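/- arXiv:1412.0076 — 8 statements merged into one kernel-verified Lean document; each statement's English description precedes it below -/
import Mathlib

section
/- Let M, N be finite, let a ∈ C¹[-M, N] and b ∈ C¹[-M, N] with a > 0 on [-M, N], let C(x) = ∫_θ^x (b/a)(t) dt, and define μ(dx) = (e^{C(x)}/a(x)) dx on (-M, N) with π = μ/μ(-M, N). Define λ₁ = inf{ ∫_{-M}^N f'(x)² e^{C(x)} dx : f absolutely continuous, ∫ f dπ = 0, ∫ f² dμ = 1 }, and define λ_S = sup_{f ∈ F} inf_{x ∈ (-M,N)} (-L_S f/f)(x), where L_S f = a f'' + (a' + b) f' + b' f and F = { f ∈ C¹[-M, N] ∩ C²(-M, N) : f(-M) = f(N) = 0, f > 0 on (-M, N) }. Then λ₁ = λ_S. -/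
open MeasureTheory Real Set Filter Topology ENNReal

/-- Prufer vector field. -/
noncomputable def prufV (p w : ℝ → ℝ) (l : ℝ) (t x : ℝ) : ℝ := cos x ^ 2 / p t + l * w t * sin x ^ 2

lemma prufV_lip (p w : ℝ → ℝ) (l t P W : ℝ) (hp : 0 < p t) (hP : 1 / p t ≤ P)
    (hw : 0 < w t) (hW : w t ≤ W) :
    LipschitzWith (Real.toNNReal (2 * P + 2 * |l| * W)) (prufV p w l t) := by
  have h0 : 0 < 1 / p t := by positivity
  have hP0 : 0 < P := h0.trans_le hP
  have hW0 : 0 < W := hw.trans_le hW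
  have hd : ∀ x, HasDerivAt (prufV p w l t)
      ((2 * cos x * (- sin x)) / p t + l * w t * (2 * sin x * cos x)) x := by
    intro x
    unfold prufV
    have h1 := ((hasDerivAt_cos x).pow 2).div_const (p t)
    have h2 := ((hasDerivAt_sin x).pow 2).const_mul (l * w t)
    exact (h1.add h2).congr_deriv (by norm_num)
  refine lipschitzWith_of_nnnorm_deriv_le (fun x => (hd x).differentiableAt) ?_
  intro x
  rw [(hd x).deriv, ← NNReal.coe_le_coe, coe_nnnorm,
    Real.coe_toNNReal _ (by positivity)]
  have hs : |sin x| ≤ 1 := abs_sin_le_one x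
  have hc : |cos x| ≤ 1 := abs_cos_le_one x
  have hsc : |sin x| * |cos x| ≤ 1 := by
    nlinarith [abs_nonneg (sin x), abs_nonneg (cos x)]
  refine (norm_add_le _ _).trans ?_
  simp only [Real.norm_eq_abs, abs_mul, abs_div, abs_neg, abs_two, abs_of_pos hp, abs_of_pos hw]
  have e1 : 2 * |cos x| * |sin x| / p t = 2 * (1 / p t) * (|sin x| * |cos x|) := by ring
  have e2 : |l| * w t * (2 * |sin x| * |cos x|) = 2 * |l| * w t * (|sin x| * |cos x|) := by ring
  rw [e1, e2]
  have f1 : 2 * (1 / p t) * (|sin x| * |cos x|) ≤ 2 * (1 / p t) * 1 := by gcongr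
  have f2 : 2 * |l| * w t * (|sin x| * |cos x|) ≤ 2 * |l| * w t * 1 := by gcongr
  have f3 : 2 * |l| * w t ≤ 2 * |l| * W := by gcongr
  linarith

lemma exists_bounds (α β : ℝ) (p w : ℝ → ℝ) (hpc : ContinuousOn p (Icc α β))
    (hwc : ContinuousOn w (Icc α β)) (hp : ∀ t ∈ Icc α β, 0 < p t) :
    ∃ P W : ℝ, ∀ t ∈ Icc α β, 1 / p t ≤ P ∧ w t ≤ W := by
  obtain ⟨P, hP⟩ := (isCompact_Icc (a := α) (b := β)).bddAbove_image
    (f := fun t => 1 / p t) (continuousOn_const.div hpc fun t ht => (hp t ht).ne')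
  obtain ⟨W, hW⟩ := (isCompact_Icc (a := α) (b := β)).bddAbove_image hwc
  exact ⟨P, W, fun t ht => ⟨hP (mem_image_of_mem _ ht), hW (mem_image_of_mem _ ht)⟩⟩

lemma pruf_exists (α β : ℝ) (hab : α < β) (p w : ℝ → ℝ) (hpc : ContinuousOn p (Icc α β))
    (hwc : ContinuousOn w (Icc α β)) (hp : ∀ t ∈ Icc α β, 0 < p t) (hw : ∀ t ∈ Icc α β, 0 < w t)
    (l : ℝ) : ∃ φ : ℝ → ℝ, φ α = 0 ∧
      ∀ t ∈ Icc α β, HasDerivWithinAt φ (prufV p w l t (φ t)) (Icc α β) t := by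
  obtain ⟨P, W, hPW⟩ := exists_bounds α β p w hpc hwc hp
  have hα : α ∈ Icc α β := left_mem_Icc.2 hab.le
  have hP0 : 0 < P := lt_of_lt_of_le (by have := hp α hα; positivity) (hPW α hα).1
  have hW0 : 0 < W := lt_of_lt_of_le (hw α hα) (hPW α hα).2
  have : IsPicardLindelof (prufV p w l) (tmin := α) (tmax := β) ⟨α, hα⟩ 0
      (Real.toNNReal ((P + |l| * W) * (β - α))) 0 (Real.toNNReal (P + |l| * W))
      (Real.toNNReal (2 * P + 2 * |l| * W)) := by
    have hba : 0 < β - α := sub_pos.2 hab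
    refine ⟨fun t ht => (prufV_lip p w l t P W (hp t ht) (hPW t ht).1 (hw t ht)
      (hPW t ht).2).lipschitzOnWith, ?_, ?_, ?_⟩
    · intro x _
      unfold prufV
      exact (continuousOn_const.div hpc fun t ht => (hp t ht).ne').add
        ((continuousOn_const.mul hwc).mul continuousOn_const)
    · intro t ht x _
      rw [Real.coe_toNNReal _ (by positivity)]
      unfold prufV
      have hpt := hp t ht
      have hwt := hw t ht
      have h1 : cos x ^ 2 ≤ 1 := cos_sq_le_one x
      have h2 : sin x ^ 2 ≤ 1 := sin_sq_le_one x
      refine (norm_add_le _ _).trans ?_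
      simp only [Real.norm_eq_abs, abs_mul, abs_div, abs_of_pos hpt, abs_of_pos hwt, abs_pow, sq_abs]
      have f1 : cos x ^ 2 / p t ≤ P := le_trans (by gcongr) (hPW t ht).1
      have f2 : |l| * w t * sin x ^ 2 ≤ |l| * w t * 1 := by gcongr
      have f3 : |l| * w t ≤ |l| * W := by gcongr; exact (hPW t ht).2
      linarith
    · rw [Real.coe_toNNReal _ (by positivity), Real.coe_toNNReal _ (by positivity)]
      simp [max_eq_left hba.le]
  obtain ⟨φ, h0, h⟩ := this.exists_eq_forall_mem_Icc_hasDerivWithinAt₀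
  exact ⟨φ, h0, h⟩

lemma pruf_dist (α β : ℝ) (hab : α < β) (p w : ℝ → ℝ) (hpc : ContinuousOn p (Icc α β))
    (hwc : ContinuousOn w (Icc α β)) (hp : ∀ t ∈ Icc α β, 0 < p t) (hw : ∀ t ∈ Icc α β, 0 < w t)
    (l : ℝ) : ∃ K W : ℝ, ∀ (l' : ℝ) (φ ψ : ℝ → ℝ), φ α = 0 → ψ α = 0 →
      (∀ t ∈ Icc α β, HasDerivWithinAt φ (prufV p w l t (φ t)) (Icc α β) t) →
      (∀ t ∈ Icc α β, HasDerivWithinAt ψ (prufV p w l' t (ψ t)) (Icc α β) t) →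
      dist (ψ β) (φ β) ≤ gronwallBound 0 K (|l' - l| * W) (β - α) := by
  obtain ⟨P, W, hPW⟩ := exists_bounds α β p w hpc hwc hp
  refine ⟨Real.toNNReal (2 * P + 2 * |l| * W), W, ?_⟩
  intro l' φ ψ hφ0 hψ0 hφ hψ
  have key : ∀ f : ℝ → ℝ, ∀ f' : ℝ → ℝ, (∀ t ∈ Icc α β, HasDerivWithinAt f (f' t) (Icc α β) t) →
      ∀ t ∈ Ico α β, HasDerivWithinAt f (f' t) (Ici t) t := by
    intro f f' h t ht
    exact (h t (Ico_subset_Icc_self ht)).mono_of_mem_nhdsWithin (Icc_mem_nhdsGE_of_mem ht)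
  have := dist_le_of_approx_trajectories_ODE_of_mem (v := prufV p w l) (s := fun _ => univ)
    (K := Real.toNNReal (2 * P + 2 * |l| * W)) (f := ψ) (g := φ) (a := α) (b := β)
    (εf := |l' - l| * W) (εg := 0) (δ := 0)
    (fun t ht => by
      have ht' := Ico_subset_Icc_self ht
      exact (prufV_lip p w l t P W (hp t ht') (hPW t ht').1 (hw t ht') (hPW t ht').2).lipschitzOnWith)
    (fun t ht => (hψ t ht).continuousWithinAt) (key _ _ hψ)
    (fun t ht => by
      have ht' := Ico_subset_Icc_self ht
      have hwt := hw t ht'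
      have h2 : sin (ψ t) ^ 2 ≤ 1 := sin_sq_le_one _
      rw [Real.dist_eq]
      unfold prufV
      have : cos (ψ t) ^ 2 / p t + l' * w t * sin (ψ t) ^ 2 -
        (cos (ψ t) ^ 2 / p t + l * w t * sin (ψ t) ^ 2) = (l' - l) * w t * sin (ψ t) ^ 2 := by ring
      rw [this, abs_mul, abs_mul, abs_of_pos hwt, abs_pow, sq_abs]
      have f2 : |l' - l| * w t * sin (ψ t) ^ 2 ≤ |l' - l| * w t * 1 := by gcongr
      have f3 : |l' - l| * w t ≤ |l' - l| * W := by gcongr; exact (hPW t ht').2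
      linarith)
    (fun _ _ => trivial)
    (fun t ht => (hφ t ht).continuousWithinAt) (key _ _ hφ)
    (fun t ht => by simp) (fun _ _ => trivial) (by simp [hφ0, hψ0]) β (right_mem_Icc.2 hab.le)
  simpa using this

/-- primitives of continuous functions on a closed interval -/
lemma prim_deriv (α β c : ℝ) (hc : c ∈ Icc α β) (g : ℝ → ℝ) (hg : ContinuousOn g (Icc α β)) :
    ∀ x ∈ Icc α β, HasDerivWithinAt (fun u => ∫ t in c..u, g t) (g x) (Icc α β) x := by
  intro x hx
  have : Fact (x ∈ Icc α β) := ⟨hx⟩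
  have hi : IntervalIntegrable g volume c x :=
    (hg.mono (Set.uIcc_subset_Icc hc hx)).intervalIntegrable
  exact intervalIntegral.integral_hasDerivWithinAt_right hi
    (hg.stronglyMeasurableAtFilter_nhdsWithin measurableSet_Icc x) (hg x hx)

lemma int_of_cont {α β : ℝ} (hab : α < β) {g : ℝ → ℝ} (hg : ContinuousOn g (Icc α β)) :
    IntervalIntegrable g volume α β := by
  apply ContinuousOn.intervalIntegrable
  rwa [uIcc_of_le hab.le]

lemma cwa_ratio (S : Set ℝ) (x0 : ℝ) (H s c : ℝ → ℝ) (h d : ℝ)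
    (hH : HasDerivWithinAt H h S x0) (hs : HasDerivWithinAt s d S x0)
    (hc : ContinuousWithinAt c S x0) (hd : s x0 = 0 → d ≠ 0) (hH0 : s x0 = 0 → H x0 = 0) :
    ContinuousWithinAt (fun x => H x ^ 2 * (c x / s x)) S x0 := by
  by_cases h0 : s x0 = 0
  · rw [← continuousWithinAt_sdiff_self]
    have hHx := hH0 h0
    have t1 := hasDerivWithinAt_iff_tendsto_slope.1 hH
    have t2 := hasDerivWithinAt_iff_tendsto_slope.1 hs
    have t3 := (t1.div t2 (hd h0))
    have t4 : Tendsto (fun x => H x * (slope H x0 x / slope s x0 x) * c x)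
        (𝓝[S \ {x0}] x0) (𝓝 (H x0 * (h / d) * c x0)) :=
      ((hH.continuousWithinAt.mono sdiff_subset).tendsto.mul t3).mul
        (hc.mono sdiff_subset).tendsto
    unfold ContinuousWithinAt
    simp only [hHx, h0] at t4 ⊢
    simp only [zero_mul, ne_eq, OfNat.ofNat_ne_zero, not_false_eq_true, zero_pow] at t4 ⊢
    refine t4.congr' ?_
    filter_upwards [self_mem_nhdsWithin] with x hx
    have hne : x - x0 ≠ 0 := sub_ne_zero.2 hx.2
    simp only [slope_def_field, hHx, h0, sub_zero]
    by_cases hsx : s x = 0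
    · simp [hsx]
    · field_simp
  · exact (hH.continuousWithinAt.pow 2).mul (hc.div hs.continuousWithinAt h0)

lemma picone (α β : ℝ) (hab : α < β) (p w : ℝ → ℝ) (hpc : ContinuousOn p (Icc α β))
    (hwc : ContinuousOn w (Icc α β)) (hp : ∀ t ∈ Icc α β, 0 < p t)
    (l : ℝ) (φ : ℝ → ℝ) 
    (hφ : ∀ t ∈ Icc α β, HasDerivWithinAt φ (prufV p w l t (φ t)) (Icc α β) t)
    (hφI : ∀ t ∈ Ioo α β, φ t ∈ Ioo 0 π)
    (H H' : ℝ → ℝ) (hH : ∀ t ∈ Icc α β, HasDerivWithinAt H (H' t) (Icc α β) t)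
    (hH' : ContinuousOn H' (Icc α β)) (hHα : H α = 0) (hHβ : H β = 0) :
    l * ∫ x in α..β, w x * H x ^ 2 ≤ ∫ x in α..β, p x * H' x ^ 2 := by
  have hHc : ContinuousOn H (Icc α β) := fun t ht => (hH t ht).continuousWithinAt
  have hα : α ∈ Icc α β := left_mem_Icc.2 hab.le
  have hβ : β ∈ Icc α β := right_mem_Icc.2 hab.le
  set g : ℝ → ℝ := fun x => p x * H' x ^ 2 - l * (w x * H x ^ 2) with hg
  have c1 : ContinuousOn (fun x => p x * H' x ^ 2) (Icc α β) := hpc.mul (hH'.pow 2)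
  have c2 : ContinuousOn (fun x => l * (w x * H x ^ 2)) (Icc α β) :=
    continuousOn_const.mul (hwc.mul (hHc.pow 2))
  have hgc : ContinuousOn g (Icc α β) := c1.sub c2
  have hD := prim_deriv α β α hα g hgc
  have hs : ∀ t ∈ Icc α β, HasDerivWithinAt (fun x => sin (φ x))
      (cos (φ t) * prufV p w l t (φ t)) (Icc α β) t := fun t ht => (hφ t ht).sin
  have hc : ∀ t ∈ Icc α β, HasDerivWithinAt (fun x => cos (φ x))
      (-sin (φ t) * prufV p w l t (φ t)) (Icc α β) t := fun t ht => (hφ t ht).cos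
  set E : ℝ → ℝ := fun x => (∫ t in α..x, g t) - H x ^ 2 * (cos (φ x) / sin (φ x)) with hE
  have hspos : ∀ t ∈ Ioo α β, 0 < sin (φ t) := fun t ht =>
    sin_pos_of_pos_of_lt_pi (hφI t ht).1 (hφI t ht).2
  have hEc : ContinuousOn E (Icc α β) := by
    intro t ht
    refine (hD t ht).continuousWithinAt.sub ?_
    refine cwa_ratio _ t H (fun x => sin (φ x)) (fun x => cos (φ x)) _ _ (hH t ht) (hs t ht)
      (hc t ht).continuousWithinAt ?_ ?_
    · intro h0
      have hcne : cos (φ t) ≠ 0 := by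
        intro hc0
        have := sin_sq_add_cos_sq (φ t)
        rw [h0, hc0] at this; norm_num at this
      unfold prufV
      rw [h0]
      have := hp t ht
      simp only [ne_eq, OfNat.ofNat_ne_zero, not_false_eq_true, zero_pow, mul_zero, add_zero]
      positivity
    · intro h0
      rcases eq_or_lt_of_le ht.1 with h | h
      · rw [← h]; exact hHα
      rcases eq_or_lt_of_le ht.2 with h' | h'
      · rw [h']; exact hHβ
      exact absurd h0 (hspos t ⟨h, h'⟩).ne'
  have hmono : MonotoneOn E (Icc α β) := by
    have hder : ∀ t ∈ Ioo α β, ∃ e, 0 ≤ e ∧ HasDerivAt E e t := by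
      intro t ht
      have ht' := Ioo_subset_Icc_self ht
      have hn := Icc_mem_nhds ht.1 ht.2
      have d1 := (hD t ht').hasDerivAt hn
      have d2 := (hH t ht').hasDerivAt hn
      have d3 := (hs t ht').hasDerivAt hn
      have d4 := (hc t ht').hasDerivAt hn
      have hsn := (hspos t ht).ne'
      have hpt := hp t ht'
      refine ⟨_, ?_, d1.sub ((d2.pow 2).mul (d4.div d3 hsn))⟩
      have e1 : cos (φ t) ^ 2 = 1 - sin (φ t) ^ 2 := cos_sq' _
      have : 0 ≤ p t * (H' t - H t * (cos (φ t) / sin (φ t)) / p t) ^ 2 := by positivity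
      refine this.trans_eq ?_
      simp only [hg, prufV, Pi.pow_apply]
      push_cast
      field_simp
      generalize sin (φ t) = S at *
      generalize cos (φ t) = c at *
      have e4 : c ^ 4 = (1 - S ^ 2) ^ 2 := by rw [← e1]; ring
      ring_nf
      simp only [e4, e1]
      ring
    apply monotoneOn_of_deriv_nonneg (convex_Icc α β) hEc
    · rw [interior_Icc]
      intro t ht
      obtain ⟨e, _, he⟩ := hder t ht
      exact he.differentiableAt.differentiableWithinAt
    · rw [interior_Icc]
      intro t ht
      obtain ⟨e, h0, he⟩ := hder t ht
      rwa [he.deriv]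
  have := hmono hα hβ hab.le
  simp only [hE, hHα, hHβ, intervalIntegral.integral_same, hg] at this
  rw [intervalIntegral.integral_sub (int_of_cont hab c1) (int_of_cont hab c2),
    intervalIntegral.integral_const_mul] at this
  linarith

lemma pruf_zero (α β : ℝ) (hab : α < β) (p w : ℝ → ℝ) (hpc : ContinuousOn p (Icc α β))
    (hwc : ContinuousOn w (Icc α β)) (hp : ∀ t ∈ Icc α β, 0 < p t) (hw : ∀ t ∈ Icc α β, 0 < w t)
    (φ : ℝ → ℝ) (h0 : φ α = 0)
    (hφ : ∀ t ∈ Icc α β, HasDerivWithinAt φ (prufV p w 0 t (φ t)) (Icc α β) t) : φ β < π := by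
  have hα : α ∈ Icc α β := left_mem_Icc.2 hab.le
  have hI := prim_deriv α β α hα (fun t => 1 / p t)
    (continuousOn_const.div hpc fun t ht => (hp t ht).ne')
  obtain ⟨K, W, hK⟩ := pruf_dist α β hab p w hpc hwc hp hw 0
  have := hK 0 φ (fun x => arctan (∫ t in α..x, 1 / p t)) h0 (by simp) hφ (by
    intro t ht
    refine (hI t ht).arctan.congr_deriv ?_
    simp only [prufV, cos_sq_arctan]
    ring)
  simp only [sub_self, abs_zero, zero_mul, gronwallBound_ε0_δ0] at this
  have e := dist_le_zero.1 this
  rw [← e]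
  have := arctan_lt_pi_div_two (∫ t in α..β, 1 / p t)
  linarith [pi_pos]

lemma pruf_mono (α β : ℝ) (p w : ℝ → ℝ)
    (hp : ∀ t ∈ Icc α β, 0 < p t) (hw : ∀ t ∈ Icc α β, 0 < w t)
    (l : ℝ) (hl : 0 < l) (φ : ℝ → ℝ)
    (hφ : ∀ t ∈ Icc α β, HasDerivWithinAt φ (prufV p w l t (φ t)) (Icc α β) t) :
    StrictMonoOn φ (Icc α β) := by
  apply strictMonoOn_of_deriv_pos (convex_Icc α β) (fun t ht => (hφ t ht).continuousWithinAt)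
  rw [interior_Icc]
  intro t ht
  have ht' := Ioo_subset_Icc_self ht
  rw [((hφ t ht').hasDerivAt (Icc_mem_nhds ht.1 ht.2)).deriv]
  unfold prufV
  have h1 := hp t ht'
  have h2 := hw t ht'
  by_cases hc : cos (φ t) = 0
  · have : sin (φ t) ^ 2 = 1 := by rw [sin_sq, hc]; norm_num
    rw [this, hc]
    norm_num
    positivity
  · positivity

lemma pruf_eigen (α β : ℝ) (hab : α < β) (p w : ℝ → ℝ) (hpc : ContinuousOn p (Icc α β))
    (hwc : ContinuousOn w (Icc α β)) (hp : ∀ t ∈ Icc α β, 0 < p t) (hw : ∀ t ∈ Icc α β, 0 < w t) :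
    ∃ (l : ℝ) (φ : ℝ → ℝ), 0 < l ∧ φ α = 0 ∧ φ β = π ∧ (∀ t ∈ Ioo α β, φ t ∈ Ioo 0 π) ∧
      ∀ t ∈ Icc α β, HasDerivWithinAt φ (prufV p w l t (φ t)) (Icc α β) t := by
  have hα : α ∈ Icc α β := left_mem_Icc.2 hab.le
  have hβ : β ∈ Icc α β := right_mem_Icc.2 hab.le
  choose φ h0 hφ using pruf_exists α β hab p w hpc hwc hp hw
  have hcont : Continuous fun l => φ l β := by
    rw [continuous_iff_continuousAt]
    intro l
    obtain ⟨K, W, hK⟩ := pruf_dist α β hab p w hpc hwc hp hw l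
    unfold ContinuousAt
    rw [tendsto_iff_dist_tendsto_zero]
    refine squeeze_zero (fun _ => dist_nonneg)
      (fun l' => hK l' (φ l) (φ l') (h0 l) (h0 l') (hφ l) (hφ l')) ?_
    have : Continuous fun l' => gronwallBound 0 K (|l' - l| * W) (β - α) :=
      (gronwallBound_continuous_ε 0 K (β - α)).comp (by fun_prop)
    have h := this.tendsto l
    simpa [gronwallBound_ε0_δ0] using h
  have hin : ∀ l, 0 < l → φ l β ≤ π → ∀ t ∈ Ioo α β, φ l t ∈ Ioo 0 π := by
    intro l hl hle t ht
    have hm := pruf_mono α β p w hp hw l hl (φ l) (hφ l)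
    have ht' := Ioo_subset_Icc_self ht
    have a1 := hm hα ht' ht.1
    have a2 := hm ht' hβ ht.2
    rw [h0] at a1
    exact ⟨a1, a2.trans_le hle⟩
  obtain ⟨L, hL, hLπ⟩ : ∃ L, 0 < L ∧ π ≤ φ L β := by
    set H : ℝ → ℝ := fun x => (x - α) * (β - x) with hH
    set H' : ℝ → ℝ := fun x => 1 * (β - x) + (x - α) * (0 - 1) with hH'
    have hd : ∀ t ∈ Icc α β, HasDerivWithinAt H (H' t) (Icc α β) t := by
      intro t _
      exact ((((hasDerivAt_id t).sub_const α).mul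
        ((hasDerivAt_const t β).sub (hasDerivAt_id t))).hasDerivWithinAt).congr_deriv (by simp [hH'])
    have hH'c : ContinuousOn H' (Icc α β) := by fun_prop
    have hHc : ContinuousOn H (Icc α β) := by fun_prop
    have hA : 0 < ∫ x in α..β, w x * H x ^ 2 := by
      apply intervalIntegral.intervalIntegral_pos_of_pos_on
        (int_of_cont hab (hwc.mul (hHc.pow 2))) _ hab
      intro x hx
      have h1 := hw x (Ioo_subset_Icc_self hx)
      have h2 : 0 < x - α := sub_pos.2 hx.1
      have h3 : 0 < β - x := sub_pos.2 hx.2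
      have h4 : 0 < H x := mul_pos h2 h3
      exact mul_pos h1 (pow_pos h4 2)
    set A := ∫ x in α..β, w x * H x ^ 2
    set B := ∫ x in α..β, p x * H' x ^ 2 with hB
    have hLp : 0 < |B| / A + 1 := by positivity
    refine ⟨|B| / A + 1, hLp, ?_⟩
    by_contra hlt
    push Not at hlt
    have := picone α β hab p w hpc hwc hp _ _ (hφ (|B| / A + 1)) (hin _ hLp hlt.le) H H' hd hH'c
      (by simp [hH]) (by simp [hH])
    have e : (|B| / A + 1) * A = |B| + A := by field_simp
    change (|B| / A + 1) * A ≤ B at this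
    rw [e] at this
    linarith [le_abs_self B]
  have hz := pruf_zero α β hab p w hpc hwc hp hw (φ 0) (h0 0) (hφ 0)
  obtain ⟨l, hl, hlπ⟩ := intermediate_value_Icc hL.le hcont.continuousOn ⟨hz.le, hLπ⟩
  simp only at hlπ
  have hlpos : 0 < l := by
    rcases eq_or_lt_of_le hl.1 with h | h
    · rw [← h] at hlπ; exact absurd hlπ hz.ne
    · exact h
  exact ⟨l, φ l, hlpos, h0 l, hlπ, hin l hlpos hlπ.le, hφ l⟩

theorem sl_eigen (α β : ℝ) (hab : α < β) (p w : ℝ → ℝ) (hpc : ContinuousOn p (Icc α β))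
    (hwc : ContinuousOn w (Icc α β)) (hp : ∀ t ∈ Icc α β, 0 < p t) (hw : ∀ t ∈ Icc α β, 0 < w t) :
    ∃ (l : ℝ) (G z : ℝ → ℝ), 0 < l ∧ G α = 0 ∧ G β = 0 ∧ (∀ t ∈ Ioo α β, 0 < G t) ∧
      (∀ t ∈ Icc α β, HasDerivWithinAt G (z t / p t) (Icc α β) t) ∧
      (∀ t ∈ Icc α β, HasDerivWithinAt z (-l * (w t * G t)) (Icc α β) t) ∧
      ∀ H H' : ℝ → ℝ, (∀ t ∈ Icc α β, HasDerivWithinAt H (H' t) (Icc α β) t) →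
        ContinuousOn H' (Icc α β) → H α = 0 → H β = 0 →
        l * ∫ x in α..β, w x * H x ^ 2 ≤ ∫ x in α..β, p x * H' x ^ 2 := by
  have hα : α ∈ Icc α β := left_mem_Icc.2 hab.le
  obtain ⟨l, φ, hl, h0, hπ, hin, hφ⟩ := pruf_eigen α β hab p w hpc hwc hp hw
  have hφc : ContinuousOn φ (Icc α β) := fun t ht => (hφ t ht).continuousWithinAt
  have hI := prim_deriv α β α hα (fun t => (1 / p t - l * w t) * (sin (φ t) * cos (φ t)))
    (((continuousOn_const.div hpc fun t ht => (hp t ht).ne').sub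
      (continuousOn_const.mul hwc)).mul
      ((continuous_sin.comp_continuousOn hφc).mul (continuous_cos.comp_continuousOn hφc)))
  set J : ℝ → ℝ := fun u => ∫ t in α..u, (1 / p t - l * w t) * (sin (φ t) * cos (φ t)) with hJ
  refine ⟨l, fun x => exp (J x) * sin (φ x), fun x => exp (J x) * cos (φ x), hl, by simp [h0],
    by simp [hπ], ?_, ?_, ?_, ?_⟩
  · intro t ht
    have := sin_pos_of_pos_of_lt_pi (hin t ht).1 (hin t ht).2
    positivity
  · intro t ht
    refine ((hI t ht).exp.mul (hφ t ht).sin).congr_deriv ?_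
    have e1 : sin (φ t) ^ 2 = 1 - cos (φ t) ^ 2 := sin_sq _
    have := hp t ht
    unfold prufV
    field_simp
    linear_combination (cos (φ t) ) * e1
  · intro t ht
    refine ((hI t ht).exp.mul (hφ t ht).cos).congr_deriv ?_
    have e1 : sin (φ t) ^ 2 = 1 - cos (φ t) ^ 2 := sin_sq _
    have := hp t ht
    unfold prufV
    field_simp
    linear_combination (- p t * l * w t * sin (φ t)) * e1
  · intro H H' h1 h2 h3 h4
    exact picone α β hab p w hpc hwc hp l φ hφ hin H H' h1 h2 h3 h4

lemma int_congr_Ioo {α β : ℝ} (hab : α < β) {f g : ℝ → ℝ} (h : ∀ x ∈ Ioo α β, f x = g x) :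
    ∫ x in α..β, f x = ∫ x in α..β, g x := by
  rw [intervalIntegral.integral_of_le hab.le, intervalIntegral.integral_of_le hab.le,
    integral_Ioc_eq_integral_Ioo, integral_Ioc_eq_integral_Ioo]
  exact setIntegral_congr_fun measurableSet_Ioo h

lemma lower_bound (α β : ℝ) (hab : α < β) (a C : ℝ → ℝ) (hac : ContinuousOn a (Icc α β))
    (hCc : ContinuousOn C (Icc α β)) (hapos : ∀ t ∈ Icc α β, 0 < a t) (l : ℝ) (hl : 0 < l)
    (hpoin : ∀ H H' : ℝ → ℝ, (∀ t ∈ Icc α β, HasDerivWithinAt H (H' t) (Icc α β) t) →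
        ContinuousOn H' (Icc α β) → H α = 0 → H β = 0 →
        l * ∫ x in α..β, exp (- C x) * H x ^ 2 ≤ ∫ x in α..β, (a x * exp (- C x)) * H' x ^ 2)
    (f f' : ℝ → ℝ) (hf : ∀ x ∈ Ioo α β, HasDerivAt f (f' x) x)
    (h0 : ∫ x in α..β, f x * (exp (C x) / a x) = 0)
    (h1 : ∫ x in α..β, f x ^ 2 * (exp (C x) / a x) = 1)
    (hint : IntervalIntegrable (fun x => f' x ^ 2 * exp (C x)) volume α β) :
    l ≤ ∫ x in α..β, f' x ^ 2 * exp (C x) := by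
  have hα : α ∈ Icc α β := left_mem_Icc.2 hab.le
  have hβ : β ∈ Icc α β := right_mem_Icc.2 hab.le
  have huI : uIcc α β = Icc α β := uIcc_of_le hab.le
  have hEc : ContinuousOn (fun x => exp (C x)) (Icc α β) := hCc.rexp
  have hEnc : ContinuousOn (fun x => exp (- C x)) (Icc α β) := hCc.neg.rexp
  -- integrability of f'
  have hf'i : IntervalIntegrable f' volume α β := by
    have hb : IntervalIntegrable (fun x => 1 + exp (- C x) * (f' x ^ 2 * exp (C x)))
        volume α β := by
      refine (intervalIntegrable_const).add (hint.continuousOn_mul ?_)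
      rwa [huI]
    rw [intervalIntegrable_iff_integrableOn_Ioo_of_le hab.le] at hb ⊢
    refine Integrable.mono' hb ?_ ?_
    · refine (measurable_deriv f).aestronglyMeasurable.congr ?_
      filter_upwards [ae_restrict_mem measurableSet_Ioo] with x hx
      exact (hf x hx).deriv
    · refine Eventually.of_forall fun x => ?_
      have : exp (- C x) * (f' x ^ 2 * exp (C x)) = f' x ^ 2 := by
        rw [mul_comm (f' x ^ 2), ← mul_assoc, ← exp_add]; simp
      rw [this, Real.norm_eq_abs]
      nlinarith [sq_abs (f' x), sq_nonneg (|f' x| - 1), abs_nonneg (f' x)]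
  set m := (α + β) / 2 with hm
  have hmI : m ∈ Ioo α β := ⟨by linarith, by linarith⟩
  set F : ℝ → ℝ := fun x => f m + ∫ t in m..x, f' t with hF
  have hFc : ContinuousOn F (Icc α β) := by
    have := intervalIntegral.continuousOn_primitive_interval' hf'i
      (a := m) (by rw [huI]; exact Ioo_subset_Icc_self hmI)
    rw [huI] at this
    exact continuousOn_const.add this
  have hFf : ∀ x ∈ Ioo α β, F x = f x := by
    intro x hx
    have hsub : uIcc m x ⊆ Ioo α β := by
      intro y hy
      rw [mem_uIcc] at hy
      rcases hy with hy | hy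
      · exact ⟨by linarith [hmI.1], by linarith [hx.2]⟩
      · exact ⟨by linarith [hx.1], by linarith [hmI.2]⟩
    have := intervalIntegral.integral_eq_sub_of_hasDerivAt (a := m) (b := x)
      (fun y hy => hf y (hsub hy)) (hf'i.mono_set (by
        rw [huI]; exact hsub.trans Ioo_subset_Icc_self))
    simp only [hF, this]; ring
  have hFd : ∀ x ∈ Ioo α β, HasDerivAt F (f' x) x := by
    intro x hx
    refine (hf x hx).congr_of_eventuallyEq ?_
    filter_upwards [Ioo_mem_nhds hx.1 hx.2] with y hy using hFf y hy
  set H' : ℝ → ℝ := fun x => F x * (exp (C x) / a x) with hH'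
  have hH'c : ContinuousOn H' (Icc α β) :=
    hFc.mul (hEc.div hac fun t ht => (hapos t ht).ne')
  have hHd := prim_deriv α β α hα H' hH'c
  set H : ℝ → ℝ := fun x => ∫ t in α..x, H' t with hH
  have hHc : ContinuousOn H (Icc α β) := fun t ht => (hHd t ht).continuousWithinAt
  have hHα : H α = 0 := by simp [hH]
  have hHβ : H β = 0 := by
    rw [← h0]
    exact int_congr_Ioo hab fun x hx => by simp only [hH', hFf x hx]
  have hP := hpoin H H' hHd hH'c hHα hHβ
  have e1 : ∫ x in α..β, (a x * exp (- C x)) * H' x ^ 2 = 1 := by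
    rw [← h1]
    refine int_congr_Ioo hab fun x hx => ?_
    have := hapos x (Ioo_subset_Icc_self hx)
    simp only [hH', hFf x hx, exp_neg]
    field_simp
  have e2 : ∫ x in α..β, F x * H' x = 1 := by
    rw [← h1]
    refine int_congr_Ioo hab fun x hx => ?_
    simp only [hH', hFf x hx]
    ring
  have e3 := intervalIntegral.integral_mul_deriv_eq_deriv_mul_of_hasDerivAt
    (u := F) (v := H) (u' := f') (v' := H') (a := α) (b := β) (by rwa [huI]) (by rwa [huI])
    (by rw [min_eq_left hab.le, max_eq_right hab.le]; exact hFd)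
    (by
      rw [min_eq_left hab.le, max_eq_right hab.le]
      exact fun x hx => (hHd x (Ioo_subset_Icc_self hx)).hasDerivAt (Icc_mem_nhds hx.1 hx.2))
    hf'i (int_of_cont hab hH'c)
  rw [e2, hHα, hHβ] at e3
  have i2 : IntervalIntegrable (fun x => f' x * H x) volume α β :=
    hf'i.mul_continuousOn (by rwa [huI])
  have i3 : IntervalIntegrable (fun x => exp (- C x) * H x ^ 2) volume α β :=
    int_of_cont hab (hEnc.mul (hHc.pow 2))
  have e4 : 0 ≤ ∫ x in α..β, (f' x ^ 2 * exp (C x) + (2 * l) * (f' x * H x)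
      + l ^ 2 * (exp (- C x) * H x ^ 2)) := by
    refine intervalIntegral.integral_nonneg hab.le fun x _ => ?_
    have : f' x ^ 2 * exp (C x) + (2 * l) * (f' x * H x) + l ^ 2 * (exp (- C x) * H x ^ 2)
        = exp (C x) * (f' x + l * exp (- C x) * H x) ^ 2 := by
      rw [exp_neg]
      field_simp
      ring
    rw [this]
    positivity
  rw [intervalIntegral.integral_add (hint.add (i2.const_mul _)) (i3.const_mul _),
    intervalIntegral.integral_add hint (i2.const_mul _),
    intervalIntegral.integral_const_mul, intervalIntegral.integral_const_mul] at e4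
  rw [e1] at hP
  nlinarith

lemma upper_S (α β : ℝ) (hab : α < β) (a a' b b' C G z : ℝ → ℝ) (l : ℝ)
    (ha : ∀ x ∈ Icc α β, HasDerivWithinAt a (a' x) (Icc α β) x)
    (hb : ∀ x ∈ Icc α β, HasDerivWithinAt b (b' x) (Icc α β) x)
    (hapos : ∀ t ∈ Icc α β, 0 < a t)
    (hC : ∀ x ∈ Icc α β, HasDerivWithinAt C (b x / a x) (Icc α β) x)
    (hGα : G α = 0) (hGβ : G β = 0) (hGpos : ∀ t ∈ Ioo α β, 0 < G t)
    (hG : ∀ t ∈ Icc α β, HasDerivWithinAt G (z t / (a t * exp (- C t))) (Icc α β) t)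
    (hz : ∀ t ∈ Icc α β, HasDerivWithinAt z (-l * (exp (- C t) * G t)) (Icc α β) t)
    (f f' f'' : ℝ → ℝ)
    (hf : ∀ x ∈ Icc α β, HasDerivWithinAt f (f' x) (Icc α β) x)
    (hf'c : ContinuousOn f' (Icc α β))
    (hf' : ∀ x ∈ Ioo α β, HasDerivAt f' (f'' x) x)
    (hfα : f α = 0) (hfβ : f β = 0) (hfpos : ∀ x ∈ Ioo α β, 0 < f x) (r : ℝ)
    (hr : ∀ x ∈ Ioo α β, r ≤ -(a x * f'' x + (a' x + b x) * f' x + b' x * f x) / f x) :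
    r ≤ l := by
  by_contra hlt
  push Not at hlt
  set V : ℝ → ℝ := fun x => z x * (exp (C x) * f x) - (a x * f' x + b x * f x) * G x with hV
  have cont : ∀ {u u' : ℝ → ℝ}, (∀ x ∈ Icc α β, HasDerivWithinAt u (u' x) (Icc α β) x) →
      ContinuousOn u (Icc α β) := fun h x hx => (h x hx).continuousWithinAt
  have hVc : ContinuousOn V (Icc α β) :=
    ((cont hz).mul ((cont hC).rexp.mul (cont hf))).sub
      ((((cont ha).mul hf'c).add ((cont hb).mul (cont hf))).mul (cont hG))
  have hmono : StrictMonoOn V (Icc α β) := by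
    apply strictMonoOn_of_deriv_pos (convex_Icc α β) hVc
    rw [interior_Icc]
    intro x hx
    have hx' := Ioo_subset_Icc_self hx
    have hn := Icc_mem_nhds hx.1 hx.2
    have d := (((hz x hx').hasDerivAt hn).mul (((hC x hx').hasDerivAt hn).exp.mul
      ((hf x hx').hasDerivAt hn))).sub (((((ha x hx').hasDerivAt hn).mul (hf' x hx)).add
      (((hb x hx').hasDerivAt hn).mul ((hf x hx').hasDerivAt hn))).mul ((hG x hx').hasDerivAt hn))
    have hd : HasDerivAt V (- G x * (l * f x +
        (a x * f'' x + (a' x + b x) * f' x + b' x * f x))) x := by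
      refine d.congr_deriv ?_
      have := hapos x hx'
      simp only [Pi.mul_apply, Pi.add_apply, exp_neg]
      field_simp
      ring
    rw [hd.deriv]
    have h1 := hr x hx
    have h2 := hfpos x hx
    have h3 := hGpos x hx
    rw [le_div_iff₀ h2] at h1
    have h4 : 0 < (r - l) * f x := mul_pos (sub_pos.2 hlt) h2
    rw [neg_mul, ← mul_neg]
    apply mul_pos h3
    linarith
  have := hmono (left_mem_Icc.2 hab.le) (right_mem_Icc.2 hab.le) hab
  simp [hV, hfα, hfβ, hGα, hGβ] at this

/-- Identity `λ₁ = λ_S`: the first nontrivial Neumann eigenvalue of the elliptic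
operator `L = a d²/dx² + b d/dx` on `(-M, N)`, characterized variationally, coincides
with the principal (Dirichlet) eigenvalue of the Schrödinger operator
`L_S f = a f'' + (a' + b) f' + b' f`, characterized by the sup-inf formula. -/
theorem lambda_one_eq_lambda_S
    (M N : ℝ) (hMN : -M < N)
    (a a' b b' : ℝ → ℝ)
    (ha : ∀ x ∈ Icc (-M) N, HasDerivWithinAt a (a' x) (Icc (-M) N) x)
    (hb : ∀ x ∈ Icc (-M) N, HasDerivWithinAt b (b' x) (Icc (-M) N) x)
    (ha' : ContinuousOn a' (Icc (-M) N)) (hb' : ContinuousOn b' (Icc (-M) N))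
    (hapos : ∀ x ∈ Icc (-M) N, 0 < a x)
    (θ : ℝ) (hθ : θ ∈ Ioo (-M) N)
    (C : ℝ → ℝ) (hC : ∀ x, C x = ∫ t in θ..x, b t / a t)
    (μ : Measure ℝ)
    (hμ : μ = (volume.restrict (Ioo (-M) N)).withDensity
        fun x => ENNReal.ofReal (Real.exp (C x) / a x))
    (pi : Measure ℝ) (hpi : pi = (μ (Ioo (-M) N))⁻¹ • μ)
    (lam1 lamS : ℝ)
    (hlam1 : lam1 = sInf { r : ℝ | ∃ f f' : ℝ → ℝ,
        (∀ x ∈ Ioo (-M) N, HasDerivAt f (f' x) x) ∧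
        (∫ y, f y ∂pi) = 0 ∧
        (∫ x, f x ^ 2 ∂μ) = 1 ∧
        IntervalIntegrable (fun x => f' x ^ 2 * Real.exp (C x)) volume (-M) N ∧
        r = ∫ x in (-M)..N, f' x ^ 2 * Real.exp (C x) })
    (hlamS : lamS = sSup { r : ℝ | ∃ f f' f'' : ℝ → ℝ,
        (∀ x ∈ Icc (-M) N, HasDerivWithinAt f (f' x) (Icc (-M) N) x) ∧
        ContinuousOn f' (Icc (-M) N) ∧
        (∀ x ∈ Ioo (-M) N, HasDerivAt f' (f'' x) x) ∧
        ContinuousOn f'' (Ioo (-M) N) ∧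
        f (-M) = 0 ∧ f N = 0 ∧ (∀ x ∈ Ioo (-M) N, 0 < f x) ∧
        r = sInf { s : ℝ | ∃ x ∈ Ioo (-M) N,
          s = -(a x * f'' x + (a' x + b x) * f' x + b' x * f x) / f x } }) :
    lam1 = lamS := by
  have hab := hMN
  generalize -M = α at *
  have hα : α ∈ Icc α N := left_mem_Icc.2 hab.le
  have hβ : N ∈ Icc α N := right_mem_Icc.2 hab.le
  have huI : uIcc α N = Icc α N := uIcc_of_le hab.le
  have hac : ContinuousOn a (Icc α N) := fun x hx => (ha x hx).continuousWithinAt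
  have hbc : ContinuousOn b (Icc α N) := fun x hx => (hb x hx).continuousWithinAt
  have hCd : ∀ x ∈ Icc α N, HasDerivWithinAt C (b x / a x) (Icc α N) x := by
    have := prim_deriv α N θ (Ioo_subset_Icc_self hθ) (fun t => b t / a t)
      (hbc.div hac fun t ht => (hapos t ht).ne')
    have hCe : C = fun x => ∫ t in θ..x, b t / a t := funext hC
    rw [hCe]
    exact this
  have hCc : ContinuousOn C (Icc α N) := fun x hx => (hCd x hx).continuousWithinAt
  have hwc : ContinuousOn (fun x => exp (- C x)) (Icc α N) := hCc.neg.rexp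
  have hdc : ContinuousOn (fun x => exp (C x) / a x) (Icc α N) :=
    hCc.rexp.div hac fun t ht => (hapos t ht).ne'
  have hdpos : ∀ x ∈ Icc α N, 0 < exp (C x) / a x := fun x hx => by
    have := hapos x hx; positivity
  have hdm : AEMeasurable (fun x => ENNReal.ofReal (exp (C x) / a x))
      (volume.restrict (Ioo α N)) :=
    ((hdc.mono Ioo_subset_Icc_self).aemeasurable measurableSet_Ioo).ennreal_ofReal
  have hμint : ∀ g : ℝ → ℝ, ∫ x, g x ∂μ = ∫ x in α..N, g x * (exp (C x) / a x) := by
    intro g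
    rw [hμ, integral_withDensity_eq_integral_toReal_smul₀ hdm
      (Eventually.of_forall fun _ => ENNReal.ofReal_lt_top),
      intervalIntegral.integral_of_le hab.le, integral_Ioc_eq_integral_Ioo]
    refine setIntegral_congr_fun measurableSet_Ioo fun x hx => ?_
    have := hdpos x (Ioo_subset_Icc_self hx)
    simp only [ENNReal.toReal_ofReal this.le, smul_eq_mul]
    ring
  have hμI : 0 < μ (Ioo α N) ∧ μ (Ioo α N) < ∞ := by
    have hi := int_of_cont hab hdc
    have hpos : 0 < ∫ x in α..N, exp (C x) / a x :=
      intervalIntegral.intervalIntegral_pos_of_pos_on hi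
        (fun x hx => hdpos x (Ioo_subset_Icc_self hx)) hab
    rw [intervalIntegrable_iff_integrableOn_Ioo_of_le hab.le] at hi
    have : μ (Ioo α N) = ENNReal.ofReal (∫ x in α..N, exp (C x) / a x) := by
      rw [intervalIntegral.integral_of_le hab.le, integral_Ioc_eq_integral_Ioo,
        ofReal_integral_eq_lintegral_ofReal hi, hμ, withDensity_apply _ measurableSet_Ioo,
        Measure.restrict_restrict measurableSet_Ioo, inter_self]
      filter_upwards [ae_restrict_mem measurableSet_Ioo] with x hx
      exact (hdpos x (Ioo_subset_Icc_self hx)).le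
    rw [this]
    exact ⟨ENNReal.ofReal_pos.2 hpos, ENNReal.ofReal_lt_top⟩
  have hpiint : ∀ g : ℝ → ℝ, ∫ x, g x ∂pi = 0 ↔ ∫ x in α..N, g x * (exp (C x) / a x) = 0 := by
    intro g
    rw [hpi, integral_smul_measure, hμint, smul_eq_mul, mul_eq_zero]
    refine or_iff_right ?_
    rw [ENNReal.toReal_inv]
    exact inv_ne_zero (ENNReal.toReal_pos hμI.1.ne' hμI.2.ne).ne'
  obtain ⟨l, G, z, hl, hGα, hGβ, hGpos, hG, hz, hpoin⟩ := sl_eigen α N hab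
    (fun x => a x * exp (- C x)) (fun x => exp (- C x)) (hac.mul hwc) hwc
    (fun t ht => mul_pos (hapos t ht) (exp_pos _)) (fun t _ => exp_pos _)
  have hGc : ContinuousOn G (Icc α N) := fun x hx => (hG x hx).continuousWithinAt
  have hzc : ContinuousOn z (Icc α N) := fun x hx => (hz x hx).continuousWithinAt
  have hzpc : ContinuousOn (fun t => z t / (a t * exp (- C t))) (Icc α N) :=
    hzc.div (hac.mul hwc) fun t ht => (mul_pos (hapos t ht) (exp_pos _)).ne'
  -- lam1 = l
  have h1 : lam1 = l := by
    rw [hlam1]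
    apply IsLeast.csInf_eq
    constructor
    · set A := ∫ x in α..N, exp (- C x) * G x ^ 2 with hA
      have hApos : 0 < A := by
        apply intervalIntegral.intervalIntegral_pos_of_pos_on
          (int_of_cont hab (hwc.mul (hGc.pow 2))) _ hab
        intro x hx
        have := hGpos x hx
        exact mul_pos (exp_pos _) (pow_pos this 2)
      have hz2 : ∫ x in α..N, z x * (z x / (a x * exp (- C x))) = l * A := by
        rw [intervalIntegral.integral_mul_deriv_eq_deriv_mul_of_hasDerivWithinAt
          (u := z) (v := G) (u' := fun t => -l * (exp (- C t) * G t))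
          (by rwa [huI]) (by rwa [huI])
          (int_of_cont hab (continuousOn_const.mul (hwc.mul hGc))) (int_of_cont hab hzpc),
          hGα, hGβ, hA, ← intervalIntegral.integral_const_mul]
        rw [mul_zero, mul_zero, sub_zero, zero_sub, ← intervalIntegral.integral_neg]
        exact int_congr_Ioo hab fun x _ => by ring
      have hz1 : ∫ x in α..N, z x / (a x * exp (- C x)) = 0 := by
        rw [intervalIntegral.integral_eq_sub_of_hasDerivAt_of_le hab.le hGc
          (fun x hx => (hG x (Ioo_subset_Icc_self hx)).hasDerivAt (Icc_mem_nhds hx.1 hx.2))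
          (int_of_cont hab hzpc), hGα, hGβ, sub_zero]
      have hlA : 0 < l * A := mul_pos hl hApos
      set κ := (sqrt (l * A))⁻¹ with hκ
      have hκ2 : κ ^ 2 = (l * A)⁻¹ := by rw [hκ, inv_pow, sq_sqrt hlA.le]
      have hint : ContinuousOn (fun x => (κ * (-l * (exp (- C x) * G x))) ^ 2 * exp (C x))
          (Icc α N) :=
        ((continuousOn_const.mul (continuousOn_const.mul (hwc.mul hGc))).pow 2).mul hCc.rexp
      refine ⟨fun x => κ * z x, fun x => κ * (-l * (exp (- C x) * G x)), ?_, ?_, ?_,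
        int_of_cont hab hint, ?_⟩
      · intro x hx
        exact ((hz x (Ioo_subset_Icc_self hx)).hasDerivAt (Icc_mem_nhds hx.1 hx.2)).const_mul κ
      · rw [hpiint]
        have : ∫ x in α..N, κ * z x * (exp (C x) / a x)
            = ∫ x in α..N, κ * (z x / (a x * exp (- C x))) := by
          refine int_congr_Ioo hab fun x hx => ?_
          have := hapos x (Ioo_subset_Icc_self hx)
          rw [exp_neg]
          field_simp
        rw [this, intervalIntegral.integral_const_mul, hz1, mul_zero]
      · rw [hμint]
        have : ∫ x in α..N, (κ * z x) ^ 2 * (exp (C x) / a x)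
            = ∫ x in α..N, κ ^ 2 * (z x * (z x / (a x * exp (- C x)))) := by
          refine int_congr_Ioo hab fun x hx => ?_
          have := hapos x (Ioo_subset_Icc_self hx)
          rw [exp_neg]
          field_simp
        rw [this, intervalIntegral.integral_const_mul, hz2, hκ2, inv_mul_cancel₀ hlA.ne']
      · have : ∫ x in α..N, (κ * (-l * (exp (- C x) * G x))) ^ 2 * exp (C x)
            = ∫ x in α..N, (κ ^ 2 * l ^ 2) * (exp (- C x) * G x ^ 2) := by
          refine int_congr_Ioo hab fun x hx => ?_
          rw [exp_neg]
          field_simp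
        rw [this, intervalIntegral.integral_const_mul, ← hA, hκ2]
        field_simp
    · rintro r ⟨f, f', hf, hf0, hf1, hfi, rfl⟩
      rw [hpiint] at hf0
      rw [hμint] at hf1
      exact lower_bound α N hab a C hac hCc hapos l hl hpoin f f' hf hf0 hf1 hfi
  have h2 : lamS = l := by
    rw [hlamS]
    apply IsGreatest.csSup_eq
    constructor
    · have hf : ∀ x ∈ Icc α N, HasDerivWithinAt (fun x => exp (- C x) * G x)
          (z x / a x - b x / a x * (exp (- C x) * G x)) (Icc α N) x := by
        intro x hx
        refine ((hCd x hx).neg.exp.mul (hG x hx)).congr_deriv ?_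
        have := hapos x hx
        simp only [Pi.neg_apply]
        field_simp
        ring
      have hfc : ContinuousOn (fun x => exp (- C x) * G x) (Icc α N) := hwc.mul hGc
      have hane : ∀ t ∈ Icc α N, a t ≠ 0 := fun t ht => (hapos t ht).ne'
      have hf'c : ContinuousOn (fun x => z x / a x - b x / a x * (exp (- C x) * G x))
          (Icc α N) := (hzc.div hac hane).sub ((hbc.div hac hane).mul hfc)
      refine ⟨fun x => exp (- C x) * G x,
        fun x => z x / a x - b x / a x * (exp (- C x) * G x),
        fun x => (-l * (exp (- C x) * G x)
          - (a' x + b x) * (z x / a x - b x / a x * (exp (- C x) * G x))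
          - b' x * (exp (- C x) * G x)) / a x, hf, hf'c, ?_, ?_, by simp [hGα], by simp [hGβ],
        fun x hx => mul_pos (exp_pos _) (hGpos x hx), ?_⟩
      · intro x hx
        have hx' := Ioo_subset_Icc_self hx
        have hn := Icc_mem_nhds hx.1 hx.2
        have hax := hane x hx'
        have d1 := (hz x hx').hasDerivAt hn
        have d2 := (ha x hx').hasDerivAt hn
        have d3 := (hb x hx').hasDerivAt hn
        have d4 := (hf x hx').hasDerivAt hn
        refine ((d1.div d2 hax).sub ((d3.div d2 hax).mul d4)).congr_deriv ?_
        simp only [Pi.div_apply]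
        field_simp
        ring
      · refine ContinuousOn.mono ?_ Ioo_subset_Icc_self
        exact (((continuousOn_const.mul hfc).sub ((ha'.add hbc).mul hf'c)).sub
          (hb'.mul hfc)).div hac hane
      · symm
        have key : ∀ x ∈ Ioo α N, -(a x * ((-l * (exp (- C x) * G x)
          - (a' x + b x) * (z x / a x - b x / a x * (exp (- C x) * G x))
          - b' x * (exp (- C x) * G x)) / a x) + (a' x + b x) *
          (z x / a x - b x / a x * (exp (- C x) * G x)) + b' x * (exp (- C x) * G x)) /
          (exp (- C x) * G x) = l := by
          intro x hx
          have hax := hane x (Ioo_subset_Icc_self hx)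
          have hg := hGpos x hx
          rw [mul_div_cancel₀ _ hax, div_eq_iff (by positivity)]
          ring
        apply IsLeast.csInf_eq
        constructor
        · exact ⟨θ, hθ, (key θ hθ).symm⟩
        · rintro s ⟨x, hx, rfl⟩
          exact (key x hx).ge
    · rintro r ⟨f, f', f'', hf, hf'c, hf', -, hfα, hfβ, hfpos, rfl⟩
      by_cases hbdd : BddBelow { s : ℝ | ∃ x ∈ Ioo α N,
          s = -(a x * f'' x + (a' x + b x) * f' x + b' x * f x) / f x }
      · exact upper_S α N hab a a' b b' C G z l ha hb hapos hCd hGα hGβ hGpos hG hz f f' f''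
          hf hf'c hf' hfα hfβ hfpos _ fun x hx => csInf_le hbdd ⟨x, hx, rfl⟩
      · rw [Real.sInf_of_not_bddBelow hbdd]
        exact hl.le
  rw [h1, h2]
end

section
/- Let M, N be finite, let a ∈ C¹[-M, N] and b ∈ C¹[-M, N] with a > 0 on [-M, N]. Define λ_S = sup_{f ∈ F} inf_{x ∈ (-M,N)} (-L_S f/f)(x), where L_S f = a f'' + (a' + b) f' + b' f, and define λ₀* = sup_{f ∈ F} inf_{x ∈ (-M,N)} (-L* f/f)(x), where L* f = a f'' + (a' - b) f', with F = { f ∈ C¹[-M, N] ∩ C²(-M, N) : f(-M) = f(N) = 0, f > 0 on (-M, N) } in both formulas. Then λ_S = λ₀*. -/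
open MeasureTheory Real Set Filter Topology

def FF (p q : ℝ) (f f' f'' : ℝ → ℝ) : Prop :=
  (∀ x ∈ Icc p q, HasDerivWithinAt f (f' x) (Icc p q) x) ∧
        ContinuousOn f' (Icc p q) ∧
        (∀ x ∈ Ioo p q, HasDerivAt f' (f'' x) x) ∧
        ContinuousOn f'' (Ioo p q) ∧
        f p = 0 ∧ f q = 0 ∧ (∀ x ∈ Ioo p q, 0 < f x)

theorem exists_factor (p q : ℝ) (hpq : p < q) (k : ℝ → ℝ) (hk : ContinuousOn k (Icc p q)) :
    ∃ E : ℝ → ℝ, (∀ x, 0 < E x) ∧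
      ∀ x ∈ Icc p q, HasDerivAt E (E x * k x) x := by
  have hc : Continuous (IccExtend hpq.le ((Icc p q).restrict k)) :=
    (continuousOn_iff_continuous_restrict.1 hk).Icc_extend'
  refine ⟨fun x => Real.exp (∫ t in p..x, IccExtend hpq.le ((Icc p q).restrict k) t),
    fun x => Real.exp_pos _, fun x hx => ?_⟩
  have h := (hc.integral_hasStrictDerivAt p x).hasDerivAt.exp
  rw [IccExtend_of_mem _ _ hx] at h
  exact h

theorem FF_transform {p q : ℝ} {k k' E f f' f'' : ℝ → ℝ}
    (hk : ContinuousOn k (Icc p q)) (hkd : ∀ x ∈ Ioo p q, HasDerivAt k (k' x) x)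
    (hk' : ContinuousOn k' (Ioo p q)) (hE : ∀ x, 0 < E x)
    (hEd : ∀ x ∈ Icc p q, HasDerivAt E (E x * k x) x) (h : FF p q f f' f'') :
    FF p q (fun x => E x * f x) (fun x => E x * (f' x + k x * f x))
      (fun x => E x * (f'' x + 2 * k x * f' x + (k' x + k x ^ 2) * f x)) := by
  obtain ⟨h1, h2, h3, h4, h5, h6, h7⟩ := h
  have hss : Ioo p q ⊆ Icc p q := Ioo_subset_Icc_self
  have hEc : ContinuousOn E (Icc p q) := fun x hx => (hEd x hx).continuousAt.continuousWithinAt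
  have hfc : ContinuousOn f (Icc p q) := fun x hx => (h1 x hx).continuousWithinAt
  refine ⟨fun x hx => ?_, by fun_prop, fun x hx => ?_, ?_, by simp [h5], by simp [h6],
    fun x hx => mul_pos (hE x) (h7 x hx)⟩
  · refine ((hEd x hx).hasDerivWithinAt.fun_mul (h1 x hx)).congr_deriv ?_
    ring
  · have hf : HasDerivAt f (f' x) x := (h1 x (hss hx)).hasDerivAt (Icc_mem_nhds hx.1 hx.2)
    refine ((hEd x (hss hx)).fun_mul ((h3 x hx).fun_add ((hkd x hx).fun_mul hf))).congr_deriv ?_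
    ring
  · have := hEc.mono hss
    have := hfc.mono hss
    have := hk.mono hss
    have := h2.mono hss
    fun_prop

/-- Duality identity `λ_S = λ₀*`: the sup-inf characterizations of the principal
eigenvalue of the Schrödinger operator `L_S f = a f'' + (a' + b) f' + b' f` and of
the dual operator `L* f = a f'' + (a' - b) f'` (with Dirichlet boundary conditions
at `-M` and `N`) give the same value. -/
theorem lambda_S_eq_lambda_zero_star
    (M N : ℝ) (hMN : -M < N)
    (a a' b b' : ℝ → ℝ)
    (ha : ∀ x ∈ Icc (-M) N, HasDerivWithinAt a (a' x) (Icc (-M) N) x)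
    (hb : ∀ x ∈ Icc (-M) N, HasDerivWithinAt b (b' x) (Icc (-M) N) x)
    (ha' : ContinuousOn a' (Icc (-M) N)) (hb' : ContinuousOn b' (Icc (-M) N))
    (hapos : ∀ x ∈ Icc (-M) N, 0 < a x)
    (lamS lam0star : ℝ)
    (hlamS : lamS = sSup { r : ℝ | ∃ f f' f'' : ℝ → ℝ,
        (∀ x ∈ Icc (-M) N, HasDerivWithinAt f (f' x) (Icc (-M) N) x) ∧
        ContinuousOn f' (Icc (-M) N) ∧
        (∀ x ∈ Ioo (-M) N, HasDerivAt f' (f'' x) x) ∧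
        ContinuousOn f'' (Ioo (-M) N) ∧
        f (-M) = 0 ∧ f N = 0 ∧ (∀ x ∈ Ioo (-M) N, 0 < f x) ∧
        r = sInf { s : ℝ | ∃ x ∈ Ioo (-M) N,
          s = -(a x * f'' x + (a' x + b x) * f' x + b' x * f x) / f x } })
    (hlam0star : lam0star = sSup { r : ℝ | ∃ f f' f'' : ℝ → ℝ,
        (∀ x ∈ Icc (-M) N, HasDerivWithinAt f (f' x) (Icc (-M) N) x) ∧
        ContinuousOn f' (Icc (-M) N) ∧
        (∀ x ∈ Ioo (-M) N, HasDerivAt f' (f'' x) x) ∧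
        ContinuousOn f'' (Ioo (-M) N) ∧
        f (-M) = 0 ∧ f N = 0 ∧ (∀ x ∈ Ioo (-M) N, 0 < f x) ∧
        r = sInf { s : ℝ | ∃ x ∈ Ioo (-M) N,
          s = -(a x * f'' x + (a' x - b x) * f' x) / f x } }) :
    lamS = lam0star := by
  have hss : Ioo (-M) N ⊆ Icc (-M) N := Ioo_subset_Icc_self
  have hac : ContinuousOn a (Icc (-M) N) := fun x hx => (ha x hx).continuousWithinAt
  have hbc : ContinuousOn b (Icc (-M) N) := fun x hx => (hb x hx).continuousWithinAt
  have hk : ContinuousOn (fun x => b x / a x) (Icc (-M) N) :=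
    hbc.div hac fun x hx => (hapos x hx).ne'
  have hkd : ∀ x ∈ Ioo (-M) N, HasDerivAt (fun x => b x / a x)
      ((b' x * a x - b x * a' x) / a x ^ 2) x := fun x hx =>
    ((hb x (hss hx)).hasDerivAt (Icc_mem_nhds hx.1 hx.2)).fun_div
      ((ha x (hss hx)).hasDerivAt (Icc_mem_nhds hx.1 hx.2)) (hapos x (hss hx)).ne'
  have hk' : ContinuousOn (fun x => (b' x * a x - b x * a' x) / a x ^ 2) (Ioo (-M) N) :=
    (((hb'.mul hac).sub (hbc.mul ha')).div (hac.pow 2)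
      fun x hx => pow_ne_zero 2 (hapos x hx).ne').mono hss
  obtain ⟨E, hE, hEd⟩ := exists_factor (-M) N hMN _ hk
  obtain ⟨G, hG, hGd⟩ := exists_factor (-M) N hMN _ hk.neg
  rw [hlamS, hlam0star]
  congr 1
  ext r
  simp only [mem_setOf_eq]
  constructor
  · rintro ⟨f, f', f'', h1, h2, h3, h4, h5, h6, h7, hr⟩
    obtain ⟨g1, g2, g3, g4, g5, g6, g7⟩ :=
      FF_transform hk hkd hk' hE hEd ⟨h1, h2, h3, h4, h5, h6, h7⟩
    refine ⟨_, _, _, g1, g2, g3, g4, g5, g6, g7, ?_⟩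
    rw [hr]
    congr 1
    ext s
    refine exists_congr fun x => and_congr_right fun hx => ?_
    have := (hE x).ne'
    have := (hapos x (hss hx)).ne'
    have := (h7 x hx).ne'
    refine Eq.congr_right ?_
    field_simp
    ring
  · rintro ⟨f, f', f'', h1, h2, h3, h4, h5, h6, h7, hr⟩
    obtain ⟨g1, g2, g3, g4, g5, g6, g7⟩ :=
      FF_transform hk.neg (fun x hx => (hkd x hx).neg) hk'.neg hG hGd
        ⟨h1, h2, h3, h4, h5, h6, h7⟩
    refine ⟨_, _, _, g1, g2, g3, g4, g5, g6, g7, ?_⟩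
    rw [hr]
    congr 1
    ext s
    refine exists_congr fun x => and_congr_right fun hx => ?_
    have := (hG x).ne'
    have := (hapos x (hss hx)).ne'
    have := (h7 x hx).ne'
    refine Eq.congr_right ?_
    simp only [Pi.neg_apply]
    field_simp
    ring
end

section
/- Let M, N be finite, let a, b be continuous on [-M, N] with a > 0 on [-M, N], let C(x) = ∫_θ^x (b/a)(t) dt, and let ν̂(dx) = e^{-C(x)} dx. Then for any -M < x < y < N, the capacity of the interval [x, y], namely inf{ ∫_{-M}^N f'(t)² e^{C(t)} dt : f ∈ C_c^∞((-M, N)), f ≥ 1 on [x, y] }, equals ν̂(-M, x)^{-1} + ν̂(y, N)^{-1}. -/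
open MeasureTheory Real Set Filter Topology

lemma cap_lower (A B : ℝ) (hAB : A < B) (C : ℝ → ℝ) (hC : ContinuousOn C (Icc A B))
    (u : ℝ → ℝ) (hu : Continuous u) (h1 : 1 ≤ ∫ t in A..B, u t) :
    (∫ t in A..B, exp (-C t))⁻¹ ≤ ∫ t in A..B, u t ^ 2 * exp (C t) := by
  have hC' : ContinuousOn C (uIcc A B) := by rwa [uIcc_of_le hAB.le]
  have i1 : IntervalIntegrable (fun t => exp (-C t)) volume A B :=
    (hC'.neg.rexp).intervalIntegrable
  have i2 : IntervalIntegrable (fun t => u t ^ 2 * exp (C t)) volume A B :=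
    ((hu.continuousOn.pow 2).mul hC'.rexp).intervalIntegrable
  have i3 : IntervalIntegrable u volume A B := hu.intervalIntegrable _ _
  have hpos : 0 < ∫ t in A..B, exp (-C t) :=
    intervalIntegral.intervalIntegral_pos_of_pos_on i1 (fun t _ => exp_pos _) hAB
  set ν := ∫ t in A..B, exp (-C t) with hν
  have key : ∫ t in A..B, (2 * ν⁻¹ * u t - ν⁻¹ ^ 2 * exp (-C t)) ≤
      ∫ t in A..B, u t ^ 2 * exp (C t) := by
    apply intervalIntegral.integral_mono_on hAB.le ((i3.const_mul _).sub (i1.const_mul _)) i2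
    intro t _
    have e : exp (C t) * exp (-C t) = 1 := by rw [← exp_add]; simp
    have : 0 ≤ (u t - ν⁻¹ * exp (-C t)) ^ 2 * exp (C t) := by positivity
    have e2 : (u t - ν⁻¹ * exp (-C t)) ^ 2 * exp (C t) = u t ^ 2 * exp (C t)
      - 2 * ν⁻¹ * u t * (exp (C t) * exp (-C t))
      + ν⁻¹ ^ 2 * exp (-C t) * (exp (C t) * exp (-C t)) := by ring
    rw [e2, e] at this
    linarith
  rw [intervalIntegral.integral_sub (i3.const_mul _) (i1.const_mul _),
    intervalIntegral.integral_const_mul, intervalIntegral.integral_const_mul, ← hν] at key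
  have hi : 0 < ν⁻¹ := inv_pos.2 hpos
  have : ν⁻¹ ^ 2 * ν = ν⁻¹ := by field_simp
  rw [this] at key
  nlinarith

lemma cap_upper (A B : ℝ) (hAB : A < B) (C : ℝ → ℝ) (hC : ContinuousOn C (Icc A B))
    (ε : ℝ) (hε : 0 < ε) :
    ∃ g : ℝ → ℝ, ContDiff ℝ (⊤ : ℕ∞) g ∧
      (∃ δ > 0, (∀ t, t ≤ A + δ → g t = 0) ∧ (∀ t, B - δ ≤ t → g t = 0)) ∧
      ∫ t in A..B, g t = 1 ∧
      ∫ t in A..B, g t ^ 2 * exp (C t) < (∫ t in A..B, exp (-C t))⁻¹ + ε := by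
  have hC' : ContinuousOn C (uIcc A B) := by rwa [uIcc_of_le hAB.le]
  have hw : ContinuousOn (fun t => exp (-C t)) (Icc A B) := hC.neg.rexp
  have i1 : IntervalIntegrable (fun t => exp (-C t)) volume A B :=
    (hC'.neg.rexp).intervalIntegrable
  have hpos : 0 < ∫ t in A..B, exp (-C t) :=
    intervalIntegral.intervalIntegral_pos_of_pos_on i1 (fun t _ => exp_pos _) hAB
  set ν := ∫ t in A..B, exp (-C t) with hν
  obtain ⟨K, hK⟩ := isCompact_Icc.exists_bound_of_continuousOn hw
  obtain ⟨L, hL⟩ := isCompact_Icc.exists_bound_of_continuousOn hC.rexp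
  have hp : ∀ n : ℕ, ∃ p : Polynomial ℝ, ∀ t ∈ Icc A B,
      |p.eval t - exp (-C t)| < 1 / ((n : ℝ) + 1) := fun n =>
    exists_polynomial_near_of_continuousOn A B _ hw _ (by positivity)
  choose p hp using hp
  let φ : ℕ → ℝ → ℝ := fun n t =>
    smoothTransition (((n : ℝ) + 1) * (t - A) - 1) * smoothTransition (((n : ℝ) + 1) * (B - t) - 1)
  have φ0 : ∀ n t, 0 ≤ φ n t := fun n t =>
    mul_nonneg (smoothTransition.nonneg _) (smoothTransition.nonneg _)
  have φ1 : ∀ n t, φ n t ≤ 1 := fun n t =>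
    mul_le_one₀ (smoothTransition.le_one _) (smoothTransition.nonneg _) (smoothTransition.le_one _)
  have φs : ∀ n, ContDiff ℝ (⊤ : ℕ∞) (φ n) := fun n =>
    (smoothTransition.contDiff.comp (by fun_prop)).mul (smoothTransition.contDiff.comp (by fun_prop))
  let q : ℕ → ℝ → ℝ := fun n t => φ n t * (p n).eval t
  have qs : ∀ n, ContDiff ℝ (⊤ : ℕ∞) (q n) := fun n => (φs n).mul (by simpa using (p n).contDiff_aeval (𝕜 := ℝ) _)
  have qc : ∀ n, Continuous (q n) := fun n => (qs n).continuous
  have qb : ∀ n, ∀ t ∈ Icc A B, |q n t| ≤ K + 1 := by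
    intro n t ht
    have h1 := (hp n t ht).le
    have h2 := hK t ht
    rw [Real.norm_eq_abs] at h2
    have h3 : 1 / ((n : ℝ) + 1) ≤ 1 := by
      rw [div_le_one (by positivity)]; linarith [(Nat.cast_nonneg n : (0:ℝ) ≤ n)]
    have h4 : |(p n).eval t| ≤ K + 1 := by
      have := abs_add_le ((p n).eval t - exp (-C t)) (exp (-C t))
      rw [sub_add_cancel] at this
      linarith
    simp only [q, abs_mul, abs_of_nonneg (φ0 n t)]
    calc φ n t * |(p n).eval t| ≤ 1 * |(p n).eval t| := by gcongr; exact φ1 n t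
      _ ≤ K + 1 := by linarith
  have qt : ∀ t ∈ Ioo A B, Tendsto (fun n => q n t) atTop (𝓝 (exp (-C t))) := by
    intro t ht
    have hpt : Tendsto (fun n => (p n).eval t) atTop (𝓝 (exp (-C t))) := by
      rw [tendsto_iff_dist_tendsto_zero]
      exact squeeze_zero (fun _ => dist_nonneg) (fun n => (hp n t (Ioo_subset_Icc_self ht)).le)
        tendsto_one_div_add_atTop_nhds_zero_nat
    have hφt : Tendsto (fun n => φ n t) atTop (𝓝 1) := by
      have hev : ∀ c : ℝ, 0 < c → ∀ᶠ n : ℕ in atTop, 1 ≤ ((n : ℝ) + 1) * c - 1 := by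
        intro c hc
        obtain ⟨m, hm⟩ := exists_nat_ge (2 / c)
        filter_upwards [eventually_ge_atTop m] with n hn
        have : (m : ℝ) ≤ n := by exact_mod_cast hn
        rw [div_le_iff₀ hc] at hm
        nlinarith
      apply tendsto_const_nhds.congr'
      filter_upwards [hev (t - A) (by linarith [ht.1]), hev (B - t) (by linarith [ht.2])] with n h1 h2
      simp only [φ]
      rw [smoothTransition.one_of_one_le h1, smoothTransition.one_of_one_le h2, one_mul]
    simpa using hφt.mul hpt
  have ae : ∀ᵐ t ∂(volume : Measure ℝ), t ∈ uIoc A B → t ∈ Ioo A B := by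
    have : ∀ᵐ t ∂(volume : Measure ℝ), t ≠ B := by
      simp [ae_iff]
    filter_upwards [this] with t ht h
    rw [uIoc_of_le hAB.le] at h
    exact ⟨h.1, lt_of_le_of_ne h.2 ht⟩
  have T1 : Tendsto (fun n => ∫ t in A..B, q n t) atTop (𝓝 ν) := by
    apply intervalIntegral.tendsto_integral_filter_of_dominated_convergence (fun _ => K + 1)
    · exact Eventually.of_forall fun n => (qc n).aestronglyMeasurable
    · refine Eventually.of_forall fun n => ?_
      filter_upwards [ae] with t ht h
      exact qb n t (Ioo_subset_Icc_self (ht h))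
    · exact intervalIntegrable_const
    · filter_upwards [ae] with t ht h
      exact qt t (ht h)
  have T2 : Tendsto (fun n => ∫ t in A..B, q n t ^ 2 * exp (C t)) atTop (𝓝 ν) := by
    apply intervalIntegral.tendsto_integral_filter_of_dominated_convergence
      (fun _ => (K + 1) ^ 2 * L)
    · exact Eventually.of_forall fun n =>
        ((((qc n).continuousOn.pow 2).mul hC'.rexp).mono uIoc_subset_uIcc).aestronglyMeasurable
          measurableSet_uIoc
    · refine Eventually.of_forall fun n => ?_
      filter_upwards [ae] with t ht h
      have h1 := qb n t (Ioo_subset_Icc_self (ht h))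
      have h2 := hL t (Ioo_subset_Icc_self (ht h))
      rw [norm_mul, norm_pow, Real.norm_eq_abs]
      gcongr
    · exact intervalIntegrable_const
    · filter_upwards [ae] with t ht h
      have := ((qt t (ht h)).pow 2).mul_const (exp (C t))
      convert this using 2
      rw [← exp_nat_mul, ← exp_add]
      congr 1; push_cast; ring
  have T3 : Tendsto (fun n => (∫ t in A..B, q n t ^ 2 * exp (C t)) / (∫ t in A..B, q n t) ^ 2)
      atTop (𝓝 ν⁻¹) := by
    have := T2.div (T1.pow 2) (by positivity)
    have e : ν⁻¹ = ν / ν ^ 2 := by field_simp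
    rw [e]
    exact this
  obtain ⟨n, hn1, hn2⟩ := ((T3.eventually_lt_const (show ν⁻¹ < ν⁻¹ + ε by linarith)).and
    (T1.eventually_const_lt hpos)).exists
  set I := ∫ t in A..B, q n t with hI
  have hn : (0:ℝ) < (n:ℝ) + 1 := by positivity
  refine ⟨fun t => I⁻¹ * q n t, contDiff_const.mul (qs n), ⟨1 / ((n:ℝ) + 1), by positivity, ?_, ?_⟩,
    ?_, ?_⟩
  · intro t ht
    have : ((n : ℝ) + 1) * (t - A) - 1 ≤ 0 := by
      have : t - A ≤ 1 / ((n:ℝ) + 1) := by linarith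
      rw [le_div_iff₀ hn] at this
      linarith
    simp [q, φ, smoothTransition.zero_of_nonpos this]
  · intro t ht
    have : ((n : ℝ) + 1) * (B - t) - 1 ≤ 0 := by
      have : B - t ≤ 1 / ((n:ℝ) + 1) := by linarith
      rw [le_div_iff₀ hn] at this
      linarith
    simp [q, φ, smoothTransition.zero_of_nonpos this]
  · rw [intervalIntegral.integral_const_mul, ← hI, inv_mul_cancel₀ hn2.ne']
  · have : ∀ t, (I⁻¹ * q n t) ^ 2 * exp (C t) = (I ^ 2)⁻¹ * (q n t ^ 2 * exp (C t)) := by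
      intro t; rw [mul_pow, inv_pow, mul_assoc]
    simp only [this]
    rw [intervalIntegral.integral_const_mul, mul_comm, ← div_eq_mul_inv]
    exact hn1

/-- Explicit computation of the capacity of `[x, y]` for the Dirichlet form
`D(f) = ∫_{-M}^N f'(t)² e^{C(t)} dt` associated with the one-dimensional elliptic
operator `L = a d²/dx² + b d/dx`:
`Cap([x,y]) = ν̂(-M, x)⁻¹ + ν̂(y, N)⁻¹` where `ν̂(dx) = e^{-C(x)} dx`. -/
theorem capacity_of_interval
    (M N : ℝ) (hMN : -M < N)
    (a b : ℝ → ℝ)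
    (ha : ContinuousOn a (Icc (-M) N)) (hb : ContinuousOn b (Icc (-M) N))
    (hapos : ∀ x ∈ Icc (-M) N, 0 < a x)
    (θ : ℝ) (hθ : θ ∈ Ioo (-M) N)
    (C : ℝ → ℝ) (hC : ∀ x, C x = ∫ t in θ..x, b t / a t)
    (x y : ℝ) (hx : -M < x) (hxy : x < y) (hy : y < N) :
    sInf { r : ℝ | ∃ f : ℝ → ℝ, ContDiff ℝ (⊤ : ℕ∞) f ∧ HasCompactSupport f ∧
        tsupport f ⊆ Ioo (-M) N ∧ (∀ t ∈ Icc x y, 1 ≤ f t) ∧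
        r = ∫ t in (-M)..N, deriv f t ^ 2 * Real.exp (C t) }
      = (∫ t in (-M)..x, Real.exp (-C t))⁻¹ + (∫ t in y..N, Real.exp (-C t))⁻¹ := by
  have hCc : ContinuousOn C (Icc (-M) N) := by
    have hq : ContinuousOn (fun t => b t / a t) (Icc (-M) N) :=
      hb.div ha fun t ht => (hapos t ht).ne'
    have hi : IntegrableOn (fun t => b t / a t) (uIcc (-M) N) volume := by
      rw [uIcc_of_le hMN.le]; exact hq.integrableOn_Icc
    have := intervalIntegral.continuousOn_primitive_interval' (a := θ)
      (hi.intervalIntegrable) (by rw [uIcc_of_le hMN.le]; exact Ioo_subset_Icc_self hθ)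
    rw [uIcc_of_le hMN.le] at this
    exact this.congr fun t _ => hC t
  have hC1 : ContinuousOn C (Icc (-M) x) := hCc.mono (Icc_subset_Icc le_rfl (by linarith))
  have hC2 : ContinuousOn C (Icc x y) := hCc.mono (Icc_subset_Icc (by linarith) (by linarith))
  have hC3 : ContinuousOn C (Icc y N) := hCc.mono (Icc_subset_Icc (by linarith) le_rfl)
  have hint : ∀ u : ℝ → ℝ, Continuous u → ∀ s t, s ≤ t → ContinuousOn C (Icc s t) →
      IntervalIntegrable (fun t => u t ^ 2 * exp (C t)) volume s t := by
    intro u hu s t hst hc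
    rw [← uIcc_of_le hst] at hc
    exact ((hu.continuousOn.pow 2).mul hc.rexp).intervalIntegrable
  have hsplit : ∀ u : ℝ → ℝ, Continuous u → ∫ t in (-M)..N, u t ^ 2 * exp (C t) =
      (∫ t in (-M)..x, u t ^ 2 * exp (C t)) + (∫ t in x..y, u t ^ 2 * exp (C t)) +
      ∫ t in y..N, u t ^ 2 * exp (C t) := by
    intro u hu
    have j1 := hint u hu _ _ hx.le hC1
    have j2 := hint u hu _ _ hxy.le hC2
    have j3 := hint u hu _ _ hy.le hC3
    rw [intervalIntegral.integral_add_adjacent_intervals j1 j2,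
      intervalIntegral.integral_add_adjacent_intervals (j1.trans j2) j3]
  have lower : ∀ r ∈ { r : ℝ | ∃ f : ℝ → ℝ, ContDiff ℝ (⊤ : ℕ∞) f ∧ HasCompactSupport f ∧
        tsupport f ⊆ Ioo (-M) N ∧ (∀ t ∈ Icc x y, 1 ≤ f t) ∧
        r = ∫ t in (-M)..N, deriv f t ^ 2 * Real.exp (C t) },
      (∫ t in (-M)..x, Real.exp (-C t))⁻¹ + (∫ t in y..N, Real.exp (-C t))⁻¹ ≤ r := by
    rintro r ⟨f, hf, -, hs, h1, rfl⟩
    have hd : Continuous (deriv f) := hf.continuous_deriv (by simp)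
    have hdf : Differentiable ℝ f := hf.differentiable (by simp)
    have ftc : ∀ s t, ∫ z in s..t, deriv f z = f t - f s := fun s t =>
      intervalIntegral.integral_deriv_eq_sub (fun z _ => hdf z) (hd.intervalIntegrable _ _)
    have f0 : ∀ t, t ∉ Ioo (-M) N → f t = 0 := fun t ht =>
      image_eq_zero_of_notMem_tsupport fun h => ht (hs h)
    have fA : f (-M) = 0 := f0 _ (by simp)
    have fN : f N = 0 := f0 _ (by simp)
    have l1 := cap_lower (-M) x hx C hC1 (deriv f) hd (by
      rw [ftc, fA]; linarith [h1 x ⟨le_rfl, hxy.le⟩])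
    have l3 := cap_lower y N hy C hC3 (fun t => -deriv f t) hd.neg (by
      rw [intervalIntegral.integral_neg, ftc, fN]; linarith [h1 y ⟨hxy.le, le_rfl⟩])
    simp only [neg_sq] at l3
    have l2 : 0 ≤ ∫ t in x..y, deriv f t ^ 2 * exp (C t) :=
      intervalIntegral.integral_nonneg hxy.le fun t _ => by positivity
    rw [hsplit _ hd]
    linarith
  have upper : ∀ ε > 0, ∃ r ∈ { r : ℝ | ∃ f : ℝ → ℝ, ContDiff ℝ (⊤ : ℕ∞) f ∧ HasCompactSupport f ∧
        tsupport f ⊆ Ioo (-M) N ∧ (∀ t ∈ Icc x y, 1 ≤ f t) ∧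
        r = ∫ t in (-M)..N, deriv f t ^ 2 * Real.exp (C t) },
      r ≤ (∫ t in (-M)..x, Real.exp (-C t))⁻¹ + (∫ t in y..N, Real.exp (-C t))⁻¹ + ε := by
    intro ε hε
    obtain ⟨g, gs, ⟨δ, hδ, g1, g2⟩, gi, ge⟩ := cap_upper (-M) x hx C hC1 (ε / 2) (by linarith)
    obtain ⟨h, hs, ⟨η, hη, h1, h2⟩, hi, he⟩ := cap_upper y N hy C hC3 (ε / 2) (by linarith)
    have gc := gs.continuous
    have hc := hs.continuous
    let u : ℝ → ℝ := fun t => g t - h t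
    have us : ContDiff ℝ (⊤ : ℕ∞) u := gs.sub hs
    have uc : Continuous u := us.continuous
    have ui : ∀ s t, IntervalIntegrable u volume s t := fun s t => uc.intervalIntegrable _ _
    let f : ℝ → ℝ := fun t => ∫ z in (-M)..t, u z
    have fd : ∀ t, HasDerivAt f (u t) t := fun t =>
      intervalIntegral.integral_hasDerivAt_right (ui _ _)
        uc.aestronglyMeasurable.stronglyMeasurableAtFilter uc.continuousAt
    have fd' : deriv f = u := funext fun t => (fd t).deriv
    have u1 : ∀ t, t ≤ x → u t = g t := fun t ht => by
      simp only [u]; rw [h1 t (by linarith), sub_zero]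
    have u2 : ∀ t, x ≤ t → t ≤ y → u t = 0 := fun t ht ht' => by
      simp only [u]; rw [h1 t (by linarith), g2 t (by linarith), sub_zero]
    have u3 : ∀ t, y ≤ t → u t = -h t := fun t ht => by
      simp only [u]; rw [g2 t (by linarith), zero_sub]
    have z0 : ∀ (v w : ℝ → ℝ) (s t : ℝ), s ≤ t → (∀ z ∈ Icc s t, v z = w z) →
        ∫ z in s..t, v z = ∫ z in s..t, w z := by
      intro v w s t hst hvw
      apply intervalIntegral.integral_congr
      rw [uIcc_of_le hst]; exact hvw
    have fl : ∀ t, t ≤ -M + δ → f t = 0 := by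
      intro t ht
      have : ∫ z in (-M)..t, u z = ∫ z in (-M)..t, (0:ℝ) := by
        apply intervalIntegral.integral_congr
        intro z hz
        have hz' : z ≤ -M + δ := by
          rcases le_total (-M) t with h | h
          · rw [uIcc_of_le h] at hz; linarith [hz.2]
          · rw [uIcc_of_ge h] at hz; linarith [hz.2]
        have hh : h z = 0 := by
          apply h1
          by_contra hcon
          -- g vanishes identically if the cutoff is past x
          have : ∫ t in (-M)..x, g t = ∫ t in (-M)..x, (0:ℝ) :=
            z0 _ _ _ _ hx.le fun s hs => g1 s (by push Not at hcon; linarith [hs.2])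
          rw [gi] at this; simp at this
        simp [u, g1 z hz', hh]
      simp only [f, this]; simp
    have fx : f x = 1 := by
      simp only [f]; rw [z0 u g _ _ hx.le fun z hz => u1 z hz.2, gi]
    have fm : ∀ t ∈ Icc x y, f t = 1 := by
      intro t ht
      have e : f t = f x + ∫ z in x..t, u z :=
        (intervalIntegral.integral_add_adjacent_intervals (ui _ _) (ui _ _)).symm
      rw [e, fx, z0 u (fun _ => 0) _ _ ht.1 fun z hz => u2 z hz.1 (hz.2.trans ht.2)]
      simp
    have fN : f N = 0 := by
      have e : f N = f y + ∫ z in y..N, u z :=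
        (intervalIntegral.integral_add_adjacent_intervals (ui _ _) (ui _ _)).symm
      rw [e, fm y ⟨hxy.le, le_rfl⟩, z0 u (fun z => -h z) _ _ hy.le fun z hz => u3 z hz.1,
        intervalIntegral.integral_neg, hi]
      simp
    have hη' : y ≤ N - η := by
      by_contra hcon
      push Not at hcon
      have : ∫ t in y..N, h t = ∫ t in y..N, (0:ℝ) :=
        z0 _ _ _ _ hy.le fun s hs => h2 s (by linarith [hs.1])
      rw [hi] at this; simp at this
    have fr : ∀ t, N - η ≤ t → f t = 0 := by
      intro t ht
      have e : f t = f N + ∫ z in N..t, u z :=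
        (intervalIntegral.integral_add_adjacent_intervals (ui _ _) (ui _ _)).symm
      have : ∫ z in N..t, u z = ∫ z in N..t, (0:ℝ) := by
        apply intervalIntegral.integral_congr
        intro z hz
        have hz' : N - η ≤ z := by
          rcases le_total N t with h | h
          · rw [uIcc_of_le h] at hz; linarith [hz.1]
          · rw [uIcc_of_ge h] at hz; linarith [hz.1]
        show u z = 0
        rw [u3 z (by linarith), h2 z hz', neg_zero]
      rw [e, fN, this]; simp
    have hsup : tsupport f ⊆ Icc (-M + δ) (N - η) := by
      apply closure_minimal _ isClosed_Icc
      intro t ht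
      constructor
      · by_contra hcon; push Not at hcon; exact ht (fl t hcon.le)
      · by_contra hcon; push Not at hcon; exact ht (fr t hcon.le)
    refine ⟨_, ⟨f, ?_, ?_, ?_, ?_, rfl⟩, ?_⟩
    · rw [contDiff_infty_iff_deriv]
      exact ⟨fun t => (fd t).differentiableAt, by rw [fd']; exact us⟩
    · exact isCompact_Icc.of_isClosed_subset (isClosed_tsupport f) hsup
    · exact hsup.trans fun t ht => ⟨by linarith [ht.1], by linarith [ht.2]⟩
    · exact fun t ht => (fm t ht).ge
    · rw [fd', hsplit u uc,
        z0 (fun t => u t ^ 2 * exp (C t)) (fun t => g t ^ 2 * exp (C t)) _ _ hx.le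
          fun z hz => by simp only [u1 z hz.2],
        z0 (fun t => u t ^ 2 * exp (C t)) (fun t => 0) _ _ hxy.le
          fun z hz => by simp [u2 z hz.1 hz.2],
        z0 (fun t => u t ^ 2 * exp (C t)) (fun t => h t ^ 2 * exp (C t)) _ _ hy.le
          fun z hz => by simp only [u3 z hz.1, neg_sq]]
      simp only [intervalIntegral.integral_zero]
      linarith
  apply le_antisymm
  · apply le_of_forall_pos_le_add
    intro ε hε
    obtain ⟨r, hr, hle⟩ := upper ε hε
    exact (csInf_le ⟨_, lower⟩ hr).trans hle
  · obtain ⟨r, hr, -⟩ := upper 1 one_pos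
    exact le_csInf ⟨r, hr⟩ lower
end

section
/- Let a, b be continuous on [-M, N] with a > 0 on (-M, N), let C(x) = ∫_θ^x (b/a)(t) dt, and define μ(dx) = (e^{C(x)}/a(x)) dx and ν̂(dx) = e^{-C(x)} dx on (-M, N). Define κ₀ > 0 by κ₀^{-2} = inf_{-M<x<y<N} [ν̂(-M, x)^{-1} + ν̂(y, N)^{-1}]·μ(x, y)^{-1}. Then the optimal constant A₀ in the inequality ∫_{-M}^N f² dμ ≤ A₀² ∫_{-M}^N f'(t)² e^{C(t)} dt, required to hold for all f ∈ C_c^∞((-M, N)), satisfies κ₀ ≤ A₀ ≤ 2κ₀. -/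
open MeasureTheory Real Set Filter Topology ENNReal

namespace DPB

noncomputable def dens (L R : ℝ) (w : ℝ → ℝ) : Measure ℝ :=
  (volume.restrict (Ioo L R)).withDensity fun x => ENNReal.ofReal (w x)

lemma ii {L R : ℝ} {w : ℝ → ℝ} (hw : ContinuousOn w (Ioo L R)) {x y : ℝ}
    (hx : x ∈ Ioo L R) (hy : y ∈ Ioo L R) : IntervalIntegrable w volume x y := by
  apply ContinuousOn.intervalIntegrable
  exact hw.mono (ordConnected_Ioo.uIcc_subset hx hy)

lemma hasDeriv {L R : ℝ} {w : ℝ → ℝ} (hw : ContinuousOn w (Ioo L R)) {θ x : ℝ}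
    (hθ : θ ∈ Ioo L R) (hx : x ∈ Ioo L R) :
    HasDerivAt (fun u => ∫ t in θ..u, w t) (w x) x :=
  intervalIntegral.integral_hasDerivAt_right (ii hw hθ hx)
    (hw.stronglyMeasurableAtFilter isOpen_Ioo x hx)
    (hw.continuousAt (isOpen_Ioo.mem_nhds hx))

lemma dens_apply {L R : ℝ} {w : ℝ → ℝ} {x y : ℝ} (hx : L ≤ x) (hy : y ≤ R) :
    dens L R w (Ioo x y) = ∫⁻ t in Ioo x y, ENNReal.ofReal (w t) := by
  rw [dens, withDensity_apply _ measurableSet_Ioo, Measure.restrict_restrict measurableSet_Ioo]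
  rw [inter_eq_self_of_subset_left (Ioo_subset_Ioo hx hy)]

lemma dens_Ioo {L R : ℝ} {w : ℝ → ℝ} (hw : ContinuousOn w (Ioo L R))
    (hpos : ∀ x ∈ Ioo L R, 0 < w x) {x y : ℝ}
    (hx : x ∈ Ioo L R) (hy : y ∈ Ioo L R) (hxy : x ≤ y) :
    dens L R w (Ioo x y) = ENNReal.ofReal (∫ t in x..y, w t) := by
  rw [dens_apply hx.1.le hy.2.le, intervalIntegral.integral_of_le hxy,
    ofReal_integral_eq_lintegral_ofReal, restrict_Ioo_eq_restrict_Ioc]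
  · exact (ii hw hx hy).1
  · refine (ae_restrict_iff' measurableSet_Ioc).2 (Eventually.of_forall fun t ht => ?_)
    exact (hpos t ⟨hx.1.trans ht.1, ht.2.trans_lt hy.2⟩).le

lemma int_pos {L R : ℝ} {w : ℝ → ℝ} (hw : ContinuousOn w (Ioo L R))
    (hpos : ∀ x ∈ Ioo L R, 0 < w x) {x y : ℝ}
    (hx : x ∈ Ioo L R) (hy : y ∈ Ioo L R) (hxy : x < y) : 0 < ∫ t in x..y, w t := by
  apply intervalIntegral.intervalIntegral_pos_of_pos_on (ii hw hx hy) _ hxy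
  intro t ht
  exact hpos t ⟨hx.1.trans ht.1, ht.2.trans hy.2⟩

lemma dens_split {L R : ℝ} {w : ℝ → ℝ} {x y z : ℝ} (hxy : x < y) (hyz : y < z) :
    dens L R w (Ioo x z) = dens L R w (Ioo x y) + dens L R w (Ioo y z) := by
  have hac : dens L R w ≪ volume :=
    (withDensity_absolutelyContinuous _ _).trans Measure.restrict_le_self.absolutelyContinuous
  have h0 : dens L R w {y} = 0 := hac (by simp)
  have e1 : dens L R w (Ioo x y) = dens L R w (Ioc x y) := by
    rw [← Ioo_union_right hxy]
    refine le_antisymm (measure_mono subset_union_left) ((measure_union_le _ _).trans ?_)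
    rw [h0, add_zero]
  rw [e1, ← measure_union _ measurableSet_Ioo, Ioc_union_Ioo_eq_Ioo hxy.le hyz]
  rw [Set.disjoint_left]
  intro t ht ht2
  exact absurd ht.2 (not_le.2 ht2.1)

lemma dens_pos {L R : ℝ} {w : ℝ → ℝ} (hw : ContinuousOn w (Ioo L R))
    (hpos : ∀ x ∈ Ioo L R, 0 < w x) {x y : ℝ}
    (hx : L ≤ x) (hy : y ≤ R) (hxy : x < y) : 0 < dens L R w (Ioo x y) := by
  obtain ⟨p, hp1, hp2⟩ := exists_between hxy
  obtain ⟨q, hq1, hq2⟩ := exists_between hp2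
  have h1 : p ∈ Ioo L R := ⟨by linarith, by linarith⟩
  have h2 : q ∈ Ioo L R := ⟨by linarith, by linarith⟩
  refine lt_of_lt_of_le ?_ (measure_mono (Ioo_subset_Ioo hp1.le hq2.le))
  rw [dens_Ioo hw hpos h1 h2 hq1.le]
  exact ENNReal.ofReal_pos.2 (int_pos hw hpos h1 h2 hq1)

lemma left_rep {L R : ℝ} {w : ℝ → ℝ} (hw : ContinuousOn w (Ioo L R))
    (hpos : ∀ x ∈ Ioo L R, 0 < w x) {x y : ℝ} 
    (hx : x ∈ Ioo L R) (hy : y ∈ Ioo L R) (hxy : x ≤ y) :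
    dens L R w (Ioo L y) = dens L R w (Ioo L x) + ENNReal.ofReal (∫ t in x..y, w t) := by
  rcases hxy.eq_or_lt with rfl | h
  · simp
  · rw [dens_split hx.1 h, dens_Ioo hw hpos hx hy h.le]

lemma right_rep {L R : ℝ} {w : ℝ → ℝ} (hw : ContinuousOn w (Ioo L R))
    (hpos : ∀ x ∈ Ioo L R, 0 < w x) {x y : ℝ} 
    (hx : x ∈ Ioo L R) (hy : y ∈ Ioo L R) (hxy : x ≤ y) :
    dens L R w (Ioo x R) = ENNReal.ofReal (∫ t in x..y, w t) + dens L R w (Ioo y R) := by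
  rcases hxy.eq_or_lt with rfl | h
  · simp
  · rw [dens_split h hy.2, dens_Ioo hw hpos hx hy h.le]

lemma alpha {L R : ℝ} {w : ℝ → ℝ} (hw : ContinuousOn w (Ioo L R))
    (hpos : ∀ x ∈ Ioo L R, 0 < w x) :
    ∃ α : ℝ → ℝ, (∀ x, 0 ≤ α x) ∧
      (∀ x ∈ Ioo L R, (dens L R w (Ioo L x))⁻¹ = ENNReal.ofReal (α x)) ∧
      ∀ x ∈ Ioo L R, HasDerivAt α (-(w x * α x ^ 2)) x := by
  refine ⟨fun x => (dens L R w (Ioo L x)).toReal⁻¹, fun x => by positivity, ?_, ?_⟩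
  · intro x hx
    have := dens_pos hw hpos le_rfl hx.2.le hx.1
    beta_reduce
    rw [← ENNReal.toReal_inv, ENNReal.ofReal_toReal]
    simpa using this.ne'
  · intro x hx
    by_cases hf : dens L R w (Ioo L x) = ∞
    · have key : ∀ y ∈ Ioo L R, dens L R w (Ioo L y) = ∞ := by
        intro y hy
        rcases le_total x y with h | h
        · rw [left_rep hw hpos hx hy h, hf]; simp
        · rw [left_rep hw hpos hy hx h] at hf; simpa using hf
      have : (fun x => (dens L R w (Ioo L x)).toReal⁻¹) =ᶠ[𝓝 x] fun _ => 0 := by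
        filter_upwards [isOpen_Ioo.mem_nhds hx] with y hy
        simp [key y hy]
      refine HasDerivAt.congr_of_eventuallyEq ?_ this
      simpa [hf] using hasDerivAt_const x (0:ℝ)
    · have h1 : HasDerivAt (fun y => (dens L R w (Ioo L y)).toReal) (w x) x := by
        have : (fun y => (dens L R w (Ioo L y)).toReal) =ᶠ[𝓝 x] 
            fun y => (dens L R w (Ioo L x)).toReal + ∫ t in x..y, w t := by
          filter_upwards [isOpen_Ioo.mem_nhds hx] with y hy
          rcases le_total x y with h | h
          · rw [left_rep hw hpos hx hy h, ENNReal.toReal_add hf (by simp), ENNReal.toReal_ofReal]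
            exact intervalIntegral.integral_nonneg h fun t ht => 
              (hpos t ⟨hx.1.trans_le ht.1, ht.2.trans_lt hy.2⟩).le
          · have hr := left_rep hw hpos hy hx h
            have hf' : dens L R w (Ioo L y) ≠ ∞ := by
              intro h; rw [hr, h] at hf; simp at hf
            rw [hr, ENNReal.toReal_add hf' (by simp), ENNReal.toReal_ofReal,
              intervalIntegral.integral_symm x y]
            · ring
            exact intervalIntegral.integral_nonneg h fun t ht => 
              (hpos t ⟨hy.1.trans_le ht.1, ht.2.trans_lt hx.2⟩).le
        exact ((hasDeriv hw hx hx).const_add _).congr_of_eventuallyEq this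
      have h0 : (dens L R w (Ioo L x)).toReal ≠ 0 := 
        (ENNReal.toReal_pos (dens_pos hw hpos le_rfl hx.2.le hx.1).ne' hf).ne'
      refine (h1.inv h0).congr_deriv ?_
      field_simp

lemma beta {L R : ℝ} {w : ℝ → ℝ} (hw : ContinuousOn w (Ioo L R))
    (hpos : ∀ x ∈ Ioo L R, 0 < w x) :
    ∃ β : ℝ → ℝ, (∀ x, 0 ≤ β x) ∧
      (∀ x ∈ Ioo L R, (dens L R w (Ioo x R))⁻¹ = ENNReal.ofReal (β x)) ∧
      ∀ x ∈ Ioo L R, HasDerivAt β (w x * β x ^ 2) x := by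
  refine ⟨fun x => (dens L R w (Ioo x R)).toReal⁻¹, fun x => by positivity, ?_, ?_⟩
  · intro x hx
    have := dens_pos hw hpos hx.1.le le_rfl hx.2
    beta_reduce
    rw [← ENNReal.toReal_inv, ENNReal.ofReal_toReal]
    simpa using this.ne'
  · intro x hx
    by_cases hf : dens L R w (Ioo x R) = ∞
    · have key : ∀ y ∈ Ioo L R, dens L R w (Ioo y R) = ∞ := by
        intro y hy
        rcases le_total x y with h | h
        · rw [right_rep hw hpos hx hy h] at hf; simpa using hf
        · rw [right_rep hw hpos hy hx h, hf]; simp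
      have : (fun x => (dens L R w (Ioo x R)).toReal⁻¹) =ᶠ[𝓝 x] fun _ => 0 := by
        filter_upwards [isOpen_Ioo.mem_nhds hx] with y hy
        simp [key y hy]
      refine HasDerivAt.congr_of_eventuallyEq ?_ this
      simpa [hf] using hasDerivAt_const x (0:ℝ)
    · have h1 : HasDerivAt (fun y => (dens L R w (Ioo y R)).toReal) (-w x) x := by
        have : (fun y => (dens L R w (Ioo y R)).toReal) =ᶠ[𝓝 x] 
            fun y => (dens L R w (Ioo x R)).toReal - ∫ t in x..y, w t := by
          filter_upwards [isOpen_Ioo.mem_nhds hx] with y hy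
          rcases le_total x y with h | h
          · have hr := right_rep hw hpos hx hy h
            have hf' : dens L R w (Ioo y R) ≠ ∞ := by
              intro h; rw [hr, h] at hf; simp at hf
            rw [hr, ENNReal.toReal_add (by simp) hf', ENNReal.toReal_ofReal]
            · ring
            exact intervalIntegral.integral_nonneg h fun t ht => 
              (hpos t ⟨hx.1.trans_le ht.1, ht.2.trans_lt hy.2⟩).le
          · rw [right_rep hw hpos hy hx h, ENNReal.toReal_add (by simp) hf, ENNReal.toReal_ofReal,
              intervalIntegral.integral_symm x y]
            · ring
            exact intervalIntegral.integral_nonneg h fun t ht => 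
              (hpos t ⟨hy.1.trans_le ht.1, ht.2.trans_lt hx.2⟩).le
        exact ((hasDeriv hw hx hx).const_sub _).congr_of_eventuallyEq this
      have h0 : (dens L R w (Ioo x R)).toReal ≠ 0 := 
        (ENNReal.toReal_pos (dens_pos hw hpos hx.1.le le_rfl hx.2).ne' hf).ne'
      refine (h1.inv h0).congr_deriv ?_
      field_simp

end DPB
namespace DPB

lemma amgm_left (K f f' c e al T : ℝ) (hK : 0 ≤ K) (hc : c * e = 1) (hcp : 0 < c) (_hep : 0 < e) 
    (hal : 0 ≤ al) (h0 : 0 ≤ T) (hT : T ≤ K * al) :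
    2 * f * f' * (K * al + T) - K * f ^ 2 * e * al ^ 2 ≤ 4 * K * f' ^ 2 * c := by
  have h1 : 2 * f * f' * (K * al + T) ≤ 4 * K * (al * (|f| * |f'|)) := by
    have : f * f' ≤ |f| * |f'| := by rw [← abs_mul]; exact le_abs_self _
    have h2 : 0 ≤ |f| * |f'| := by positivity
    have h3 : 0 ≤ K * al := by positivity
    nlinarith [mul_nonneg (sub_nonneg.2 this) (add_nonneg h3 h0), mul_nonneg h2 (sub_nonneg.2 hT)]
  have h4 : 0 ≤ K * (c * (2 * |f'| - e * al * |f|) ^ 2) := by positivity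
  have h5 : K * (c * (2 * |f'| - e * al * |f|) ^ 2) = 4 * K * |f'| ^ 2 * c 
     - 4 * K * (al * (|f| * |f'|)) * (c * e) + K * |f| ^ 2 * e * al ^ 2 * (c * e) := by ring
  rw [h5, hc, sq_abs, sq_abs] at h4
  linarith

lemma left_part {L R : ℝ} {C w m α f : ℝ → ℝ} {K v p q : ℝ}
    (hCc : ContinuousOn C (Ioo L R)) (hw : ContinuousOn w (Ioo L R))
    (hm : ∀ x ∈ Ioo L R, HasDerivAt m (w x) x)
    (hα0 : ∀ x, 0 ≤ α x)
    (hα : ∀ x ∈ Ioo L R, HasDerivAt α (-(exp (-C x) * α x ^ 2)) x)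
    (hK : 0 ≤ K) (hf : ContDiff ℝ 1 f) (hp : p ∈ Ioo L R) (hq : q ∈ Ioo L R) (hpq : p ≤ q)
    (h0 : ∀ x ∈ Icc p q, 0 ≤ - v - m x) (h1 : ∀ x ∈ Icc p q, - v - m x ≤ K * α x)
    (hfp : f p = 0) :
    0 ≤ ∫ x in p..q, (4 * K * deriv f x ^ 2 * exp (C x) - f x ^ 2 * w x) := by
  have hsub : Icc p q ⊆ Ioo L R := fun x hx => ⟨hp.1.trans_le hx.1, hx.2.trans_lt hq.2⟩
  have hd : ∀ x ∈ Icc p q, HasDerivAt (fun x => f x ^ 2 * (K * α x + (- v - m x)))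
      (2 * f x * deriv f x * (K * α x + (- v - m x)) + 
        f x ^ 2 * (K * (-(exp (-C x) * α x ^ 2)) - w x)) x := by
    intro x hx
    have hfd := (hf.differentiable (by norm_num) x).hasDerivAt
    refine ((hfd.pow 2).mul (((hα x (hsub hx)).const_mul K).add 
      ((hm x (hsub hx)).const_sub (-v)))).congr_deriv ?_
    simp; exact Or.inl (by ring)
  have := intervalIntegral.sub_le_integral_of_hasDeriv_right_of_le (φ := fun x => 
    4 * K * deriv f x ^ 2 * exp (C x) - f x ^ 2 * w x) hpq 
    (fun x hx => (hd x hx).continuousAt.continuousWithinAt) 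
    (fun x hx => (hd x (Ioo_subset_Icc_self hx)).hasDerivWithinAt) ?_ ?_
  · refine le_trans ?_ this
    have := h0 q ⟨hpq, le_rfl⟩
    have := hα0 q
    simp only [hfp]
    have : 0 ≤ f q ^ 2 * (K * α q + (- v - m q)) := by positivity
    linarith
  · apply ContinuousOn.integrableOn_Icc
    have h1 := hf.continuous_deriv le_rfl
    have h2 := hf.continuous
    have h3 := hCc.mono hsub
    have h4 := hw.mono hsub
    fun_prop
  · intro x hx
    have hx := Ioo_subset_Icc_self hx
    have := amgm_left K (f x) (deriv f x) (exp (C x)) (exp (-C x)) (α x) (-v - m x) hK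
      (by rw [← exp_add]; simp) (exp_pos _) (exp_pos _) (hα0 x) (h0 x hx) (h1 x hx)
    beta_reduce
    linarith

lemma right_part {L R : ℝ} {C w m α f : ℝ → ℝ} {K v p q : ℝ}
    (hCc : ContinuousOn C (Ioo L R)) (hw : ContinuousOn w (Ioo L R))
    (hm : ∀ x ∈ Ioo L R, HasDerivAt m (w x) x)
    (hα0 : ∀ x, 0 ≤ α x)
    (hα : ∀ x ∈ Ioo L R, HasDerivAt α (exp (-C x) * α x ^ 2) x)
    (hK : 0 ≤ K) (hf : ContDiff ℝ 1 f) (hp : p ∈ Ioo L R) (hq : q ∈ Ioo L R) (hpq : p ≤ q)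
    (h0 : ∀ x ∈ Icc p q, 0 ≤ v + m x) (h1 : ∀ x ∈ Icc p q, v + m x ≤ K * α x)
    (hfq : f q = 0) :
    0 ≤ ∫ x in p..q, (4 * K * deriv f x ^ 2 * exp (C x) - f x ^ 2 * w x) := by
  have hsub : Icc p q ⊆ Ioo L R := fun x hx => ⟨hp.1.trans_le hx.1, hx.2.trans_lt hq.2⟩
  have hd : ∀ x ∈ Icc p q, HasDerivAt (fun x => - (f x ^ 2 * (K * α x + (v + m x))))
      (-(2 * f x * deriv f x * (K * α x + (v + m x)) + 
        f x ^ 2 * (K * ((exp (-C x) * α x ^ 2)) + w x))) x := by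
    intro x hx
    have hfd := (hf.differentiable (by norm_num) x).hasDerivAt
    refine (((hfd.pow 2).mul (((hα x (hsub hx)).const_mul K).add 
      ((hm x (hsub hx)).const_add v))).neg).congr_deriv ?_
    simp
  have := intervalIntegral.sub_le_integral_of_hasDeriv_right_of_le (φ := fun x => 
    4 * K * deriv f x ^ 2 * exp (C x) - f x ^ 2 * w x) hpq 
    (fun x hx => (hd x hx).continuousAt.continuousWithinAt) 
    (fun x hx => (hd x (Ioo_subset_Icc_self hx)).hasDerivWithinAt) ?_ ?_
  · refine le_trans ?_ this
    have := h0 p ⟨le_rfl, hpq⟩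
    have := hα0 p
    simp only [hfq]
    have : 0 ≤ f p ^ 2 * (K * α p + (v + m p)) := by positivity
    linarith
  · apply ContinuousOn.integrableOn_Icc
    have h1 := hf.continuous_deriv le_rfl
    have h2 := hf.continuous
    have h3 := hCc.mono hsub
    have h4 := hw.mono hsub
    fun_prop
  · intro x hx
    have hx := Ioo_subset_Icc_self hx
    have := amgm_left K (f x) (-deriv f x) (exp (C x)) (exp (-C x)) (α x) (v + m x) hK
      (by rw [← exp_add]; simp) (exp_pos _) (exp_pos _) (hα0 x) (h0 x hx) (h1 x hx)
    beta_reduce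
    linarith

lemma upper {L R : ℝ} {C w m α β f : ℝ → ℝ} {K p q : ℝ}
    (hCc : ContinuousOn C (Ioo L R)) (hw : ContinuousOn w (Ioo L R))
    (hm : ∀ x ∈ Ioo L R, HasDerivAt m (w x) x)
    (hmono : MonotoneOn m (Ioo L R))
    (hα0 : ∀ x, 0 ≤ α x)
    (hα : ∀ x ∈ Ioo L R, HasDerivAt α (-(exp (-C x) * α x ^ 2)) x)
    (hβ0 : ∀ x, 0 ≤ β x)
    (hβ : ∀ x ∈ Ioo L R, HasDerivAt β (exp (-C x) * β x ^ 2) x)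
    (hαβ : ∀ x ∈ Ioo L R, ∀ y ∈ Ioo L R, x < y → m y - m x ≤ K * (α x + β y))
    (hK : 0 ≤ K) (hf : ContDiff ℝ 1 f) (hp : p ∈ Ioo L R) (hq : q ∈ Ioo L R) (hpq : p ≤ q)
    (hfp : f p = 0) (hfq : f q = 0) :
    ∫ x in p..q, f x ^ 2 * w x ≤ 4 * K * ∫ x in p..q, deriv f x ^ 2 * exp (C x) := by
  have hsub : Icc p q ⊆ Ioo L R := fun x hx => ⟨hp.1.trans_le hx.1, hx.2.trans_lt hq.2⟩
  have h1' := hf.continuous_deriv le_rfl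
  have h2' := hf.continuous
  have hA : ContinuousOn (fun x => deriv f x ^ 2 * exp (C x)) (Ioo L R) := by fun_prop
  have hB : ContinuousOn (fun x => f x ^ 2 * w x) (Ioo L R) := by fun_prop
  have hAll : ∀ x ∈ Ioo L R, ∀ y ∈ Ioo L R, m y - m x ≤ K * (α x + β y) := by
    intro x hx y hy
    rcases lt_or_ge x y with h | h
    · exact hαβ x hx y hy h
    · have := hmono hy hx h
      have := mul_nonneg hK (add_nonneg (hα0 x) (hβ0 y))
      linarith
  obtain ⟨v, hv1, hv2⟩ : ∃ v : ℝ, (∀ x ∈ Ioo L R, -v - m x ≤ K * α x) ∧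
      ∀ y ∈ Ioo L R, v + m y ≤ K * β y := by
    have hbd : ∀ y ∈ Ioo L R, K * β y - m y ∈ upperBounds ((fun x => - m x - K * α x) '' Ioo L R) := by
      rintro y hy _ ⟨x, hx, rfl⟩
      have := hAll x hx y hy
      linarith
    refine ⟨sSup ((fun x => - m x - K * α x) '' Ioo L R), fun x hx => ?_, fun y hy => ?_⟩
    · have := le_csSup ⟨_, hbd p hp⟩ (mem_image_of_mem (fun x => - m x - K * α x) hx)
      beta_reduce at this; linarith
    · have := csSup_le ⟨_, mem_image_of_mem (fun x => - m x - K * α x) hp⟩ (hbd y hy)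
      linarith
  have key : 0 ≤ ∫ x in p..q, (4 * K * deriv f x ^ 2 * exp (C x) - f x ^ 2 * w x) := by
    rcases le_total (m q) (-v) with h | h
    · refine left_part hCc hw hm hα0 hα hK hf hp hq hpq (v := v) ?_ (fun x hx => hv1 x (hsub hx)) hfp
      intro x hx
      have := hmono (hsub hx) hq hx.2
      linarith
    rcases le_total (-v) (m p) with h' | h'
    · refine right_part hCc hw hm hβ0 hβ hK hf hp hq hpq (v := v) ?_ (fun x hx => hv2 x (hsub hx)) hfq
      intro x hx
      have := hmono hp (hsub hx) hx.1
      linarith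
    obtain ⟨c, hc, hcv⟩ := intermediate_value_Icc hpq 
      (fun x hx => (hm x (hsub hx)).continuousAt.continuousWithinAt) (show -v ∈ Icc (m p) (m q) from ⟨h', h⟩)
    have hcI := hsub hc
    have hD : ContinuousOn (fun x => 4 * K * deriv f x ^ 2 * exp (C x) - f x ^ 2 * w x) (Ioo L R) := by
      fun_prop
    rw [← intervalIntegral.integral_add_adjacent_intervals (ii hD hp hcI) (ii hD hcI hq)]
    apply add_nonneg
    · refine left_part hCc hw hm hα0 hα hK hf hp hcI hc.1 (v := v) ?_ 
        (fun x hx => hv1 x (hsub ⟨hx.1, hx.2.trans hc.2⟩)) hfp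
      intro x hx
      have := hmono (hsub ⟨hx.1, hx.2.trans hc.2⟩) hcI hx.2
      linarith
    · refine right_part hCc hw hm hβ0 hβ hK hf hcI hq hc.2 (v := v) ?_ 
        (fun x hx => hv2 x (hsub ⟨hc.1.trans hx.1, hx.2⟩)) hfq
      intro x hx
      have := hmono hcI (hsub ⟨hc.1.trans hx.1, hx.2⟩) hx.1
      linarith
  have e : ∫ x in p..q, (4 * K * deriv f x ^ 2 * exp (C x) - f x ^ 2 * w x) = 
      4 * K * (∫ x in p..q, deriv f x ^ 2 * exp (C x)) - ∫ x in p..q, f x ^ 2 * w x := by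
    rw [← intervalIntegral.integral_const_mul, ← intervalIntegral.integral_sub]
    · simp only [mul_assoc]
    · exact (ii hA hp hq).const_mul _
    · exact ii hB hp hq
  linarith

end DPB
namespace DPB

lemma integral_dens {L R : ℝ} {w f : ℝ → ℝ} {p q : ℝ} (hw : ContinuousOn w (Ioo L R))
    (hpos : ∀ x ∈ Ioo L R, 0 < w x) (hp : p ∈ Ioo L R) (hq : q ∈ Ioo L R) (hpq : p ≤ q)
    (h0 : ∀ x, x ∉ Ioo p q → f x = 0) :
    ∫ x, f x ^ 2 ∂(dens L R w) = ∫ x in p..q, f x ^ 2 * w x := by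
  have hsub : Ioc p q ⊆ Ioo L R := fun x hx => ⟨hp.1.trans hx.1, hx.2.trans_lt hq.2⟩
  rw [dens, integral_withDensity_eq_integral_toReal_smul₀]
  · rw [setIntegral_eq_of_subset_of_forall_sdiff_eq_zero (s := Ioc p q) measurableSet_Ioo hsub,
      intervalIntegral.integral_of_le hpq]
    · refine setIntegral_congr_fun measurableSet_Ioc fun x hx => ?_
      simp only [smul_eq_mul]
      rw [ENNReal.toReal_ofReal (hpos x (hsub hx)).le, mul_comm]
    · intro x hx
      rw [h0 x (fun h => hx.2 (Ioo_subset_Ioc_self h))]; simp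
  · exact (hw.aemeasurable measurableSet_Ioo).ennreal_ofReal
  · simp

lemma integral_energy {L R : ℝ} {C f : ℝ → ℝ} {p q : ℝ} 
    (hp : L ≤ p) (hq : q ≤ R) 
    (h0 : ∀ x, x ∉ Ioo p q → f x = 0) :
    ∫ x in L..R, f x ^ 2 * exp (C x) = ∫ x in p..q, f x ^ 2 * exp (C x) := by
  have hs : Function.support (fun x => f x ^ 2 * exp (C x)) ⊆ Ioo p q := by
    intro x hx
    by_contra h
    exact hx (by simp [h0 x h])
  rw [intervalIntegral.integral_eq_integral_of_support_subset (hs.trans Ioo_subset_Ioc_self),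
    intervalIntegral.integral_eq_integral_of_support_subset]
  exact fun x hx => ⟨hp.trans_lt (hs hx).1, (hs hx).2.le.trans hq⟩

lemma compact_in {L R : ℝ} {K : Set ℝ} (hLR : L < R) (hK : IsCompact K) (hs : K ⊆ Ioo L R) :
    ∃ p ∈ Ioo L R, ∃ q ∈ Ioo L R, p < q ∧ K ⊆ Ioo p q := by
  rcases K.eq_empty_or_nonempty with rfl | hne
  · obtain ⟨p, hp1, hp2⟩ := exists_between hLR
    obtain ⟨q, hq1, hq2⟩ := exists_between hp2
    exact ⟨p, ⟨hp1, hp2⟩, q, ⟨hp1.trans hq1, hq2⟩, hq1, by simp⟩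
  · obtain ⟨x, hx⟩ := hK.exists_isLeast hne
    obtain ⟨y, hy⟩ := hK.exists_isGreatest hne
    obtain ⟨p, hp1, hp2⟩ := exists_between (hs hx.1).1
    obtain ⟨q, hq1, hq2⟩ := exists_between (hs hy.1).2
    have hxy := hx.2 hy.1
    exact ⟨p, ⟨hp1, by linarith⟩, q, ⟨by linarith, hq2⟩, by linarith, fun z hz => 
      ⟨hp2.trans_le (hx.2 hz), (hy.2 hz).trans_lt hq1⟩⟩

lemma bump {l r : ℝ} (hlr : l < r) {C : ℝ → ℝ} (hC : ContinuousOn C (Ioo l r)) {s : ℝ} (hs : 0 < s)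
    (hW : (∫⁻ t in Ioo l r, ENNReal.ofReal (exp (-C t)))⁻¹ < ENNReal.ofReal s) :
    ∃ g : ℝ → ℝ, ContDiff ℝ (⊤ : ℕ∞) g ∧ ∃ p ∈ Ioo l r, ∃ q ∈ Ioo l r, p < q ∧
      (∀ x, x ∉ Ioo p q → g x = 0) ∧ ∫ x in p..q, g x = 1 ∧ 
      ∫ x in p..q, g x ^ 2 * exp (C x) ≤ s := by
  have hE : ContinuousOn (fun t => exp (-C t)) (Ioo l r) := by fun_prop
  obtain ⟨p0, hp0, q0, hq0, hpq0, hJ⟩ : ∃ p0 ∈ Ioo l r, ∃ q0 ∈ Ioo l r, p0 < q0 ∧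
      s⁻¹ < ∫ t in p0..q0, exp (-C t) := by
    have h1 : ENNReal.ofReal s⁻¹ < ∫⁻ t in Ioo l r, ENNReal.ofReal (exp (-C t)) := by
      rw [ENNReal.ofReal_inv_of_pos hs]
      exact ENNReal.inv_lt_iff_inv_lt.1 hW
    have t0 : Tendsto (fun n : ℕ => (r - l) / ((n : ℝ) + 3)) atTop (𝓝 0) := by
      apply Tendsto.div_atTop tendsto_const_nhds
      exact tendsto_atTop_add_const_right _ _ tendsto_natCast_atTop_atTop
    have ta : Tendsto (fun n : ℕ => l + (r - l) / ((n : ℝ) + 3)) atTop (𝓝 l) := by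
      simpa using t0.const_add l
    have tb : Tendsto (fun n : ℕ => r - (r - l) / ((n : ℝ) + 3)) atTop (𝓝 r) := by
      simpa using t0.const_sub r
    have hlim := (aecover_Ioo_of_Icc (μ := volume) ta tb).lintegral_tendsto_of_countably_generated
      (f := fun t => ENNReal.ofReal (exp (-C t))) 
      (hE.aemeasurable measurableSet_Ioo).ennreal_ofReal
    obtain ⟨n, hn⟩ := (hlim.eventually (lt_mem_nhds h1)).exists
    have hd0 : 0 < (r - l) / ((n : ℝ) + 3) := div_pos (sub_pos.2 hlr) (by positivity)
    have hd1 : (r - l) / ((n : ℝ) + 3) ≤ (r - l) / 3 := by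
      apply div_le_div_of_nonneg_left (sub_pos.2 hlr).le (by norm_num)
      have : (0:ℝ) ≤ n := by positivity
      linarith
    have ha : l + (r - l) / ((n : ℝ) + 3) ∈ Ioo l r := ⟨by linarith, by linarith⟩
    have hb : r - (r - l) / ((n : ℝ) + 3) ∈ Ioo l r := ⟨by linarith, by linarith⟩
    have hab : l + (r - l) / ((n : ℝ) + 3) < r - (r - l) / ((n : ℝ) + 3) := by linarith
    refine ⟨_, ha, _, hb, hab, ?_⟩
    have hsub : Icc (l + (r - l) / ((n : ℝ) + 3)) (r - (r - l) / ((n : ℝ) + 3)) ⊆ Ioo l r :=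
      fun x hx => ⟨ha.1.trans_le hx.1, hx.2.trans_lt hb.2⟩
    rw [Measure.restrict_restrict measurableSet_Icc, inter_eq_self_of_subset_left hsub, ← restrict_Ioc_eq_restrict_Icc,
      ← ofReal_integral_eq_lintegral_ofReal (ii hE ha hb).1 
        (Eventually.of_forall fun _ => (exp_pos _).le),
      ← intervalIntegral.integral_of_le hab.le] at hn
    exact (ENNReal.ofReal_lt_ofReal_iff_of_nonneg (by positivity)).1 hn
  set J := ∫ t in p0..q0, exp (-C t) with hJdef
  have hJpos : 0 < J := lt_trans (by positivity) hJ
  have hsJ : 1 < s * J := by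
    have := mul_lt_mul_of_pos_left hJ hs
    rwa [mul_inv_cancel₀ hs.ne'] at this
  obtain ⟨ε, hε0, hε1, hε⟩ : ∃ ε : ℝ, 0 < ε ∧ ε < 1 ∧ (1 + ε) ^ 2 ≤ s * J * (1 - ε) ^ 2 := by
    have hc : Continuous (fun ε : ℝ => s * J * (1 - ε) ^ 2 - (1 + ε) ^ 2) := by fun_prop
    have h0 : ∀ᶠ ε in 𝓝 (0:ℝ), 0 < s * J * (1 - ε) ^ 2 - (1 + ε) ^ 2 :=
      hc.continuousAt.eventually (lt_mem_nhds (by simp; linarith))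
    have h1 : ∀ᶠ ε in 𝓝[>] (0:ℝ), 0 < ε ∧ ε < 1 ∧ 0 < s * J * (1 - ε) ^ 2 - (1 + ε) ^ 2 := by
      filter_upwards [self_mem_nhdsWithin, nhdsWithin_le_nhds h0, 
        nhdsWithin_le_nhds (gt_mem_nhds (show (0:ℝ) < 1 by norm_num))] with x a b c
      exact ⟨a, c, b⟩
    obtain ⟨ε, a, b, c⟩ := h1.exists
    exact ⟨ε, a, b, by linarith⟩
  obtain ⟨d, hd0, hd1⟩ := exists_between (show 0 < min (p0 - l) (r - q0) from 
    lt_min (sub_pos.2 hp0.1) (sub_pos.2 hq0.2))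
  have hdl := hd1.trans_le (min_le_left _ _)
  have hdr := hd1.trans_le (min_le_right _ _)
  let ψ : ContDiffBump ((p0 + q0) / 2) := ⟨(q0 - p0) / 2, (q0 - p0) / 2 + d, by linarith, by linarith⟩
  have hp : p0 - d ∈ Ioo l r := ⟨by linarith, by linarith [hp0.2]⟩
  have hq : q0 + d ∈ Ioo l r := ⟨by linarith [hq0.1], by linarith⟩
  set p := p0 - d
  set q := q0 + d
  have hpq : p < q := by simp only [p, q]; linarith
  have hψ1 : ∀ x ∈ Icc p0 q0, ψ x = 1 := by
    intro x hx
    apply ψ.one_of_mem_closedBall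
    rw [Real.closedBall_eq_Icc]
    simp only [ψ]
    constructor <;> [linarith [hx.1]; linarith [hx.2]]
  have hψ0 : ∀ x, x ∉ Ioo p q → ψ x = 0 := by
    intro x hx
    rw [← Function.notMem_support, ψ.support_eq, Real.ball_eq_Ioo]
    intro h
    apply hx
    simp only [ψ] at h
    simp only [p, q]
    constructor <;> [linarith [h.1]; linarith [h.2]]
  have hψc : Continuous ψ := ψ.continuous
  have hsub : Icc p q ⊆ Ioo l r := fun x hx => ⟨hp.1.trans_le hx.1, hx.2.trans_lt hq.2⟩
  have hclamp : Continuous (fun t => exp (-C (projIcc p q hpq.le t))) := by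
    have h1 : Continuous (fun t : Icc p q => C t) := (hC.mono hsub).domRestrict
    have h2 := h1.comp (continuous_projIcc (h := hpq.le))
    exact continuous_exp.comp h2.neg
  obtain ⟨h, hh, happ, -⟩ := hclamp.exists_contDiff_approx (⊤ : ℕ∞) 
    (ε := fun t => ε * exp (-C (projIcc p q hpq.le t))) (by fun_prop)
    (fun t => mul_pos hε0 (exp_pos _))
  have happ' : ∀ t ∈ Icc p q, (1 - ε) * exp (-C t) ≤ h t ∧ h t ≤ (1 + ε) * exp (-C t) := by
    intro t ht
    have := happ t
    rw [projIcc_of_mem hpq.le ht, Real.dist_eq, abs_lt] at this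
    simp only at this
    constructor <;> linarith [this.1, this.2]
  have hhc := hh.continuous
  set P := ∫ t in p..q, ψ t * exp (-C t) with hPdef
  have hPc : ContinuousOn (fun t => ψ t * exp (-C t)) (Ioo l r) := by fun_prop
  have hPJ : J ≤ P := by
    have e : J = ∫ t in p0..q0, ψ t * exp (-C t) := by
      apply intervalIntegral.integral_congr
      intro t ht
      rw [uIcc_of_le hpq0.le] at ht
      simp [hψ1 t ht]
    rw [e]
    apply intervalIntegral.integral_mono_interval
    · simp only [p]; linarith
    · exact hpq0.le
    · simp only [q]; linarith
    · exact Eventually.of_forall fun t => mul_nonneg ψ.nonneg (exp_pos _).le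
    · exact ii hPc hp hq
  have hPpos : 0 < P := hJpos.trans_le hPJ
  set G := ∫ t in p..q, h t * ψ t with hGdef
  have hGP : (1 - ε) * P ≤ G := by
    rw [hPdef, ← intervalIntegral.integral_const_mul]
    apply intervalIntegral.integral_mono_on hpq.le
    · exact (ii hPc hp hq).const_mul _
    · exact (hhc.mul hψc).intervalIntegrable _ _
    · intro t ht
      have := mul_le_mul_of_nonneg_right (happ' t ht).1 (ψ.nonneg (x := t))
      linarith
  have h1ε : 0 < 1 - ε := by linarith
  have hGpos : 0 < G := lt_of_lt_of_le (by positivity) hGP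
  have hQc : ContinuousOn (fun t => (h t * ψ t) ^ 2 * exp (C t)) (Ioo l r) := by fun_prop
  have hQ : ∫ t in p..q, (h t * ψ t) ^ 2 * exp (C t) ≤ (1 + ε) ^ 2 * P := by
    rw [hPdef, ← intervalIntegral.integral_const_mul]
    apply intervalIntegral.integral_mono_on hpq.le
    · exact ii hQc hp hq
    · exact (ii hPc hp hq).const_mul _
    · intro t ht
      have h0 : 0 ≤ h t := le_trans (by positivity) (happ' t ht).1
      have h1 : h t ^ 2 ≤ ((1 + ε) * exp (-C t)) ^ 2 := pow_le_pow_left₀ h0 (happ' t ht).2 2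
      have h2 : ψ t ^ 2 ≤ ψ t := by
        have := ψ.nonneg (x := t)
        have := ψ.le_one (x := t)
        nlinarith
      calc (h t * ψ t) ^ 2 * exp (C t) = h t ^ 2 * ψ t ^ 2 * exp (C t) := by ring
        _ ≤ ((1 + ε) * exp (-C t)) ^ 2 * ψ t * exp (C t) := by gcongr
        _ = (1 + ε) ^ 2 * (ψ t * exp (-C t)) * (exp (-C t) * exp (C t)) := by ring
        _ = _ := by rw [← exp_add]; simp
  refine ⟨fun t => G⁻¹ * (h t * ψ t), ?_, p, hp, q, hq, hpq, ?_, ?_, ?_⟩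
  · exact contDiff_const.mul (hh.mul ψ.contDiff)
  · intro x hx
    simp [hψ0 x hx]
  · rw [intervalIntegral.integral_const_mul, ← hGdef, inv_mul_cancel₀ hGpos.ne']
  · have : ∀ t, (G⁻¹ * (h t * ψ t)) ^ 2 * exp (C t) = (G ^ 2)⁻¹ * ((h t * ψ t) ^ 2 * exp (C t)) := by
      intro t; rw [mul_pow, inv_pow]; ring
    simp only [this]
    rw [intervalIntegral.integral_const_mul, inv_mul_le_iff₀ (by positivity)]
    refine hQ.trans ?_
    calc (1 + ε) ^ 2 * P ≤ s * J * (1 - ε) ^ 2 * P := by gcongr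
      _ ≤ s * P * (1 - ε) ^ 2 * P := by gcongr
      _ = ((1 - ε) * P) ^ 2 * s := by ring
      _ ≤ G ^ 2 * s := by gcongr

end DPB
namespace DPB

lemma prim {g : ℝ → ℝ} {p q : ℝ} (hg : ContDiff ℝ (⊤ : ℕ∞) g) (hpq : p < q)
    (h0 : ∀ x, x ∉ Ioo p q → g x = 0) (h1 : ∫ x in p..q, g x = 1) :
    ∃ F : ℝ → ℝ, ContDiff ℝ (⊤ : ℕ∞) F ∧ (∀ x, HasDerivAt F (g x) x) ∧
      (∀ x ≤ p, F x = 0) ∧ (∀ x, q ≤ x → F x = 1) := by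
  have hgc := hg.continuous
  have hd : ∀ x, HasDerivAt (fun u => ∫ t in p..u, g t) (g x) x := fun x =>
    intervalIntegral.integral_hasDerivAt_right (hgc.intervalIntegrable _ _)
      (hgc.stronglyMeasurableAtFilter _ _) hgc.continuousAt
  refine ⟨fun u => ∫ t in p..u, g t, ?_, hd, ?_, ?_⟩
  · rw [contDiff_infty_iff_deriv]
    refine ⟨fun x => (hd x).differentiableAt, ?_⟩
    rwa [show deriv (fun u => ∫ t in p..u, g t) = g from funext fun x => (hd x).deriv]
  · intro x hx
    have : ∫ t in p..x, g t = ∫ t in p..x, (0:ℝ) := by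
      apply intervalIntegral.integral_congr
      intro t ht
      rw [uIcc_of_ge hx] at ht
      exact h0 t fun h => absurd ht.2 (not_le.2 h.1)
    beta_reduce
    rw [this]; simp
  · intro x hx
    have : ∫ t in q..x, g t = ∫ t in q..x, (0:ℝ) := by
      apply intervalIntegral.integral_congr
      intro t ht
      rw [uIcc_of_le hx] at ht
      exact h0 t fun h => absurd ht.1 (not_le.2 h.2)
    beta_reduce
    rw [← intervalIntegral.integral_add_adjacent_intervals (hgc.intervalIntegrable p q)
      (hgc.intervalIntegrable q x), h1, this]; simp

lemma lower {L R : ℝ} {C w : ℝ → ℝ} {A s₁ s₂ x y : ℝ}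
    (hCc : ContinuousOn C (Ioo L R)) (hw : ContinuousOn w (Ioo L R))
    (hpos : ∀ x ∈ Ioo L R, 0 < w x)
    (hA : ∀ f : ℝ → ℝ, ContDiff ℝ (⊤ : ℕ∞) f → HasCompactSupport f →
      tsupport f ⊆ Ioo L R →
      (∫ x, f x ^ 2 ∂(dens L R w)) ≤ A ^ 2 * ∫ t in L..R, deriv f t ^ 2 * Real.exp (C t))
    (hx : x ∈ Ioo L R) (hy : y ∈ Ioo L R) (hxy : x < y) (hs₁ : 0 < s₁) (hs₂ : 0 < s₂)
    (h₁ : (dens L R (fun t => exp (-C t)) (Ioo L x))⁻¹ < ENNReal.ofReal s₁)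
    (h₂ : (dens L R (fun t => exp (-C t)) (Ioo y R))⁻¹ < ENNReal.ofReal s₂) :
    ∫ t in x..y, w t ≤ A ^ 2 * (s₁ + s₂) := by
  rw [dens_apply le_rfl hx.2.le] at h₁
  rw [dens_apply hy.1.le le_rfl] at h₂
  obtain ⟨g, hg, p, hp, q, hq, hpq, hg0, hg1, hgs⟩ := 
    bump hx.1 (hCc.mono (Ioo_subset_Ioo le_rfl hx.2.le)) hs₁ h₁
  obtain ⟨h, hh, p', hp', q', hq', hpq', hh0, hh1, hhs⟩ := 
    bump hy.2 (hCc.mono (Ioo_subset_Ioo hy.1.le le_rfl)) hs₂ h₂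
  obtain ⟨F, hF, hFd, hF0, hF1⟩ := prim hg hpq hg0 hg1
  obtain ⟨H, hH, hHd, hH0, hH1⟩ := prim hh hpq' hh0 hh1
  have hqx := hq.2
  have hyp' := hp'.1
  have hpI : p ∈ Ioo L R := ⟨hp.1, hp.2.trans hx.2⟩
  have hqI : q' ∈ Ioo L R := ⟨hy.1.trans hq'.1, hq'.2⟩
  have hpq2 : p < q' := by linarith
  have hf0 : ∀ t, t ∉ Ioo p q' → F t - H t = 0 := by
    intro t ht
    rcases le_or_gt t p with h | h
    · rw [hF0 t h, hH0 t (by linarith)]; simp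
    · have : q' ≤ t := by
        by_contra h'
        exact ht ⟨h, not_le.1 h'⟩
      rw [hF1 t (by linarith), hH1 t this]; simp
  have hts : tsupport (fun t => F t - H t) ⊆ Icc p q' := by
    apply closure_minimal _ isClosed_Icc
    intro t ht
    by_contra h
    exact ht (hf0 t fun h' => h (Ioo_subset_Icc_self h'))
  have hsub : Icc p q' ⊆ Ioo L R := fun x hx => ⟨hpI.1.trans_le hx.1, hx.2.trans_lt hqI.2⟩
  have key := hA (fun t => F t - H t) (hF.sub hH) 
    (isCompact_Icc.of_isClosed_subset (isClosed_tsupport _) hts) (hts.trans hsub)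
  rw [integral_dens hw hpos hpI hqI hpq2.le hf0] at key
  have hder : ∀ t, deriv (fun t => F t - H t) t = g t - h t := fun t => 
    ((hFd t).sub (hHd t)).deriv
  simp only [hder] at key
  have hgc := hg.continuous
  have hhc := hh.continuous
  have hFc := hF.continuous
  have hHc := hH.continuous
  have hcg : ContinuousOn (fun t => g t ^ 2 * exp (C t)) (Ioo L R) := by fun_prop
  have hch : ContinuousOn (fun t => h t ^ 2 * exp (C t)) (Ioo L R) := by fun_prop
  have e1 : ∫ t in L..R, (g t - h t) ^ 2 * exp (C t) = 
      (∫ t in p..q, g t ^ 2 * exp (C t)) + ∫ t in p'..q', h t ^ 2 * exp (C t) := by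
    rw [integral_energy (f := fun t => g t - h t) hpI.1.le hqI.2.le]
    · rw [← integral_energy (L := p) (R := q') le_rfl (by linarith) hg0,
        ← integral_energy (L := p) (R := q') (by linarith) le_rfl hh0,
        ← intervalIntegral.integral_add (ii hcg hpI hqI) (ii hch hpI hqI)]
      apply intervalIntegral.integral_congr
      intro t _
      beta_reduce
      by_cases ht : t ∈ Ioo p q
      · rw [hh0 t (fun h' => by linarith [h'.1, ht.2])]; ring
      · rw [hg0 t ht]; ring
    · intro t ht
      rw [hg0 t fun h' => ht ⟨h'.1, by linarith [h'.2]⟩, 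
        hh0 t fun h' => ht ⟨by linarith [h'.1], h'.2⟩]
      simp
  rw [e1] at key
  have hcf : ContinuousOn (fun t => (F t - H t) ^ 2 * w t) (Ioo L R) := by fun_prop
  have e2 : ∫ t in x..y, w t ≤ ∫ t in p..q', (F t - H t) ^ 2 * w t := by
    have e : ∫ t in x..y, w t = ∫ t in x..y, (F t - H t) ^ 2 * w t := by
      apply intervalIntegral.integral_congr
      intro t ht
      rw [uIcc_of_le hxy.le] at ht
      beta_reduce
      rw [hF1 t (by linarith [ht.1]), hH0 t (by linarith [ht.2])]
      ring
    rw [e]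
    apply intervalIntegral.integral_mono_interval
    · linarith
    · exact hxy.le
    · linarith [hq'.1]
    · refine (ae_restrict_iff' measurableSet_Ioc).2 (Eventually.of_forall fun t ht => ?_)
      exact mul_nonneg (sq_nonneg _) (hpos t (hsub (Ioc_subset_Icc_self ht))).le
    · exact ii hcf hpI hqI
  calc _ ≤ _ := e2
    _ ≤ _ := key
    _ ≤ _ := by gcongr

end DPB

open DPB in
/-- Basic estimates `κ₀ ≤ A₀ ≤ 2κ₀` for the optimal constant in the Poincaré-type
inequality with double Dirichlet boundary conditions
`∫ f² dμ ≤ A₀² ∫ f'² e^C`, `f ∈ C_c^∞((-M, N))`, where `μ(dx) = (e^C/a) dx` and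
`κ₀⁻² = inf_{-M<x<y<N} [ν̂(-M,x)⁻¹ + ν̂(y,N)⁻¹] μ(x,y)⁻¹`, `ν̂(dx) = e^{-C} dx`. -/
theorem dirichlet_poincare_basic_estimates
    (M N : ℝ) (hMN : -M < N)
    (a b : ℝ → ℝ)
    (ha : ContinuousOn a (Icc (-M) N)) (hb : ContinuousOn b (Icc (-M) N))
    (hapos : ∀ x ∈ Ioo (-M) N, 0 < a x)
    (θ : ℝ) (hθ : θ ∈ Ioo (-M) N)
    (C : ℝ → ℝ) (hC : ∀ x, C x = ∫ t in θ..x, b t / a t)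
    (μ νhat : Measure ℝ)
    (hμ : μ = (volume.restrict (Ioo (-M) N)).withDensity
        fun x => ENNReal.ofReal (Real.exp (C x) / a x))
    (hνhat : νhat = (volume.restrict (Ioo (-M) N)).withDensity
        fun x => ENNReal.ofReal (Real.exp (-C x)))
    (κ₀ : ℝ) (hκ₀pos : 0 < κ₀)
    (hκ₀ : ENNReal.ofReal (κ₀ ^ (-2 : ℝ)) =
      ⨅ (x : ℝ) (y : ℝ) (_ : -M < x) (_ : x < y) (_ : y < N),
        ((νhat (Ioo (-M) x))⁻¹ + (νhat (Ioo y N))⁻¹) * (μ (Ioo x y))⁻¹)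
    (A₀ : ℝ) (hA₀nonneg : 0 ≤ A₀)
    (hA₀ : ∀ f : ℝ → ℝ, ContDiff ℝ (⊤ : ℕ∞) f → HasCompactSupport f →
      tsupport f ⊆ Ioo (-M) N →
      (∫ x, f x ^ 2 ∂μ) ≤ A₀ ^ 2 * ∫ t in (-M)..N, deriv f t ^ 2 * Real.exp (C t))
    (hA₀least : ∀ A' : ℝ, 0 ≤ A' →
      (∀ f : ℝ → ℝ, ContDiff ℝ (⊤ : ℕ∞) f → HasCompactSupport f →
        tsupport f ⊆ Ioo (-M) N →
        (∫ x, f x ^ 2 ∂μ) ≤ A' ^ 2 * ∫ t in (-M)..N, deriv f t ^ 2 * Real.exp (C t)) →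
      A₀ ≤ A') :
    κ₀ ≤ A₀ ∧ A₀ ≤ 2 * κ₀ := by
  set L := -M with hL
  have hr : ContinuousOn (fun t => b t / a t) (Ioo L N) :=
    (hb.mono Ioo_subset_Icc_self).div (ha.mono Ioo_subset_Icc_self) fun x hx => (hapos x hx).ne'
  have hCc : ContinuousOn C (Ioo L N) := by
    intro x hx
    have := (hasDeriv hr hθ hx).continuousAt.continuousWithinAt (s := Ioo L N)
    rwa [← funext hC] at this
  set w : ℝ → ℝ := fun x => exp (C x) / a x with hwdef
  have hw : ContinuousOn w (Ioo L N) :=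
    (continuous_exp.comp_continuousOn hCc).div (ha.mono Ioo_subset_Icc_self) 
      fun x hx => (hapos x hx).ne'
  have hwpos : ∀ x ∈ Ioo L N, 0 < w x := fun x hx => div_pos (exp_pos _) (hapos x hx)
  have hE : ContinuousOn (fun t => exp (-C t)) (Ioo L N) := by fun_prop
  have hEpos : ∀ x ∈ Ioo L N, 0 < exp (-C x) := fun x _ => exp_pos _
  have hμ' : μ = dens L N w := hμ
  have hν' : νhat = dens L N (fun t => exp (-C t)) := hνhat
  clear hμ hνhat
  subst hμ' hν'
  obtain ⟨α, hα0, hα, hαd⟩ := alpha hE hEpos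
  obtain ⟨β, hβ0, hβ, hβd⟩ := beta hE hEpos
  have hterm : ∀ x y, L < x → x < y → y < N →
      ((dens L N (fun t => exp (-C t)) (Ioo L x))⁻¹ + (dens L N (fun t => exp (-C t)) (Ioo y N))⁻¹)
        * (dens L N w (Ioo x y))⁻¹ = ENNReal.ofReal ((α x + β y) / ∫ t in x..y, w t) := by
    intro x y h1 h2 h3
    have hx : x ∈ Ioo L N := ⟨h1, h2.trans h3⟩
    have hy : y ∈ Ioo L N := ⟨h1.trans h2, h3⟩
    have hp := int_pos hw hwpos hx hy h2
    rw [hα x hx, hβ y hy, dens_Ioo hw hwpos hx hy h2.le, ← ENNReal.ofReal_add (hα0 x) (hβ0 y),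
      ← ENNReal.ofReal_inv_of_pos hp, ← ENNReal.ofReal_mul (add_nonneg (hα0 x) (hβ0 y)),
      div_eq_mul_inv]
  have hκ2 : κ₀ ^ (-2 : ℝ) = (κ₀ ^ 2)⁻¹ := by
    rw [Real.rpow_neg hκ₀pos.le]; norm_num
  rw [hκ2] at hκ₀
  constructor
  · have hlow : ∀ x y, L < x → x < y → y < N → ∫ t in x..y, w t ≤ A₀ ^ 2 * (α x + β y) := by
      intro x y h1 h2 h3
      have hx : x ∈ Ioo L N := ⟨h1, h2.trans h3⟩
      have hy : y ∈ Ioo L N := ⟨h1.trans h2, h3⟩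
      have hδ : ∀ δ : ℝ, 0 < δ → ∫ t in x..y, w t ≤ A₀ ^ 2 * ((α x + δ) + (β y + δ)) := by
        intro δ hδ
        have hax := hα0 x
        have hby := hβ0 y
        apply lower hCc hw hwpos hA₀ hx hy h2 (by linarith) (by linarith)
        · rw [hα x hx, ENNReal.ofReal_lt_ofReal_iff (by linarith)]; linarith
        · rw [hβ y hy, ENNReal.ofReal_lt_ofReal_iff (by linarith)]; linarith
      have hc : Continuous (fun δ : ℝ => A₀ ^ 2 * ((α x + δ) + (β y + δ))) := by fun_prop
      have ht : Tendsto (fun δ : ℝ => A₀ ^ 2 * ((α x + δ) + (β y + δ))) (𝓝[>] 0) 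
          (𝓝 (A₀ ^ 2 * (α x + β y))) := by
        have := (hc.tendsto 0).mono_left (nhdsWithin_le_nhds (s := Ioi 0))
        simpa using this
      exact ge_of_tendsto ht (by filter_upwards [self_mem_nhdsWithin] with δ h using hδ δ h)
    have hApos : 0 < A₀ := by
      rcases hA₀nonneg.eq_or_lt with h | h
      · exfalso
        obtain ⟨y, hy1, hy2⟩ := exists_between hθ.2
        have h5 := hlow θ y hθ.1 hy1 hy2
        have h6 := int_pos hw hwpos hθ ⟨hθ.1.trans hy1, hy2⟩ hy1
        rw [← h] at h5
        norm_num at h5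
        linarith
      · exact h
    have hle : ENNReal.ofReal ((A₀ ^ 2)⁻¹) ≤ ENNReal.ofReal ((κ₀ ^ 2)⁻¹) := by
      rw [hκ₀]
      refine le_iInf fun x => le_iInf fun y => le_iInf fun h1 => le_iInf fun h2 => le_iInf fun h3 => ?_
      rw [hterm x y h1 h2 h3]
      apply ENNReal.ofReal_le_ofReal
      have hp := int_pos hw hwpos ⟨h1, h2.trans h3⟩ ⟨h1.trans h2, h3⟩ h2
      rw [le_div_iff₀ hp, inv_mul_le_iff₀ (by positivity)]
      exact hlow x y h1 h2 h3
    rw [ENNReal.ofReal_le_ofReal_iff (by positivity), inv_le_inv₀ (by positivity) (by positivity)] at hle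
    exact (pow_le_pow_iff_left₀ hκ₀pos.le hA₀nonneg (by norm_num)).1 hle
  · apply hA₀least _ (by positivity)
    intro f hf hfc hfs
    obtain ⟨p, hp, q, hq, hpq, hK⟩ := compact_in hMN hfc hfs
    have hf0 : ∀ x, x ∉ Ioo p q → f x = 0 := fun x hx => 
      image_eq_zero_of_notMem_tsupport fun h => hx (hK h)
    have hf0' : ∀ x, x ∉ Ioo p q → deriv f x = 0 := fun x hx => by
      by_contra h
      exact hx (hK (support_deriv_subset h))
    rw [integral_dens hw hwpos hp hq hpq.le hf0, integral_energy hp.1.le hq.2.le hf0']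
    have hm : ∀ x ∈ Ioo L N, HasDerivAt (fun u => ∫ t in θ..u, w t) (w x) x := fun x hx => 
      hasDeriv hw hθ hx
    have hdiff : ∀ x ∈ Ioo L N, ∀ y ∈ Ioo L N, 
        (∫ t in θ..y, w t) - (∫ t in θ..x, w t) = ∫ t in x..y, w t := fun x hx y hy => 
      intervalIntegral.integral_interval_sub_left (ii hw hθ hy) (ii hw hθ hx)
    have := upper (K := κ₀ ^ 2) hCc hw hm ?_ hα0 hαd hβ0 hβd ?_ (by positivity) 
      (hf.of_le (by exact_mod_cast le_top)) hp hq hpq.le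
      (hf0 p (by simp)) (hf0 q (by simp))
    · refine this.trans (le_of_eq ?_)
      ring
    · intro x hx y hy hxy
      rcases hxy.eq_or_lt with rfl | h
      · exact le_rfl
      have h1 := hdiff x hx y hy
      have h2 := int_pos hw hwpos hx hy h
      beta_reduce
      linarith
    · intro x hx y hy hxy
      rw [hdiff x hx y hy]
      have hle : ENNReal.ofReal ((κ₀ ^ 2)⁻¹) ≤ ENNReal.ofReal ((α x + β y) / ∫ t in x..y, w t) := by
        rw [hκ₀, ← hterm x y hx.1 hxy hy.2]
        exact iInf_le_of_le x (iInf_le_of_le y (iInf_le_of_le hx.1 (iInf_le_of_le hxy 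
          (iInf_le_of_le hy.2 le_rfl))))
      have hp := int_pos hw hwpos hx hy hxy
      rw [ENNReal.ofReal_le_ofReal_iff (div_nonneg (add_nonneg (hα0 x) (hβ0 y)) hp.le),
        le_div_iff₀ hp, inv_mul_le_iff₀ (by positivity)] at hle
      exact hle
end

section
/- For 1 < p ≤ q < ∞ define the constant k_{q,p} by k_{q,p} = [(q-p)/(p·Beta(p/(q-p), p(q-1)/(q-p)))]^{1/p - 1/q} when q > p, and k_{p,p} = p^{1/p}·(p*)^{1/p*} where 1/p + 1/p* = 1. Then k_{q,p} ≤ 2 for all 1 < p ≤ q < ∞. -/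
open Real

lemma aux_four {x y z w : ℝ} (hx : 0 < x) (hy : x ≤ y) (hz : x ≤ z) (h : y + z = x + w) :
    Gamma y * Gamma z ≤ Gamma x * Gamma w := by
  rcases eq_or_lt_of_le hy with rfl | hy'
  · have : z = w := by linarith
    rw [this]
  have hw : 0 < w - x := by linarith
  have hw0 : 0 < w := by linarith
  have gx := Gamma_pos_of_pos hx
  have gy := Gamma_pos_of_pos (show 0 < y by linarith)
  have gz := Gamma_pos_of_pos (show 0 < z by linarith)
  have gw := Gamma_pos_of_pos hw0
  have l0 : 0 ≤ (y - x) / (w - x) := div_nonneg (by linarith) hw.le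
  have l1 : 0 ≤ (z - x) / (w - x) := div_nonneg (by linarith) hw.le
  have ls : (y - x) / (w - x) + (z - x) / (w - x) = 1 := by
    rw [← add_div, div_eq_one_iff_eq hw.ne']; linarith
  have e1 := convexOn_log_Gamma.2 (Set.mem_Ioi.2 hw0) (Set.mem_Ioi.2 hx) l0 l1 ls
  have e2 := convexOn_log_Gamma.2 (Set.mem_Ioi.2 hw0) (Set.mem_Ioi.2 hx) l1 l0 (by linarith)
  have h1 : (y - x) / (w - x) * w + (z - x) / (w - x) * x = y := by
    field_simp
    have : z = x + w - y := by linarith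
    subst this; ring
  have h2 : (z - x) / (w - x) * w + (y - x) / (w - x) * x = z := by
    field_simp
    have : z = x + w - y := by linarith
    subst this; ring
  simp only [smul_eq_mul, Function.comp] at e1 e2
  rw [h1] at e1
  rw [h2] at e2
  rw [← Real.log_le_log_iff (by positivity) (by positivity), Real.log_mul gy.ne' gz.ne',
    Real.log_mul gx.ne' gw.ne']
  have h3 : (z - x) / (w - x) = 1 - (y - x) / (w - x) := by linarith
  rw [h3] at e1 e2
  linarith

lemma aux_key {a b : ℝ} (ha : 0 < a) (hb : 1 < b) :
    Gamma (a + b) * 2 ^ (1 - (a + b)) ≤ a * (Gamma a * Gamma b) := by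
  have hd := Gamma_mul_Gamma_add_half ((a + b) / 2)
  rw [show 2 * ((a + b) / 2) = a + b by ring] at hd
  have h1 : Gamma ((a + b) / 2 + 1 / 2) * Gamma ((a + b) / 2 + 1 / 2)
      ≤ Gamma (a + 1) * Gamma b := by
    rcases le_total (a + 1) b with h | h
    · exact aux_four (by linarith) (by linarith) (by linarith) (by ring)
    · rw [mul_comm (Gamma (a + 1))]
      exact aux_four (by linarith) (by linarith) (by linarith) (by ring)
  by_cases hs : (a + b) / 2 < 1 / 2
  · linarith
  have h2 : Gamma 1 * Gamma ((a + b) / 2) ≤ Gamma (1 / 2) * Gamma ((a + b) / 2 + 1 / 2) :=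
    aux_four (by norm_num) (by norm_num) (by linarith) (by ring)
  rw [Gamma_one, Gamma_one_half_eq, one_mul] at h2
  rw [Gamma_add_one ha.ne'] at h1
  have gp := Gamma_pos_of_pos (show 0 < (a + b) / 2 + 1 / 2 by linarith)
  have sp : 0 < √π := Real.sqrt_pos.2 Real.pi_pos
  have h3 := mul_le_mul_of_nonneg_right h2 gp.le
  rw [hd] at h3
  have h4 : Gamma (a + b) * 2 ^ (1 - (a + b)) ≤
      Gamma ((a + b) / 2 + 1 / 2) * Gamma ((a + b) / 2 + 1 / 2) := by
    refine le_of_mul_le_mul_right ?_ sp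
    linarith
  linarith

lemma aux_beta {a b : ℝ} (ha : 0 < a) (hb : 0 < b) :
    ∫ t in (0:ℝ)..1, t ^ (a - 1) * (1 - t) ^ (b - 1) = Gamma a * Gamma b / Gamma (a + b) := by
  have h := ProbabilityTheory.beta_eq_betaIntegralReal a b ha hb
  rw [ProbabilityTheory.beta] at h
  rw [h, Complex.betaIntegral]
  have : ∫ x in (0:ℝ)..1, (x : ℂ) ^ ((a : ℂ) - 1) * (1 - (x : ℂ)) ^ ((b : ℂ) - 1)
      = ∫ x in (0:ℝ)..1, ((x ^ (a - 1) * (1 - x) ^ (b - 1) : ℝ) : ℂ) := by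
    apply intervalIntegral.integral_congr
    intro x hx
    rw [Set.uIcc_of_le zero_le_one] at hx
    simp only
    rw [Complex.ofReal_mul, Complex.ofReal_cpow hx.1, Complex.ofReal_cpow (by linarith [hx.2])]
    push_cast
    rfl
  rw [this, intervalIntegral.integral_ofReal, Complex.ofReal_re]

/-- The universal factor `k_{q,p}` in the basic estimates for the weighted Hardy
inequality satisfies `k_{q,p} ≤ 2` for all `1 < p ≤ q < ∞`. Here, for `q > p`,
`k_{q,p} = [(q-p)/(p·B(p/(q-p), p(q-1)/(q-p)))]^{1/p - 1/q}` with `B` the Beta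
function, and `k_{p,p} = p^{1/p} (p*)^{1/p*}` with `1/p + 1/p* = 1`. -/
theorem k_qp_le_two (p q : ℝ) (hp : 1 < p) (hpq : p ≤ q) :
    (if q = p then p ^ (1 / p) * (p / (p - 1)) ^ (1 - 1 / p)
      else ((q - p) / (p * ∫ t in (0:ℝ)..1,
          t ^ (p / (q - p) - 1) * (1 - t) ^ (p * (q - 1) / (q - p) - 1)))
        ^ (1 / p - 1 / q)) ≤ 2 := by
  have hp0 : 0 < p := by linarith
  split_ifs with hq
  · have hp1 : 0 < p - 1 := by linarith
    have h1 : 1 / p ≤ 1 := by rw [div_le_one hp0]; exact hp.le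
    refine (geom_mean_le_arith_mean2_weighted (by positivity) (by linarith) hp0.le
      (by positivity) (by ring)).trans (le_of_eq ?_)
    field_simp
    ring
  · have hlt : p < q := lt_of_le_of_ne hpq (Ne.symm hq)
    have hd : 0 < q - p := by linarith
    have hq0 : 0 < q := by linarith
    have ha : 0 < p / (q - p) := by positivity
    have hb : 1 < p * (q - 1) / (q - p) := by
      rw [lt_div_iff₀ hd]; nlinarith
    have hab : p / (q - p) + p * (q - 1) / (q - p) = p * q / (q - p) := by
      field_simp; ring
    have hexp : 1 / p - 1 / q = (p / (q - p) + p * (q - 1) / (q - p))⁻¹ := by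
      rw [hab]; field_simp
    rw [aux_beta ha (by linarith), hexp]
    have hbase : ∀ X : ℝ, (q - p) / (p * X) = 1 / (p / (q - p) * X) := by
      intro X
      rw [one_div, mul_inv, inv_div, div_mul_eq_div_div, div_eq_mul_inv ((q - p) / p)]
    rw [hbase]
    generalize p / (q - p) = a at *
    generalize p * (q - 1) / (q - p) = b at *
    have key := aux_key ha hb
    have ga := Gamma_pos_of_pos ha
    have gb := Gamma_pos_of_pos (show 0 < b by linarith)
    have gab := Gamma_pos_of_pos (show 0 < a + b by linarith)
    have hs : 0 < a + b := by linarith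
    rw [Real.rpow_inv_le_iff_of_pos (by positivity) (by norm_num) hs]
    rw [Real.rpow_sub (by norm_num), Real.rpow_one] at key
    have tp : (0:ℝ) < 2 ^ (a + b) := by positivity
    rw [← mul_div_assoc, one_div_div, div_le_iff₀ (by positivity)]
    rw [← mul_div_assoc, div_le_iff₀ tp] at key
    nlinarith
end

section
/- Fix p ∈ (1, ∞) and let p* = p/(p-1) be its conjugate exponent. For q > p define k_{q,p} = [(q-p)/(p·Beta(p/(q-p), p(q-1)/(q-p)))]^{1/p - 1/q}, where Beta is the Beta function. Then lim_{q → p+} k_{q,p} = p^{1/p}·(p*)^{1/p*}. -/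
open Real Filter Topology

lemma aux_pt (p t : ℝ) (hp : 1 < p) (ht0 : 0 < t) (ht1 : t < 1) :
    log t + (p - 1) * log (1 - t) ≤ log (1 / p) + (p - 1) * log (1 - 1 / p) := by
  have hp0 : 0 < p := by linarith
  have hp1 : 0 < p - 1 := by linarith
  have h1 : log (t / (1 / p)) ≤ t / (1 / p) - 1 := log_le_sub_one_of_pos (by positivity)
  have e : 1 - 1 / p = (p - 1) / p := by field_simp
  have h1t : 0 < 1 - t := by linarith
  have h2 : log ((1 - t) / ((p - 1) / p)) ≤ (1 - t) / ((p - 1) / p) - 1 :=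
    log_le_sub_one_of_pos (by positivity)
  rw [log_div (by positivity) (by positivity)] at h1 h2
  rw [e]
  have h3 := mul_le_mul_of_nonneg_left h2 hp1.le
  have e1 : t / (1 / p) - 1 + (p - 1) * ((1 - t) / ((p - 1) / p) - 1) = 0 := by
    field_simp; ring
  linarith

lemma aux_bounds (p q : ℝ) (hp : 1 < p) (hq : p < q) (hq2 : q - p < 1 / p) :
    (q - p) * exp ((p / (q - p) - 1) * log (1 / p - (q - p))
        + (p * (q - 1) / (q - p) - 1) * log (1 - 1 / p))
      ≤ (∫ t in (0:ℝ)..1, t ^ (p / (q - p) - 1) * (1 - t) ^ (p * (q - 1) / (q - p) - 1)) ∧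
    (∫ t in (0:ℝ)..1, t ^ (p / (q - p) - 1) * (1 - t) ^ (p * (q - 1) / (q - p) - 1))
      ≤ exp ((p / (q - p) - 1) * (log (1 / p) + (p - 1) * log (1 - 1 / p))) := by
  have hp0 : 0 < p := by linarith
  have he : 0 < q - p := by linarith
  have hip : 1 / p < 1 := by rw [div_lt_one hp0]; exact hp
  have ha : 0 ≤ p / (q - p) - 1 := by
    rw [sub_nonneg, one_le_div he]; linarith
  have hba : p * (q - 1) / (q - p) - 1 = (p - 1) * (p / (q - p) - 1) + 2 * (p - 1) := by
    field_simp; ring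
  have hb : 0 ≤ p * (q - 1) / (q - p) - 1 := by
    rw [hba]; have : 0 < p - 1 := by linarith
    positivity
  generalize p / (q - p) - 1 = a at *
  generalize p * (q - 1) / (q - p) - 1 = b at *
  have hcont : Continuous (fun t : ℝ => t ^ a * (1 - t) ^ b) :=
    (continuous_id.rpow_const (fun _ => Or.inr ha)).mul
      ((continuous_const.sub continuous_id).rpow_const (fun _ => Or.inr hb))
  constructor
  · calc (q - p) * exp (a * log (1 / p - (q - p)) + b * log (1 - 1 / p))
        = ∫ t in (1 / p - (q - p))..(1 / p),
            exp (a * log (1 / p - (q - p)) + b * log (1 - 1 / p)) := by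
          simp
      _ ≤ ∫ t in (1 / p - (q - p))..(1 / p), t ^ a * (1 - t) ^ b := by
          apply intervalIntegral.integral_mono_on (by linarith) (by simp)
            (hcont.intervalIntegrable _ _)
          intro t ht
          have h0 : 0 < 1 / p - (q - p) := by linarith
          have ht0 : 0 < t := by linarith [ht.1]
          have h1 : 0 < 1 - 1 / p := by linarith
          have ht1 : 0 < 1 - t := by linarith [ht.2]
          rw [rpow_def_of_pos ht0, rpow_def_of_pos ht1, ← exp_add, exp_le_exp]
          have := log_le_log h0 ht.1
          have h3 : log (1 - 1 / p) ≤ log (1 - t) := log_le_log h1 (by linarith [ht.2])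
          nlinarith
      _ ≤ ∫ t in (0:ℝ)..1, t ^ a * (1 - t) ^ b := by
          apply intervalIntegral.integral_mono_interval (by linarith) (by linarith) hip.le _
            (hcont.intervalIntegrable _ _)
          filter_upwards [MeasureTheory.ae_restrict_mem measurableSet_Ioc] with t ht
          exact mul_nonneg (rpow_nonneg ht.1.le _) (rpow_nonneg (by linarith [ht.2]) _)
  · calc (∫ t in (0:ℝ)..1, t ^ a * (1 - t) ^ b)
        ≤ ∫ t in (0:ℝ)..1, exp (a * (log (1 / p) + (p - 1) * log (1 - 1 / p))) := by
          apply intervalIntegral.integral_mono_on_of_le_Ioo (by norm_num)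
            (hcont.intervalIntegrable _ _) (by simp)
          intro t ht
          have ht1 : 0 < 1 - t := by linarith [ht.2]
          rw [rpow_def_of_pos ht.1, rpow_def_of_pos ht1, ← exp_add, exp_le_exp, hba]
          have h1 := mul_le_mul_of_nonneg_left (aux_pt p t hp ht.1 ht.2) ha
          have h2 : log (1 - t) ≤ 0 := log_nonpos ht1.le (by linarith [ht.1])
          nlinarith
      _ = _ := by simp

/-- As `q ↓ p`, the sharp universal factor
`k_{q,p} = [(q-p)/(p·B(p/(q-p), p(q-1)/(q-p)))]^{1/p - 1/q}` of the weighted Hardy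
inequality converges to `k_{p,p} = p^{1/p} (p*)^{1/p*}`, where `p* = p/(p-1)`. -/
theorem k_qp_tendsto (p : ℝ) (hp : 1 < p) :
    Tendsto (fun q : ℝ =>
        ((q - p) / (p * ∫ t in (0:ℝ)..1,
            t ^ (p / (q - p) - 1) * (1 - t) ^ (p * (q - 1) / (q - p) - 1)))
          ^ (1 / p - 1 / q))
      (𝓝[>] p)
      (𝓝 (p ^ (1 / p) * (p / (p - 1)) ^ (1 - 1 / p))) := by
  have hp0 : 0 < p := by linarith
  have hp1 : 0 < p - 1 := by linarith
  have hip : 0 < 1 / p := by positivity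
  have e : 1 - 1 / p = (p - 1) / p := by field_simp
  have hL : p ^ (1 / p) * (p / (p - 1)) ^ (1 - 1 / p)
      = exp (1 / (p * p) * (-(p * log (1 / p)) - p * (p - 1) * log (1 - 1 / p))) := by
    rw [rpow_def_of_pos hp0, rpow_def_of_pos (by positivity), ← exp_add, e, one_div,
      log_inv, log_div hp0.ne' hp1.ne', log_div hp1.ne' hp0.ne']
    congr 1
    field_simp
    ring
  rw [hL]
  have hlo : Tendsto (fun q : ℝ => exp (1 / (p * q) * ((q - p) * log (q - p) - (q - p) * log p
      - (p - (q - p)) * (log (1 / p) + (p - 1) * log (1 - 1 / p))))) (𝓝[>] p)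
      (𝓝 (exp (1 / (p * p) * (-(p * log (1 / p)) - p * (p - 1) * log (1 - 1 / p))))) := by
    apply tendsto_nhdsWithin_of_tendsto_nhds
    have hc : ContinuousAt (fun q : ℝ => exp (1 / (p * q) * ((q - p) * log (q - p)
      - (q - p) * log p - (p - (q - p)) * (log (1 / p) + (p - 1) * log (1 - 1 / p))))) p := by
      have h1 : ContinuousAt (fun q : ℝ => (q - p) * log (q - p)) p :=
        (continuous_mul_log.comp (continuous_id.sub continuous_const)).continuousAt
      have h2 : ContinuousAt (fun q : ℝ => 1 / (p * q)) p :=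
        continuousAt_const.div (by fun_prop) (by positivity)
      fun_prop
    convert hc.tendsto using 3
    simp
    ring
  have hhi : Tendsto (fun q : ℝ => exp (1 / (p * q) * (- (q - p) * log p
      - (p - (q - p)) * log (1 / p - (q - p)) - (p * (q - 1) - (q - p)) * log (1 - 1 / p))))
      (𝓝[>] p)
      (𝓝 (exp (1 / (p * p) * (-(p * log (1 / p)) - p * (p - 1) * log (1 - 1 / p))))) := by
    apply tendsto_nhdsWithin_of_tendsto_nhds
    have hc : ContinuousAt (fun q : ℝ => exp (1 / (p * q) * (- (q - p) * log p
      - (p - (q - p)) * log (1 / p - (q - p)) - (p * (q - 1) - (q - p)) * log (1 - 1 / p)))) p := by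
      have h1 : ContinuousAt (fun q : ℝ => log (1 / p - (q - p))) p :=
        ContinuousAt.log (by fun_prop) (by simp; positivity)
      have h2 : ContinuousAt (fun q : ℝ => 1 / (p * q)) p :=
        continuousAt_const.div (by fun_prop) (by positivity)
      fun_prop
    convert hc.tendsto using 3
    simp
  have hev : ∀ᶠ q in 𝓝[>] p, p < q ∧ q - p < 1 / p := by
    filter_upwards [Ioo_mem_nhdsGT (show p < p + 1 / p by linarith)] with q hq
    exact ⟨hq.1, by linarith [hq.2]⟩
  refine tendsto_of_tendsto_of_tendsto_of_le_of_le' hlo hhi ?_ ?_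
  · filter_upwards [hev] with q hq
    obtain ⟨b1, b2⟩ := aux_bounds p q hp hq.1 hq.2
    have he : 0 < q - p := by linarith [hq.1]
    have hq0 : 0 < q := by linarith [hq.1]
    have hI := lt_of_lt_of_le (by positivity) b1
    generalize (∫ t in (0:ℝ)..1, t ^ (p / (q - p) - 1) * (1 - t) ^ (p * (q - 1) / (q - p) - 1))
      = I at *
    rw [rpow_def_of_pos (by positivity), exp_le_exp, log_div he.ne' (by positivity),
      log_mul hp0.ne' hI.ne']
    have hl := (log_le_log hI b2).trans_eq (log_exp _)
    have h3 : 1 / p - 1 / q = 1 / (p * q) * (q - p) := by field_simp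
    rw [h3, mul_comm (log (q - p) - _), mul_assoc]
    apply mul_le_mul_of_nonneg_left _ (by positivity)
    have h4 := mul_le_mul_of_nonneg_left hl he.le
    have h5 : (q - p) * (p / (q - p) - 1) = p - (q - p) := by field_simp
    rw [← mul_assoc, h5] at h4
    linarith
  · filter_upwards [hev] with q hq
    obtain ⟨b1, b2⟩ := aux_bounds p q hp hq.1 hq.2
    have he : 0 < q - p := by linarith [hq.1]
    have hq0 : 0 < q := by linarith [hq.1]
    have hI := lt_of_lt_of_le (by positivity) b1
    generalize (∫ t in (0:ℝ)..1, t ^ (p / (q - p) - 1) * (1 - t) ^ (p * (q - 1) / (q - p) - 1))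
      = I at *
    rw [rpow_def_of_pos (by positivity), exp_le_exp, log_div he.ne' (by positivity),
      log_mul hp0.ne' hI.ne']
    have hl := log_le_log (by positivity) b1
    rw [log_mul he.ne' (exp_pos _).ne', log_exp] at hl
    have h3 : 1 / p - 1 / q = 1 / (p * q) * (q - p) := by field_simp
    rw [h3, mul_comm (log (q - p) - _), mul_assoc]
    apply mul_le_mul_of_nonneg_left _ (by positivity)
    have h4 := mul_le_mul_of_nonneg_left hl he.le
    have h5 : (q - p) * (p / (q - p) - 1) = p - (q - p) := by field_simp
    have h6 : (q - p) * (p * (q - 1) / (q - p) - 1) = p * (q - 1) - (q - p) := by field_simp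
    rw [mul_add, mul_add, ← mul_assoc, ← mul_assoc, h5, h6] at h4
    linarith
end

section
/- Let A be the optimal (least) constant such that (∫_0^1 f(x)² dx)^{1/2} ≤ A·(∫_0^1 f'(x)² dx)^{1/2} holds for every absolutely continuous function f on (0, 1) with f(0) = 0. Then A = 2/π. -/
open MeasureTheory Real Set Filter Topology ENNReal

lemma hardy_finite (f f' : ℝ → ℝ) (hf : ∀ x ∈ Ioo (0:ℝ) 1, HasDerivAt f (f' x) x)
    (hfi : IntegrableOn (fun x => f' x ^ 2) (Ioo 0 1)) (c : ℝ) (hc0 : 0 < c) (hc : c < π / 2)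
    (a b : ℝ) (ha : 0 < a) (hab : a ≤ b) (hb : b < 1) :
    c ^ 2 * ∫ x in Ioc a b, f x ^ 2 ≤
      (∫ x in Ioo (0:ℝ) 1, f' x ^ 2) + c * Real.tan c * f a ^ 2 := by
  have hsub : Icc a b ⊆ Ioo 0 1 := fun x hx => ⟨ha.trans_le hx.1, hx.2.trans_lt hb⟩
  have hcont : ContinuousOn f (Icc a b) := fun x hx =>
    (hf x (hsub hx)).continuousAt.continuousWithinAt
  have hi1 : IntegrableOn (fun x => f' x ^ 2) (Icc a b) := hfi.mono_set hsub
  have hi2 : IntegrableOn (fun x => f x ^ 2) (Icc a b) := (hcont.pow 2).integrableOn_Icc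
  have hpos : ∀ x ∈ Icc a b, 0 < Real.cos (c * (1 - x)) := by
    intro x hx
    have := hsub hx
    apply Real.cos_pos_of_mem_Ioo
    constructor
    · have : 0 < c * (1 - x) := mul_pos hc0 (by linarith [this.2])
      linarith [Real.pi_pos]
    · nlinarith [this.1, this.2]
  have hder : ∀ x ∈ Icc a b, HasDerivAt (fun x => c * (Real.tan (c * (1 - x)) * f x ^ 2))
      (c * ((1 / Real.cos (c * (1 - x)) ^ 2 * (c * (-1))) * f x ^ 2 +
        Real.tan (c * (1 - x)) * (2 * f x * f' x))) x := by
    intro x hx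
    have h1 : HasDerivAt (fun x : ℝ => c * (1 - x)) (c * (-1)) x :=
      ((hasDerivAt_id x).const_sub 1).const_mul c
    have h2 := (Real.hasDerivAt_tan (hpos x hx).ne').comp x h1
    have h3 := (hf x (hsub hx)).pow 2
    have h4 := (h2.mul h3).const_mul c
    refine HasDerivAt.congr_deriv (f := fun x => c * (Real.tan (c * (1 - x)) * f x ^ 2)) h4 ?_
    simp
  have key := intervalIntegral.sub_le_integral_of_hasDeriv_right_of_le hab
    (g := fun x => c * (Real.tan (c * (1 - x)) * f x ^ 2))
    (φ := fun x => f' x ^ 2 - c ^ 2 * f x ^ 2)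
    (fun x hx => (hder x hx).continuousAt.continuousWithinAt)
    (fun x hx => (hder x (Ioo_subset_Icc_self hx)).hasDerivWithinAt)
    (hi1.sub (hi2.const_mul _))
    (by
      intro x hx
      have hp := hpos x (Ioo_subset_Icc_self hx)
      have : 1 / Real.cos (c * (1 - x)) ^ 2 = 1 + Real.tan (c * (1 - x)) ^ 2 := by
        rw [Real.tan_eq_sin_div_cos]
        field_simp
        linarith [Real.sin_sq_add_cos_sq (c * (1 - x))]
      rw [this]
      nlinarith [sq_nonneg (f' x - c * Real.tan (c * (1 - x)) * f x)])
  rw [intervalIntegral.integral_of_le hab, integral_sub (hi1.mono_set Ioc_subset_Icc_self)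
    ((hi2.mono_set Ioc_subset_Icc_self).const_mul _), integral_const_mul] at key
  have hJ : ∫ x in Ioc a b, f' x ^ 2 ≤ ∫ x in Ioo (0:ℝ) 1, f' x ^ 2 :=
    setIntegral_mono_set hfi (Eventually.of_forall fun x => sq_nonneg _)
      (Ioc_subset_Icc_self.trans hsub).eventuallyLE
  have ht1 : 0 ≤ Real.tan (c * (1 - b)) := by
    apply Real.tan_nonneg_of_nonneg_of_le_pi_div_two
    · exact mul_nonneg hc0.le (by linarith)
    · nlinarith
  have ht2 : Real.tan (c * (1 - a)) ≤ Real.tan c := by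
    have h0 : 0 ≤ c * (1 - a) := mul_nonneg hc0.le (by linarith)
    apply Real.strictMonoOn_tan.monotoneOn
    · constructor <;> nlinarith [Real.pi_pos]
    · constructor <;> nlinarith [Real.pi_pos]
    · nlinarith
  have e1 : 0 ≤ c * (Real.tan (c * (1 - b)) * f b ^ 2) := by positivity
  have e2 : c * (Real.tan (c * (1 - a)) * f a ^ 2) ≤ c * (Real.tan c * f a ^ 2) := by gcongr
  linarith

lemma hardy_c (f f' : ℝ → ℝ) (hf : ∀ x ∈ Ioo (0:ℝ) 1, HasDerivAt f (f' x) x)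
    (h0 : Tendsto f (𝓝[>] (0:ℝ)) (𝓝 0)) (c : ℝ) (hc0 : 0 < c) (hc : c < π / 2) :
    ENNReal.ofReal (c ^ 2) * (∫⁻ x in Ioo (0:ℝ) 1, ENNReal.ofReal (f x ^ 2)) ≤
      ∫⁻ x in Ioo (0:ℝ) 1, ENNReal.ofReal (f' x ^ 2) := by
  by_cases hK : (∫⁻ x in Ioo (0:ℝ) 1, ENNReal.ofReal (f' x ^ 2)) = ⊤
  · rw [hK]; exact le_top
  have hm' : AEStronglyMeasurable (fun x => f' x ^ 2) (volume.restrict (Ioo 0 1)) := by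
    have : AEStronglyMeasurable (fun x => deriv f x ^ 2) (volume.restrict (Ioo 0 1)) :=
      ((measurable_deriv f).pow_const 2).aestronglyMeasurable
    refine this.congr ?_
    filter_upwards [ae_restrict_mem measurableSet_Ioo] with x hx
    rw [(hf x hx).deriv]
  have hcontf : ContinuousOn f (Ioo 0 1) := fun x hx => (hf x hx).continuousAt.continuousWithinAt
  have hm : AEMeasurable (fun x => ENNReal.ofReal (f x ^ 2)) (volume.restrict (Ioo 0 1)) :=
    ((hcontf.pow 2).aemeasurable measurableSet_Ioo).ennreal_ofReal
  have hfi : IntegrableOn (fun x => f' x ^ 2) (Ioo 0 1) := by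
    refine ⟨hm', ?_⟩
    rw [hasFiniteIntegral_iff_ofReal (Eventually.of_forall fun x => sq_nonneg _)]
    exact lt_top_iff_ne_top.2 hK
  have hKe := ofReal_integral_eq_lintegral_ofReal hfi (Eventually.of_forall fun x => sq_nonneg _)
  have hu : Tendsto (fun n : ℕ => 1 / ((n : ℝ) + 1)) atTop (𝓝 0) :=
    tendsto_one_div_add_atTop_nhds_zero_nat
  let a : ℕ → ℝ := fun n => (1 / ((n : ℝ) + 1)) / 3
  have ha : Tendsto a atTop (𝓝 0) := by
    have := hu.div_const 3
    rwa [zero_div] at this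
  have hb : Tendsto (fun n => 1 - a n) atTop (𝓝 1) := by simpa using ha.const_sub 1
  have hapos : ∀ n, 0 < a n := fun n => by positivity
  have hale : ∀ n, a n ≤ 1 / 3 := fun n => by
    have : 1 / ((n : ℝ) + 1) ≤ 1 := by
      rw [div_le_one (by positivity)]; linarith [Nat.cast_nonneg (α := ℝ) n]
    simp only [a]; linarith
  have hcov := aecover_Ioo_of_Ioc (μ := volume) ha hb
  have hlim := hcov.lintegral_tendsto_of_countably_generated hm
  have hlim2 := ENNReal.Tendsto.const_mul (a := ENNReal.ofReal (c ^ 2)) hlim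
    (Or.inr ENNReal.ofReal_ne_top)
  have hfa : Tendsto (fun n => f (a n)) atTop (𝓝 0) :=
    h0.comp (tendsto_nhdsWithin_iff.2 ⟨ha, Eventually.of_forall hapos⟩)
  have hr : Tendsto (fun n => ENNReal.ofReal ((∫ x in Ioo (0:ℝ) 1, f' x ^ 2)
      + c * Real.tan c * f (a n) ^ 2)) atTop
      (𝓝 (∫⁻ x in Ioo (0:ℝ) 1, ENNReal.ofReal (f' x ^ 2))) := by
    rw [← hKe]
    apply ENNReal.tendsto_ofReal
    simpa using ((hfa.pow 2).const_mul (c * Real.tan c)).const_add (∫ x in Ioo (0:ℝ) 1, f' x ^ 2)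
  refine le_of_tendsto_of_tendsto' hlim2 hr fun n => ?_
  have h1 := hapos n
  have h2 := hale n
  have hsub : Icc (a n) (1 - a n) ⊆ Ioo 0 1 :=
    fun x hx => ⟨h1.trans_le hx.1, hx.2.trans_lt (by linarith)⟩
  have hi2 : IntegrableOn (fun x => f x ^ 2) (Icc (a n) (1 - a n)) :=
    ((hcontf.mono hsub).pow 2).integrableOn_Icc
  rw [Measure.restrict_restrict measurableSet_Ioc,
    inter_eq_left.2 (Ioc_subset_Icc_self.trans hsub),
    ← ofReal_integral_eq_lintegral_ofReal (hi2.mono_set Ioc_subset_Icc_self)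
      (Eventually.of_forall fun x => sq_nonneg _), ← ENNReal.ofReal_mul (sq_nonneg c)]
  exact ENNReal.ofReal_le_ofReal
    (hardy_finite f f' hf hfi c hc0 hc _ _ h1 (by linarith) (by linarith))

lemma hardy_pi (f f' : ℝ → ℝ) (hf : ∀ x ∈ Ioo (0:ℝ) 1, HasDerivAt f (f' x) x)
    (h0 : Tendsto f (𝓝[>] (0:ℝ)) (𝓝 0)) :
    ENNReal.ofReal ((π / 2) ^ 2) * (∫⁻ x in Ioo (0:ℝ) 1, ENNReal.ofReal (f x ^ 2)) ≤
      ∫⁻ x in Ioo (0:ℝ) 1, ENNReal.ofReal (f' x ^ 2) := by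
  have h1 : Tendsto (fun c : ℝ => ENNReal.ofReal (c ^ 2)) (𝓝[<] (π / 2))
      (𝓝 (ENNReal.ofReal ((π / 2) ^ 2))) :=
    ENNReal.tendsto_ofReal (((continuous_pow 2).tendsto _).mono_left nhdsWithin_le_nhds)
  have h2 := ENNReal.Tendsto.mul_const
    (b := ∫⁻ x in Ioo (0:ℝ) 1, ENNReal.ofReal (f x ^ 2)) h1
    (Or.inl (by simp))
  refine le_of_tendsto h2 ?_
  filter_upwards [Ioo_mem_nhdsLT (show (0:ℝ) < π / 2 by positivity)] with c hc
  exact hardy_c f f' hf h0 c hc.1 hc.2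

/-- The optimal (least) constant in the Hardy-type inequality
`‖f‖_{L²(0,1)} ≤ A ‖f'‖_{L²(0,1)}` for absolutely continuous `f` on `(0,1)`
with `f(0) = 0` equals `2/π`. -/
theorem hardy_unit_interval_p2_q2 :
    IsLeast {A : ℝ | 0 ≤ A ∧ ∀ f f' : ℝ → ℝ,
        (∀ x ∈ Ioo (0:ℝ) 1, HasDerivAt f (f' x) x) →
        Tendsto f (𝓝[>] (0:ℝ)) (𝓝 0) →
        (∫⁻ x in Ioo (0:ℝ) 1, ENNReal.ofReal (f x ^ 2)) ^ ((1:ℝ)/2)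
          ≤ ENNReal.ofReal A *
            (∫⁻ x in Ioo (0:ℝ) 1, ENNReal.ofReal (f' x ^ 2)) ^ ((1:ℝ)/2)}
      (2 / π) := by
  have hpi := Real.pi_pos
  refine ⟨⟨by positivity, fun f f' hf h0 => ?_⟩, ?_⟩
  · have h := hardy_pi f f' hf h0
    have h2 : (∫⁻ x in Ioo (0:ℝ) 1, ENNReal.ofReal (f x ^ 2)) ≤
        ENNReal.ofReal ((2 / π) ^ 2) * ∫⁻ x in Ioo (0:ℝ) 1, ENNReal.ofReal (f' x ^ 2) := by
      calc _ = ENNReal.ofReal ((2 / π) ^ 2) * (ENNReal.ofReal ((π / 2) ^ 2) *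
            (∫⁻ x in Ioo (0:ℝ) 1, ENNReal.ofReal (f x ^ 2))) := by
            rw [← mul_assoc, ← ENNReal.ofReal_mul (by positivity)]
            have : (2 / π) ^ 2 * (π / 2) ^ 2 = 1 := by field_simp
            rw [this]; simp
        _ ≤ _ := by gcongr
    have h3 := ENNReal.rpow_le_rpow h2 (show (0:ℝ) ≤ 1 / 2 by norm_num)
    rwa [ENNReal.mul_rpow_of_nonneg _ _ (by norm_num : (0:ℝ) ≤ 1 / 2),
      ENNReal.ofReal_rpow_of_nonneg (by positivity) (by norm_num), ← Real.sqrt_eq_rpow,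
      Real.sqrt_sq (by positivity)] at h3
  · rintro A ⟨hA, h⟩
    have hlin : ∀ x : ℝ, HasDerivAt (fun x : ℝ => π / 2 * x) (π / 2) x := fun x => by
      simpa using (hasDerivAt_id x).const_mul (π / 2)
    have h := h (fun x => Real.sin (π / 2 * x)) (fun x => Real.cos (π / 2 * x) * (π / 2))
      (fun x _ => (hlin x).sin)
      (by
        have : Continuous fun x : ℝ => Real.sin (π / 2 * x) := by fun_prop
        simpa using (this.tendsto 0).mono_left nhdsWithin_le_nhds)
    have conv : ∀ g : ℝ → ℝ, Continuous g → (∫⁻ x in Ioo (0:ℝ) 1, ENNReal.ofReal (g x ^ 2)) =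
        ENNReal.ofReal (∫ x in (0:ℝ)..1, g x ^ 2) := by
      intro g hg
      rw [intervalIntegral.integral_of_le zero_le_one, integral_Ioc_eq_integral_Ioo,
        ofReal_integral_eq_lintegral_ofReal]
      · exact ((hg.pow 2).integrableOn_Icc).mono_set Ioo_subset_Icc_self
      · exact Eventually.of_forall fun x => sq_nonneg _
    have hs : ∫ x in (0:ℝ)..1, Real.sin (π / 2 * x) ^ 2 = 1 / 2 := by
      rw [intervalIntegral.integral_comp_mul_left (fun x => Real.sin x ^ 2) (by positivity),
        integral_sin_sq]
      simp
      field_simp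
    have hcs : ∫ x in (0:ℝ)..1, (Real.cos (π / 2 * x) * (π / 2)) ^ 2 = (π / 2) ^ 2 * (1 / 2) := by
      simp_rw [mul_pow]
      rw [intervalIntegral.integral_mul_const,
        intervalIntegral.integral_comp_mul_left (fun x => Real.cos x ^ 2) (by positivity),
        integral_cos_sq]
      simp
      field_simp
    rw [conv _ (by fun_prop), conv _ (by fun_prop), hs, hcs,
      ENNReal.ofReal_rpow_of_nonneg (by positivity) (by norm_num),
      ENNReal.ofReal_rpow_of_nonneg (by positivity) (by norm_num),
      ← ENNReal.ofReal_mul hA, ENNReal.ofReal_le_ofReal_iff (by positivity),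
      ← Real.sqrt_eq_rpow, ← Real.sqrt_eq_rpow, Real.sqrt_mul (by positivity),
      Real.sqrt_sq (by positivity)] at h
    have hp : 0 < √(1 / 2 : ℝ) := by positivity
    have h5 : 1 ≤ A * (π / 2) := by
      by_contra hlt
      push Not at hlt
      nlinarith
    rw [div_le_iff₀ hpi]
    linarith
end

section
/- Fix p ∈ (1, ∞) and let A be the optimal (least) constant such that (∫_0^1 |f(x)|^p dx)^{1/p} ≤ A·(∫_0^1 |f'(x)|^p dx)^{1/p} holds for every absolutely continuous function f on (0, 1) with f(0) = 0. Then A = p·sin(π/p) / (π·(p-1)^{1/p}). -/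
open MeasureTheory Real Set Filter Topology ENNReal

lemma exists_psi (p : ℝ) (hp : 1 < p) : ∃ ψ : ℝ → ℝ, Continuous ψ ∧ ψ 0 = 0 ∧ ψ 1 = 1 ∧
    ∀ x ∈ Ioo (0:ℝ) 1, ψ x ∈ Ioo (0:ℝ) 1 ∧
      HasDerivAt ψ (π / Real.sin (π / p) * (ψ x) ^ (1 - 1/p) * (1 - ψ x) ^ (1/p)) x := by
  have hp0 : 0 < p := by linarith
  have ha : 0 < 1 / p := by positivity
  have ha1 : 1 / p < 1 := by rw [div_lt_one hp0]; exact hp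
  have hb : 0 < 1 - 1 / p := by linarith
  have hB : ProbabilityTheory.beta (1/p) (1 - 1/p) = π / Real.sin (π / p) := by
    rw [ProbabilityTheory.beta, Real.Gamma_mul_Gamma_one_sub]
    simp [div_eq_mul_inv]
  set v := ProbabilityTheory.betaPDFReal (1/p) (1 - 1/p) with hv
  have hvnn : ∀ x, 0 ≤ v x := by
    intro x
    by_cases hx : 0 < x ∧ x < 1
    · exact (ProbabilityTheory.betaPDFReal_pos hx.1 hx.2 ha hb).le
    · rw [hv, ProbabilityTheory.betaPDFReal, if_neg hx]
  have hvm : Measurable v := ProbabilityTheory.measurable_betaPDFReal _ _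
  have hl : ∫⁻ x, ENNReal.ofReal (v x) = 1 := ProbabilityTheory.lintegral_betaPDF_eq_one ha hb
  have hvi : Integrable v := by
    refine ⟨hvm.aestronglyMeasurable, ?_⟩
    rw [hasFiniteIntegral_iff_ofReal (ae_of_all _ hvnn), hl]; simp
  have hv1 : ∫ x, v x = 1 := by
    rw [integral_eq_lintegral_of_nonneg_ae (ae_of_all _ hvnn) hvm.aestronglyMeasurable, hl]; simp
  set k : ℝ → ℝ := indicator (Ioo (0:ℝ) 1) (fun _ => (1:ℝ)) with hk
  have hki : Integrable k := by
    rw [hk, integrable_indicator_iff measurableSet_Ioo]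
    exact integrableOn_const (by simp)
  have hk1 : ∫ x, k x = 1 := by
    rw [hk, integral_indicator measurableSet_Ioo]; simp
  set h : ℝ → ℝ := fun x => v x - k x with hh
  have hhi : Integrable h := hvi.sub hki
  have hh0 : ∫ x, h x = 0 := by
    rw [hh, integral_sub hvi hki, hv1, hk1]; simp
  have hout : ∀ x, x ∉ Ioo (0:ℝ) 1 → h x = 0 := by
    intro x hx
    have : ¬ (0 < x ∧ x < 1) := hx
    simp only [hh, hk, hv, ProbabilityTheory.betaPDFReal, if_neg this, indicator_of_notMem hx, sub_zero]
  have hin : ∀ x ∈ Ioo (0:ℝ) 1, 1 + h x = v x := by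
    intro x hx
    simp [hh, hk, indicator_of_mem hx]
  have hpos : ∀ x, 0 < 1 + h x := by
    intro x
    by_cases hx : x ∈ Ioo (0:ℝ) 1
    · rw [hin x hx]; exact ProbabilityTheory.betaPDFReal_pos hx.1 hx.2 ha hb
    · rw [hout x hx]; simp
  set G : ℝ → ℝ := fun t => t + ∫ u in (0:ℝ)..t, h u with hG
  have hGc : Continuous G :=
    continuous_id.add (intervalIntegral.continuous_primitive (fun a b => hhi.intervalIntegrable) 0)
  have hGm : StrictMono G := by
    intro a b hab
    have h1 : 0 < ∫ u in a..b, (1 + h u) :=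
      intervalIntegral.intervalIntegral_pos_of_pos (intervalIntegrable_const.add hhi.intervalIntegrable) hpos hab
    rw [intervalIntegral.integral_add intervalIntegrable_const hhi.intervalIntegrable] at h1
    have h2 := intervalIntegral.integral_interval_sub_left (μ := volume) (f := h) (a := 0) (b := b) (c := a)
      hhi.intervalIntegrable hhi.intervalIntegrable
    simp at h1
    simp only [hG]; linarith
  have hG1 : ∀ t, 1 ≤ t → G t = t := by
    intro t ht
    have : ∫ u in (0:ℝ)..t, h u = 0 := by
      rw [intervalIntegral.integral_of_le (by linarith), setIntegral_eq_integral_of_forall_compl_eq_zero, hh0]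
      intro x hx
      apply hout
      intro hx'
      exact hx ⟨hx'.1, by linarith [hx'.2]⟩
    simp [hG, this]
  have hG0 : ∀ t, t ≤ 0 → G t = t := by
    intro t ht
    have : ∫ u in (0:ℝ)..t, h u = ∫ u in (0:ℝ)..t, 0 := by
      apply intervalIntegral.integral_congr
      intro x hx
      rw [uIcc_of_ge ht] at hx
      apply hout
      intro hx'
      linarith [hx.2, hx'.1]
    simp [hG, this]
  have hGs : Function.Surjective G := by
    apply hGc.surjective
    · exact tendsto_id.congr' ((eventually_ge_atTop 1).mono fun t ht => (hG1 t ht).symm)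
    · exact tendsto_id.congr' ((eventually_le_atBot 0).mono fun t ht => (hG0 t ht).symm)
  set e := hGm.orderIsoOfSurjective G hGs with he
  have heG : ∀ t, e t = G t := fun t => rfl
  have hGe : ∀ y, G (e.symm y) = y := fun y => hGm.orderIsoOfSurjective_self_symm_apply G hGs y
  have e0 : e.symm 0 = 0 := by rw [OrderIso.symm_apply_eq, heG, hG0 0 le_rfl]
  have e1 : e.symm 1 = 1 := by rw [OrderIso.symm_apply_eq, heG, hG1 1 le_rfl]
  refine ⟨e.symm, e.symm.continuous, e0, e1, ?_⟩
  intro x hx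
  have hmem : e.symm x ∈ Ioo (0:ℝ) 1 := by
    constructor
    · rw [← e0]; exact e.symm.strictMono hx.1
    · rw [← e1]; exact e.symm.strictMono hx.2
  refine ⟨hmem, ?_⟩
  set y := e.symm x with hy
  have hev : ∀ᶠ u in 𝓝 y, h u = (1 / ProbabilityTheory.beta (1/p) (1 - 1/p) * u ^ (1/p - 1) * (1 - u) ^ (1 - 1/p - 1)) - 1 := by
    filter_upwards [Ioo_mem_nhds hmem.1 hmem.2] with u hu
    have := hin u hu
    rw [hv, ProbabilityTheory.betaPDFReal, if_pos (show 0 < u ∧ u < 1 from hu)] at this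
    linarith
  have hcont : ContinuousAt h y := by
    refine ContinuousAt.congr ?_ (hev.mono fun _ h => h.symm)
    have h1 : ContinuousAt (fun u : ℝ => u ^ (1/p - 1)) y := continuousAt_rpow_const _ _ (Or.inl hmem.1.ne')
    have h2 : ContinuousAt (fun u : ℝ => (1 - u) ^ (1 - 1/p - 1)) y :=
      ContinuousAt.rpow_const (by fun_prop) (Or.inl (by linarith [hmem.2]))
    fun_prop
  have hd : HasDerivAt G (1 + h y) y := by
    apply (hasDerivAt_id y).add
    exact intervalIntegral.integral_hasDerivAt_right hhi.intervalIntegrable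
      (hhi.aestronglyMeasurable.stronglyMeasurableAtFilter) hcont
  have := HasDerivAt.of_local_left_inverse (g := e.symm) e.symm.continuous.continuousAt hd (hpos y).ne'
    (Eventually.of_forall hGe)
  refine HasDerivAt.congr_deriv this ?_
  have hq := hin y hmem
  rw [hq, hv, ProbabilityTheory.betaPDFReal, if_pos (show 0 < y ∧ y < 1 from hmem), hB]
  have hy1 : 0 < 1 - y := by linarith [hmem.2]
  rw [mul_inv, mul_inv, ← Real.rpow_neg hmem.1.le, ← Real.rpow_neg hy1.le, one_div, inv_inv]
  ring_nf


lemma riccati (p c : ℝ) (hp : 1 < p) (hc : 0 < c) (ψ : ℝ → ℝ) (x : ℝ) (hm : ψ x ∈ Ioo (0:ℝ) 1)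
    (hd : HasDerivAt ψ (p * c * (ψ x) ^ (1 - 1/p) * (1 - ψ x) ^ (1/p)) x) :
    0 < c ^ (p-1) * ((ψ x)⁻¹ - 1) ^ (1 - 1/p) ∧
    HasDerivAt (fun x => c ^ (p-1) * ((ψ x)⁻¹ - 1) ^ (1 - 1/p))
      (-((p-1) * c ^ p + (p-1) * (c ^ (p-1) * ((ψ x)⁻¹ - 1) ^ (1 - 1/p)) ^ (p/(p-1)))) x := by
  have hp0 : 0 < p := by linarith
  have hp1 : p - 1 ≠ 0 := by linarith
  have hy := hm.1
  have hy1 : 0 < 1 - ψ x := by linarith [hm.2]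
  have hz : 0 < (ψ x)⁻¹ - 1 := by
    have := (one_lt_inv₀ hy).2 hm.2
    linarith
  refine ⟨by positivity, ?_⟩
  have h1 : HasDerivAt (fun x => (ψ x)⁻¹ - 1) _ x := (hd.inv hy.ne').sub_const 1
  have h2 := (h1.rpow_const (p := 1 - 1/p) (Or.inl hz.ne')).const_mul (c ^ (p-1))
  refine h2.congr_deriv ?_
  have e1 : (c ^ (p-1) * ((ψ x)⁻¹ - 1) ^ (1 - 1/p)) ^ (p/(p-1)) = c ^ p * ((ψ x)⁻¹ - 1) := by
    rw [Real.mul_rpow (by positivity) (by positivity), ← Real.rpow_mul hc.le, ← Real.rpow_mul hz.le]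
    have a1 : (p - 1) * (p / (p-1)) = p := by field_simp
    have a2 : (1 - 1/p) * (p / (p-1)) = 1 := by field_simp
    rw [a1, a2, Real.rpow_one]
  have e2 : ((ψ x)⁻¹ - 1) ^ (1 - 1/p - 1) = (1 - ψ x) ^ (-(1/p)) * (ψ x) ^ (1/p) := by
    have : (ψ x)⁻¹ - 1 = (1 - ψ x) * (ψ x)⁻¹ := by field_simp
    rw [this, Real.mul_rpow hy1.le (by positivity), Real.inv_rpow hy.le, ← Real.rpow_neg hy.le]
    congr 2 <;> ring
  have e3 : (ψ x) ^ (1 - 1/p) * (ψ x) ^ (1/p) = ψ x := by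
    rw [← Real.rpow_add hy]; simp
  have e4 : (1 - ψ x) ^ (1/p) * (1 - ψ x) ^ (-(1/p)) = 1 := by
    rw [← Real.rpow_add hy1]; simp
  have e5 : c ^ p = c ^ (p-1) * c := by
    rw [← Real.rpow_add_one hc.ne']; simp
  rw [e1, e2, e5]
  generalize (ψ x) ^ (1 - 1/p) = Y1 at *
  generalize (ψ x) ^ (1/p) = Y2 at *
  generalize (1 - ψ x) ^ (1/p) = Z1 at *
  generalize (1 - ψ x) ^ (-(1/p)) = Z2 at *
  have : c ^ (p - 1) * (-(p * c * Y1 * Z1) / ψ x ^ 2 * (1 - 1 / p) * (Z2 * Y2))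
     = - (c ^ (p-1) * (p * c * (1 - 1/p)) * (Y1 * Y2) * (Z1 * Z2) / ψ x ^ 2) := by ring
  rw [this, e3, e4]
  field_simp
  ring

lemma young_pt (p g u d : ℝ) (hp : 1 < p) (hg : 0 < g) :
    g * (p * |u| ^ (p-2) * u * d) ≤ |d| ^ p + (p-1) * g ^ (p/(p-1)) * |u| ^ p := by
  have hp0 : 0 < p := by linarith
  have hp1 : 0 < p - 1 := by linarith
  rcases eq_or_ne u 0 with rfl | hu
  · have : 0 ≤ |d| ^ p := by positivity
    simp [Real.zero_rpow hp0.ne', this]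
  have hu' : 0 < |u| := abs_pos.2 hu
  have hpq : p.HolderConjugate (p/(p-1)) := Real.HolderConjugate.conjExponent hp
  have hY := Real.young_inequality_of_nonneg (abs_nonneg d) (b := g * |u| ^ (p-1)) (by positivity) hpq
  have e1 : (g * |u| ^ (p-1)) ^ (p/(p-1)) = g ^ (p/(p-1)) * |u| ^ p := by
    rw [Real.mul_rpow hg.le (by positivity), ← Real.rpow_mul hu'.le]
    congr 2; field_simp
  have e2 : |u| ^ (p-1) = |u| ^ (p-2) * |u| := by
    rw [← Real.rpow_add_one hu'.ne']; congr 1; ring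
  have hY2 : p * (|d| * (g * |u| ^ (p-1))) ≤ |d| ^ p + (p-1) * (g ^ (p/(p-1)) * |u| ^ p) := by
    rw [e1] at hY
    calc _ ≤ p * _ := mul_le_mul_of_nonneg_left hY hp0.le
      _ = _ := by field_simp
  have e3 : u * d ≤ |u| * |d| := by rw [← abs_mul]; exact le_abs_self _
  calc g * (p * |u| ^ (p-2) * u * d) = (g * p * |u| ^ (p-2)) * (u * d) := by ring
    _ ≤ (g * p * |u| ^ (p-2)) * (|u| * |d|) := by gcongr
    _ = p * (|d| * (g * |u| ^ (p-1))) := by rw [e2]; ring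
    _ ≤ _ := by linarith

lemma real_ineq (p l : ℝ) (hp : 1 < p) (hl : 0 < l) (g : ℝ → ℝ)
    (hg : ∀ x ∈ Ioo (0:ℝ) 1, 0 < g x ∧ HasDerivAt g (-(l + (p-1) * (g x) ^ (p/(p-1)))) x)
    (f f' : ℝ → ℝ) (hf : ∀ x ∈ Ioo (0:ℝ) 1, HasDerivAt f (f' x) x)
    (hf0 : Tendsto f (𝓝[>] (0:ℝ)) (𝓝 0))
    (hi : IntegrableOn (fun x => |f' x| ^ p) (Ioo 0 1))
    (a b : ℝ) (ha : 0 < a) (hab : a < b) (hb : b < 1) :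
    l * ∫ x in a..b, |f x| ^ p ≤ ∫ x in Ioo (0:ℝ) 1, |f' x| ^ p := by
  have hp0 : 0 < p := by linarith
  set J := ∫ x in Ioo (0:ℝ) 1, |f' x| ^ p with hJ
  have hfc : ∀ s, 0 < s → ContinuousOn (fun x => |f x| ^ p) (Icc s b) := by
    intro s hs x hx
    have : ContinuousAt f x := (hf x ⟨by linarith [hx.1], by linarith [hx.2]⟩).continuousAt
    exact (this.abs.rpow_const (Or.inr hp0.le)).continuousWithinAt
  obtain ⟨ε, hε, hεb⟩ : ∃ ε > 0, b + ε < 1 := ⟨(1-b)/2, by linarith, by linarith⟩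
  have key : ∀ s ∈ Ioo 0 a, l * (∫ x in a..b, |f x| ^ p) ≤ J + g (s + ε) * |f s| ^ p := by
    intro s hs
    have hsb : s ≤ b := by linarith [hs.2]
    have hder : ∀ x ∈ Icc s b, HasDerivAt (fun x => g (x + ε) * |f x| ^ p)
        (-(l + (p-1) * (g (x+ε)) ^ (p/(p-1))) * |f x| ^ p
          + g (x + ε) * (p * |f x| ^ (p-2) * f x * f' x)) x := by
      intro x hx
      have hx1 : x + ε ∈ Ioo (0:ℝ) 1 := ⟨by linarith [hx.1, hs.1], by linarith [hx.2]⟩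
      have hx2 : x ∈ Ioo (0:ℝ) 1 := ⟨by linarith [hx.1, hs.1], by linarith [hx.2]⟩
      have h1 := (hg _ hx1).2.comp_add_const x ε
      have h2 := (hasDerivAt_abs_rpow (f x) hp).comp x (hf x hx2)
      exact h1.mul h2
    have hint1 : IntegrableOn (fun x => |f' x| ^ p) (Icc s b) :=
      hi.mono_set fun x hx => ⟨by linarith [hx.1, hs.1], by linarith [hx.2]⟩
    have hint2 : IntegrableOn (fun x => |f x| ^ p) (Icc s b) :=
      (hfc s hs.1).integrableOn_Icc
    have hint3 : IntegrableOn (fun x => l * |f x| ^ p) (Icc s b) := hint2.const_mul l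
    have hmain := intervalIntegral.sub_le_integral_of_hasDeriv_right_of_le hsb
      (g := fun x => g (x + ε) * |f x| ^ p) (φ := fun x => |f' x| ^ p - l * |f x| ^ p)
      (fun x hx => (hder x hx).continuousAt.continuousWithinAt)
      (fun x hx => (hder x (Ioo_subset_Icc_self hx)).hasDerivWithinAt)
      (hint1.sub hint3)
      (fun x hx => by
        have hx1 : x + ε ∈ Ioo (0:ℝ) 1 := ⟨by linarith [hx.1, hs.1], by linarith [hx.2]⟩
        have := young_pt p (g (x + ε)) (f x) (f' x) hp (hg _ hx1).1
        linarith)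
    rw [intervalIntegral.integral_sub
      ((intervalIntegrable_iff_integrableOn_Icc_of_le hsb).2 hint1)
      ((intervalIntegrable_iff_integrableOn_Icc_of_le hsb).2 hint3),
      intervalIntegral.integral_const_mul] at hmain
    have m1 : ∫ x in s..b, |f' x| ^ p ≤ J := by
      rw [intervalIntegral.integral_of_le hsb]
      refine setIntegral_mono_set hi (ae_of_all _ fun x => by positivity) (LE.le.eventuallyLE ?_)
      intro x hx
      exact ⟨by linarith [hx.1, hs.1], by linarith [hx.2]⟩
    have m2 : ∫ x in a..b, |f x| ^ p ≤ ∫ x in s..b, |f x| ^ p := by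
      rw [intervalIntegral.integral_of_le hsb, intervalIntegral.integral_of_le hab.le]
      refine setIntegral_mono_set (hint2.mono_set Ioc_subset_Icc_self) (ae_of_all _ fun x => by positivity)
        (LE.le.eventuallyLE ?_)
      exact Ioc_subset_Ioc_left hs.2.le
    have m3 : 0 ≤ g (b + ε) * |f b| ^ p := by
      have := (hg (b+ε) ⟨by linarith, hεb⟩).1
      positivity
    have m4 := mul_le_mul_of_nonneg_left m2 hl.le
    linarith
  have hlim : Tendsto (fun s => J + g (s + ε) * |f s| ^ p) (𝓝[>] 0) (𝓝 (J + g (0 + ε) * |(0:ℝ)| ^ p)) := by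
    have h1 : ContinuousAt (fun s => g (s + ε)) 0 := by
      have : ContinuousAt g (0 + ε) := (hg _ ⟨by linarith, by linarith⟩).2.continuousAt
      exact ContinuousAt.comp (f := fun s => s + ε) this (by fun_prop)
    have h2 : Tendsto (fun s => |f s| ^ p) (𝓝[>] 0) (𝓝 (|(0:ℝ)| ^ p)) :=
      hf0.abs.rpow_const (Or.inr hp0.le)
    exact ((h1.tendsto.mono_left nhdsWithin_le_nhds).mul h2).const_add J
  have := ge_of_tendsto hlim (by
    filter_upwards [Ioo_mem_nhdsGT ha] with s hs using key s hs)
  simpa [Real.zero_rpow hp0.ne'] using this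

lemma upper (p l : ℝ) (hp : 1 < p) (hl : 0 < l) (g : ℝ → ℝ)
    (hg : ∀ x ∈ Ioo (0:ℝ) 1, 0 < g x ∧ HasDerivAt g (-(l + (p-1) * (g x) ^ (p/(p-1)))) x)
    (f f' : ℝ → ℝ) (hf : ∀ x ∈ Ioo (0:ℝ) 1, HasDerivAt f (f' x) x)
    (hf0 : Tendsto f (𝓝[>] (0:ℝ)) (𝓝 0)) :
    (∫⁻ x in Ioo (0:ℝ) 1, ENNReal.ofReal |f x| ^ p) ^ (1/p)
          ≤ ENNReal.ofReal ((1/l) ^ (1/p)) *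
            (∫⁻ x in Ioo (0:ℝ) 1, ENNReal.ofReal |f' x| ^ p) ^ (1/p) := by
  have hp0 : 0 < p := by linarith
  have hconv : ∀ u : ℝ, ENNReal.ofReal |u| ^ p = ENNReal.ofReal (|u| ^ p) := fun u =>
    ENNReal.ofReal_rpow_of_nonneg (abs_nonneg u) hp0.le
  simp_rw [hconv]
  rw [← ENNReal.ofReal_rpow_of_nonneg (by positivity) (by positivity),
    ← ENNReal.mul_rpow_of_nonneg _ _ (by positivity)]
  refine ENNReal.rpow_le_rpow ?_ (by positivity)
  by_cases hfin : ∫⁻ x in Ioo (0:ℝ) 1, ENNReal.ofReal (|f' x| ^ p) = ⊤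
  · rw [hfin, ENNReal.mul_top]
    · exact le_top
    · simp [hl]
  have hmeas : AEStronglyMeasurable (fun x => |f' x| ^ p) (volume.restrict (Ioo (0:ℝ) 1)) := by
    have h1 : Measurable (fun x => |deriv f x| ^ p) := by
      have := measurable_deriv f
      fun_prop
    refine h1.aestronglyMeasurable.congr ?_
    refine (ae_restrict_iff' measurableSet_Ioo).2 (ae_of_all _ fun x hx => ?_)
    simp only [(hf x hx).deriv]
  have hi : IntegrableOn (fun x => |f' x| ^ p) (Ioo 0 1) := by
    refine ⟨hmeas, ?_⟩
    rw [hasFiniteIntegral_iff_ofReal (ae_of_all _ fun x => by positivity)]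
    exact lt_top_iff_ne_top.2 hfin
  have hfc : ContinuousOn (fun x => |f x| ^ p) (Ioo 0 1) := by
    intro x hx
    exact ((hf x hx).continuousAt.abs.rpow_const (Or.inr hp0.le)).continuousWithinAt
  rw [← ofReal_integral_eq_lintegral_ofReal hi (ae_of_all _ fun x => by positivity),
    ← ENNReal.ofReal_mul (by positivity)]
  have hcov : AECover (volume.restrict (Ioo (0:ℝ) 1)) (𝓝[>] (0:ℝ)) (fun s => Ioc s (1 - s)) := by
    apply aecover_Ioo_of_Ioc
    · exact tendsto_id.mono_left nhdsWithin_le_nhds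
    · have : Tendsto (fun s : ℝ => 1 - s) (𝓝 0) (𝓝 (1 - 0)) := by
        apply Continuous.tendsto; fun_prop
      rw [sub_zero] at this
      exact this.mono_left nhdsWithin_le_nhds
  have htend := hcov.lintegral_tendsto_of_countably_generated (f := fun x => ENNReal.ofReal (|f x| ^ p))
    (hfc.aemeasurable measurableSet_Ioo).ennreal_ofReal
  refine le_of_tendsto htend ?_
  filter_upwards [Ioo_mem_nhdsGT (show (0:ℝ) < 1/2 by norm_num)] with s hs
  have hs1 : s < 1 - s := by linarith [hs.2]
  have hs0 : 1 - s < 1 := by linarith [hs.1]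
  have hsub : Ioc s (1 - s) ⊆ Ioo (0:ℝ) 1 := fun x hx => ⟨by linarith [hx.1, hs.1], by linarith [hx.2]⟩
  have hsub' : Icc s (1 - s) ⊆ Ioo (0:ℝ) 1 := fun x hx => ⟨by linarith [hx.1, hs.1], by linarith [hx.2]⟩
  have hr := real_ineq p l hp hl g hg f f' hf hf0 hi s (1 - s) hs.1 hs1 hs0
  rw [Measure.restrict_restrict measurableSet_Ioc, inter_eq_left.2 hsub,
    ← ofReal_integral_eq_lintegral_ofReal
      (((hfc.mono hsub').integrableOn_Icc).mono_set Ioc_subset_Icc_self) (ae_of_all _ fun x => by positivity)]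
  apply ENNReal.ofReal_le_ofReal
  rw [intervalIntegral.integral_of_le hs1.le] at hr
  rw [one_div, ← div_eq_inv_mul, le_div_iff₀ hl]
  linarith

lemma extremal_integral (p c : ℝ) (hp : 1 < p) (hc : 0 < c) (ψ : ℝ → ℝ) (hψ : Continuous ψ)
    (h0 : ψ 0 = 0) (h1 : ψ 1 = 1)
    (hd : ∀ x ∈ Ioo (0:ℝ) 1, ψ x ∈ Ioo (0:ℝ) 1 ∧
      HasDerivAt ψ (p * c * (ψ x) ^ (1 - 1/p) * (1 - ψ x) ^ (1/p)) x) :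
    ∫ x in Ioo (0:ℝ) 1, ψ x = 1 / p := by
  have hp0 : 0 < p := by linarith
  have ha : 0 < 1 / p := by positivity
  have ha1 : 1 / p < 1 := by rw [div_lt_one hp0]; exact hp
  have hb : 0 < 1 - 1 / p := by linarith
  have key := intervalIntegral.integral_eq_sub_of_hasDerivAt_of_le (a := 0) (b := 1) zero_le_one
    (f := fun x => (1 - ψ x) ^ (1 - 1/p) * (ψ x) ^ (1/p)) (f' := fun x => c * (1 - p * ψ x))
    (by
      apply Continuous.continuousOn
      apply Continuous.mul
      · exact Continuous.rpow_const (by fun_prop) fun x => Or.inr hb.le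
      · exact Continuous.rpow_const (by fun_prop) fun x => Or.inr ha.le)
    (by
      intro x hx
      obtain ⟨hm, hx'⟩ := hd x hx
      have hy := hm.1
      have hy1 : 0 < 1 - ψ x := by linarith [hm.2]
      have d1 := (hx'.const_sub 1).rpow_const (p := 1 - 1/p) (Or.inl hy1.ne')
      have d2 := hx'.rpow_const (p := 1/p) (Or.inl hy.ne')
      refine (d1.mul d2).congr_deriv ?_
      have e1 : (ψ x) ^ (1/p) * (ψ x) ^ (1 - 1/p) = ψ x := by
        rw [← Real.rpow_add hy]; simp
      have e2 : (ψ x) ^ (1 - 1/p) * (ψ x) ^ (1/p - 1) = 1 := by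
        rw [← Real.rpow_add hy]; simp
      have e3 : (1 - ψ x) ^ (1/p) * (1 - ψ x) ^ (1 - 1/p) = 1 - ψ x := by
        rw [← Real.rpow_add hy1]; simp
      have e4 : (1 - ψ x) ^ (1/p) * (1 - ψ x) ^ (1 - 1/p - 1) = 1 := by
        rw [← Real.rpow_add hy1]; simp
      generalize (ψ x) ^ (1 - 1/p) = Y1 at *
      generalize (ψ x) ^ (1/p) = Y2 at *
      generalize (ψ x) ^ (1/p - 1) = Y3 at *
      generalize (1 - ψ x) ^ (1/p) = Z1 at *
      generalize (1 - ψ x) ^ (1 - 1/p) = Z2 at *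
      generalize (1 - ψ x) ^ (1 - 1/p - 1) = Z3 at *
      have : -(p * c * Y1 * Z1) * (1 - 1 / p) * Z3 * Y2 + Z2 * (p * c * Y1 * Z1 * (1 / p) * Y3)
        = -(p * c * (1 - 1/p)) * (Y2 * Y1) * (Z1 * Z3) + (p * (1/p)) * c * (Y1 * Y3) * (Z1 * Z2) := by ring
      rw [this, e1, e2, e3, e4]
      field_simp
      ring)
    (by
      apply Continuous.intervalIntegrable; fun_prop)
  rw [h0, h1, intervalIntegral.integral_const_mul, intervalIntegral.integral_sub
    (by simp) (Continuous.intervalIntegrable (by fun_prop) _ _), intervalIntegral.integral_const_mul,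
    intervalIntegral.integral_of_le zero_le_one, intervalIntegral.integral_of_le zero_le_one,
    integral_Ioc_eq_integral_Ioo, integral_Ioc_eq_integral_Ioo] at key
  simp only [sub_self, Real.zero_rpow hb.ne', Real.zero_rpow ha.ne', zero_mul, mul_zero] at key
  have k2 := (mul_eq_zero.1 key).resolve_left hc.ne'
  simp at k2
  field_simp
  linarith

lemma lower (p c : ℝ) (hp : 1 < p) (hc : 0 < c) (ψ : ℝ → ℝ) (hψ : Continuous ψ)
    (h0 : ψ 0 = 0) (h1 : ψ 1 = 1)
    (hd : ∀ x ∈ Ioo (0:ℝ) 1, ψ x ∈ Ioo (0:ℝ) 1 ∧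
      HasDerivAt ψ (p * c * (ψ x) ^ (1 - 1/p) * (1 - ψ x) ^ (1/p)) x)
    (A : ℝ) (hA : 0 ≤ A) (H : ∀ f f' : ℝ → ℝ,
        (∀ x ∈ Ioo (0:ℝ) 1, HasDerivAt f (f' x) x) →
        Tendsto f (𝓝[>] (0:ℝ)) (𝓝 0) →
        (∫⁻ x in Ioo (0:ℝ) 1, ENNReal.ofReal |f x| ^ p) ^ (1/p)
          ≤ ENNReal.ofReal A *
            (∫⁻ x in Ioo (0:ℝ) 1, ENNReal.ofReal |f' x| ^ p) ^ (1/p)) :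
    (1 / ((p-1) * c ^ p)) ^ (1/p) ≤ A := by
  have hp0 : 0 < p := by linarith
  have hp1 : 0 < p - 1 := by linarith
  have ha : 0 < 1 / p := by positivity
  have ha1 : 1 / p < 1 := by rw [div_lt_one hp0]; exact hp
  have hb : 0 < 1 - 1 / p := by linarith
  have hI := extremal_integral p c hp hc ψ hψ h0 h1 hd
  have hint : IntegrableOn ψ (Ioo 0 1) := (hψ.continuousOn.integrableOn_Icc).mono_set Ioo_subset_Icc_self
  have hint2 : IntegrableOn (fun x => c ^ p * (1 - ψ x)) (Ioo 0 1) :=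
    ((by fun_prop : Continuous fun x => c ^ p * (1 - ψ x)).continuousOn.integrableOn_Icc).mono_set
      Ioo_subset_Icc_self
  have HH := H (fun x => (ψ x) ^ (1/p)) (fun x => c * (1 - ψ x) ^ (1/p))
    (by
      intro x hx
      obtain ⟨hm, hx'⟩ := hd x hx
      refine (hx'.rpow_const (p := 1/p) (Or.inl hm.1.ne')).congr_deriv ?_
      have e2 : (ψ x) ^ (1 - 1/p) * (ψ x) ^ (1/p - 1) = 1 := by
        rw [← Real.rpow_add hm.1]; simp
      calc _ = (p * (1/p)) * c * ((ψ x) ^ (1 - 1/p) * (ψ x) ^ (1/p - 1)) * (1 - ψ x) ^ (1/p) := by ring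
        _ = _ := by rw [e2]; field_simp)
    (by
      have : Continuous fun x => (ψ x) ^ (1/p) := hψ.rpow_const fun x => Or.inr ha.le
      have h2 := this.tendsto 0
      simp only [h0, Real.zero_rpow ha.ne'] at h2
      exact h2.mono_left nhdsWithin_le_nhds)
  have L1 : ∫⁻ x in Ioo (0:ℝ) 1, ENNReal.ofReal |(ψ x) ^ (1/p)| ^ p = ENNReal.ofReal (1/p) := by
    rw [← hI, ofReal_integral_eq_lintegral_ofReal hint]
    · refine setLIntegral_congr_fun measurableSet_Ioo fun x hx => ?_
      have hm := (hd x hx).1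
      have hy := hm.1
      rw [abs_of_nonneg (by positivity), ENNReal.ofReal_rpow_of_nonneg (by positivity) hp0.le,
        ← Real.rpow_mul hy.le, hI, one_div_mul_cancel hp0.ne', Real.rpow_one]
    · exact (ae_restrict_iff' measurableSet_Ioo).2 (ae_of_all _ fun x hx => (hd x hx).1.1.le)
  have L2 : ∫⁻ x in Ioo (0:ℝ) 1, ENNReal.ofReal |c * (1 - ψ x) ^ (1/p)| ^ p
      = ENNReal.ofReal (c ^ p * (1 - 1/p)) := by
    have : c ^ p * (1 - 1/p) = ∫ x in Ioo (0:ℝ) 1, c ^ p * (1 - ψ x) := by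
      rw [integral_const_mul, integral_sub (integrable_const (1:ℝ)) hint, hI]
      simp
    rw [this, ofReal_integral_eq_lintegral_ofReal hint2]
    · refine setLIntegral_congr_fun measurableSet_Ioo fun x hx => ?_
      have hm := (hd x hx).1
      have hy : 0 < 1 - ψ x := by linarith [hm.2]
      rw [abs_of_nonneg (by positivity), ENNReal.ofReal_rpow_of_nonneg (by positivity) hp0.le,
        Real.mul_rpow hc.le (by positivity),
        ← Real.rpow_mul hy.le, one_div_mul_cancel hp0.ne', Real.rpow_one]
    · refine (ae_restrict_iff' measurableSet_Ioo).2 (ae_of_all _ fun x hx => ?_)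
      have : 0 < 1 - ψ x := by linarith [(hd x hx).1.2]
      show 0 ≤ c ^ p * (1 - ψ x)
      positivity
  rw [L1, L2, ENNReal.ofReal_rpow_of_nonneg (by positivity) ha.le,
    ENNReal.ofReal_rpow_of_nonneg (by positivity) ha.le, ← ENNReal.ofReal_mul hA,
    ENNReal.ofReal_le_ofReal_iff (by positivity)] at HH
  have hX : 0 < c ^ p * (1 - 1/p) := by positivity
  have e : 1 / p = (1 / ((p-1) * c ^ p)) * (c ^ p * (1 - 1/p)) := by
    have : c ^ p ≠ 0 := by positivity
    field_simp
  have e' : (1 / p) ^ (1/p) = (1 / ((p-1) * c ^ p)) ^ (1/p) * (c ^ p * (1 - 1/p)) ^ (1/p) := by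
    rw [← Real.mul_rpow (by positivity) hX.le, ← e]
  rw [e'] at HH
  exact le_of_mul_le_mul_right HH (by positivity)

/-- The optimal (least) constant in the Hardy-type inequality
`‖f‖_{L^p(0,1)} ≤ A ‖f'‖_{L^p(0,1)}` for absolutely continuous `f` on `(0,1)`
with `f(0) = 0` equals `p sin(π/p) / (π (p-1)^{1/p})`. -/
theorem hardy_unit_interval_p_eq_q (p : ℝ) (hp : 1 < p) :
    IsLeast {A : ℝ | 0 ≤ A ∧ ∀ f f' : ℝ → ℝ,
        (∀ x ∈ Ioo (0:ℝ) 1, HasDerivAt f (f' x) x) →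
        Tendsto f (𝓝[>] (0:ℝ)) (𝓝 0) →
        (∫⁻ x in Ioo (0:ℝ) 1, ENNReal.ofReal |f x| ^ p) ^ (1/p)
          ≤ ENNReal.ofReal A *
            (∫⁻ x in Ioo (0:ℝ) 1, ENNReal.ofReal |f' x| ^ p) ^ (1/p)}
      (p * Real.sin (π / p) / (π * (p - 1) ^ (1/p))) := by
  have hp0 : 0 < p := by linarith
  have hp1 : 0 < p - 1 := by linarith
  have hs : 0 < Real.sin (π / p) :=
    Real.sin_pos_of_pos_of_lt_pi (by positivity) (div_lt_self Real.pi_pos hp)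
  obtain ⟨c, hcdef⟩ : ∃ c, c = π / (p * Real.sin (π / p)) := ⟨_, rfl⟩
  have hc : 0 < c := by rw [hcdef]; positivity
  have hpc : π / Real.sin (π / p) = p * c := by rw [hcdef]; field_simp
  obtain ⟨ψ, hψ, h0, h1, hd⟩ := exists_psi p hp
  rw [hpc] at hd
  have hA : p * Real.sin (π / p) / (π * (p - 1) ^ (1/p)) = (1 / ((p-1) * c ^ p)) ^ (1/p) := by
    rw [Real.div_rpow zero_le_one (by positivity), Real.mul_rpow hp1.le (by positivity),
      ← Real.rpow_mul hc.le, mul_one_div_cancel hp0.ne', Real.rpow_one, Real.one_rpow, hcdef]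
    field_simp
  rw [hA]
  refine ⟨⟨by positivity, fun f f' hf hf0 => ?_⟩, fun A hA' => ?_⟩
  · exact upper p ((p-1) * c ^ p) hp (by positivity)
      (fun x => c ^ (p-1) * ((ψ x)⁻¹ - 1) ^ (1 - 1/p))
      (fun x hx => riccati p c hp hc ψ x (hd x hx).1 (hd x hx).2) f f' hf hf0
  · exact lower p c hp hc ψ hψ h0 h1 hd A hA'.1 hA'.2
end
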